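/- Interior Hölder continuity of solutions: Let Y = (y,s) ∈ ℝ^{n+1}, r > 0, and let u ∈ C^{2,1}(Q_r(Y)) ∩ C(closure of Q_r(Y)) satisfy −u_t + Lu = 0 at every point of Q_r(Y). Then u is Hölder continuous in Q_{r/2}(Y): there exist a constant α ∈ (0,1) and a constant N > 0, both depending only on n, ν and S, such that for all X = (x,t) and X' = (x',t') in Q_{r/2}(Y), |u(X) − u(X')| ≤ N · (sup_{Q_r(Y)} |u|) · ((|x−x'| + |t−t'|^{1/2})/r)^α. -/

import Mathlib

open MeasureTheory ENNReal Metric Set RealInnerProductSpace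

noncomputable section

/-- `n`-dimensional Euclidean space. -/
abbrev En (n : ℕ) : Type := EuclideanSpace ℝ (Fin n)

variable {n : ℕ}

/-- Time derivative `u_t`. -/
def Dt (u : En n × ℝ → ℝ) (X : En n × ℝ) : ℝ :=
  deriv (fun t => u (X.1, t)) X.2

/-- First spatial derivative `D_i u`. -/
def Dx (u : En n × ℝ → ℝ) (i : Fin n) (X : En n × ℝ) : ℝ :=
  fderiv ℝ (fun x => u (x, X.2)) X.1 (EuclideanSpace.single i 1)

/-- Second spatial derivative `D_{ij} u`. -/
def Dxx (u : En n × ℝ → ℝ) (i j : Fin n) (X : En n × ℝ) : ℝ :=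
  Dx (Dx u j) i X

/-- `u` is of class `C^{2,1}` on `Q`: `u`, `D_i u`, `D_{ij} u`, `u_t` exist and are
continuous on `Q`. -/
structure IsC21 (u : En n × ℝ → ℝ) (Q : Set (En n × ℝ)) : Prop where
  cont : ContinuousOn u Q
  diff_t : ∀ X ∈ Q, DifferentiableAt ℝ (fun t => u (X.1, t)) X.2
  diff_x : ∀ X ∈ Q, DifferentiableAt ℝ (fun x => u (x, X.2)) X.1
  diff_xx : ∀ j : Fin n, ∀ X ∈ Q, DifferentiableAt ℝ (fun x => Dx u j (x, X.2)) X.1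
  cont_t : ContinuousOn (Dt u) Q
  cont_x : ∀ i, ContinuousOn (Dx u i) Q
  cont_xx : ∀ i j, ContinuousOn (Dxx u i j) Q

/-- Uniform parabolicity with constant `ν` on `Q`:
`ν⁻¹|ξ|² ≤ Σ a_ij ξ_i ξ_j` and `Σ a_ij² ≤ ν²`. -/
def UnifParabolic (ν : ℝ) (a : En n × ℝ → Matrix (Fin n) (Fin n) ℝ)
    (Q : Set (En n × ℝ)) : Prop :=
  ∀ X ∈ Q, (∀ ξ : Fin n → ℝ, ν⁻¹ * (∑ i, ξ i ^ 2) ≤ ∑ i, ∑ j, a X i j * ξ i * ξ j) ∧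
    (∑ i, ∑ j, (a X i j) ^ 2) ≤ ν ^ 2

/-- `Lu = Σ_{ij} a_ij D_ij u + Σ_i b_i D_i u`. -/
def Lop (a : En n × ℝ → Matrix (Fin n) (Fin n) ℝ) (b : En n × ℝ → En n)
    (u : En n × ℝ → ℝ) (X : En n × ℝ) : ℝ :=
  (∑ i, ∑ j, a X i j * Dxx u i j X) + ∑ i, b X i * Dx u i X

/-- `∫ (ess sup_t |f(x,t)|)ⁿ dx`, the `n`-th power of the `L^n_x L^∞_t` norm of `f`
over the set `Q ⊆ ℝⁿ × ℝ`. -/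
def LxnLtinfPow {E : Type*} [NNNorm E] (f : En n × ℝ → E) (Q : Set (En n × ℝ)) : ℝ≥0∞ :=
  ∫⁻ x, (essSup (fun t => (‖f (x, t)‖₊ : ℝ≥0∞)) (volume.restrict {t | (x, t) ∈ Q})) ^ n

/-- The `L^n_x L^∞_t` norm of `f` over `Q`. -/
def LxnLtinf {E : Type*} [NNNorm E] (f : En n × ℝ → E) (Q : Set (En n × ℝ)) : ℝ≥0∞ :=
  (LxnLtinfPow f Q) ^ (1 / (n : ℝ))

/-- The box `B_ρ(y) × (t₁, t₂)`. -/
def box (y : En n) (ρ t₁ t₂ : ℝ) : Set (En n × ℝ) := ball y ρ ×ˢ Ioo t₁ t₂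

/-- The standard parabolic cylinder `Q_r(Y) = B_r(y) × (s - r², s)`. -/
def pcyl (Y : En n × ℝ) (r : ℝ) : Set (En n × ℝ) := box Y.1 r (Y.2 - r ^ 2) Y.2

/-- The slanted cylinder `V_r(Y) = {(x,t) : |x - (t/s)y| < r, 0 < t < s}`. -/
def slantCyl (Y : En n × ℝ) (r : ℝ) : Set (En n × ℝ) :=
  {X | ‖X.1 - (X.2 / Y.2) • Y.1‖ < r ∧ 0 < X.2 ∧ X.2 < Y.2}

/-- Supremum of the positive part `u₊` over a set `A`. -/
def supPos (u : En n × ℝ → ℝ) (A : Set (En n × ℝ)) : ℝ :=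
  sSup ((fun X => max (u X) 0) '' A)

/-- `Ω` is a Lipschitz domain with character `(rΩ, mΩ)`: at every boundary point `y`
there is a coordinate frame, encoded by the unit "vertical" direction `e`, in which
`Ω ∩ B_{rΩ}(y)` is the region above the graph of an `mΩ`-Lipschitz function `φ`
of the tangential variables. -/
def IsLipschitzDomain (Ω : Set (En n)) (rΩ mΩ : ℝ) : Prop :=
  0 < rΩ ∧ 0 ≤ mΩ ∧
  ∀ y ∈ frontier Ω, ∃ (e : En n) (φ : En n → ℝ),
    ‖e‖ = 1 ∧ LipschitzWith (Real.toNNReal mΩ) φ ∧ φ 0 = 0 ∧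
    (∀ x, x ∈ Ω ∩ ball y rΩ ↔
      dist x y < rΩ ∧ φ ((x - y) - ⟪x - y, e⟫ • e) < ⟪x - y, e⟫) ∧
    (∀ ρ : ℝ, 0 < ρ → ρ ≤ rΩ → y + ρ • e ∈ Ω)

open scoped NNReal

/-! ### Basic structures -/

structure Reg (u ut : En n × ℝ → ℝ) (G : En n × ℝ → En n) (H : En n × ℝ → En n →L[ℝ] En n)
    (Q : Set (En n × ℝ)) : Prop where
  dt : ∀ X ∈ Q, HasDerivAt (fun t => u (X.1, t)) (ut X) X.2
  dx : ∀ X ∈ Q, HasFDerivAt (fun x => u (x, X.2)) (innerSL ℝ (G X)) X.1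
  dxx : ∀ X ∈ Q, HasFDerivAt (fun x => G (x, X.2)) (H X) X.1
  cu : ContinuousOn u Q
  cut : ContinuousOn ut Q
  cG : ContinuousOn G Q
  cH : ContinuousOn H Q

def Ell (ν : ℝ) (A : Matrix (Fin n) (Fin n) ℝ) : Prop :=
  (∀ ξ : Fin n → ℝ, ν⁻¹ * (∑ i, ξ i ^ 2) ≤ ∑ i, ∑ j, A i j * ξ i * ξ j) ∧
    (∑ i, ∑ j, (A i j) ^ 2) ≤ ν ^ 2

def trA (A : Matrix (Fin n) (Fin n) ℝ) (L : En n →L[ℝ] En n) : ℝ :=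
  ∑ i, ∑ j, A i j * (L (EuclideanSpace.single i 1)) j

def Super (ν : ℝ) (β : En n → ℝ≥0∞) (u : En n × ℝ → ℝ) (Q : Set (En n × ℝ)) : Prop :=
  ∃ ut G H, Reg u ut G H Q ∧ ∀ X ∈ Q, ∃ A, Ell ν A ∧
    ENNReal.ofReal (trA A (H X) - ut X) ≤ β X.1 * ‖G X‖ₑ

/-- trace -/
def trc (L : En n →L[ℝ] En n) : ℝ := ∑ i, (L (EuclideanSpace.single i 1)) i

def PSD (L : En n →L[ℝ] En n) : Prop :=
  (∀ x y, ⟪L x, y⟫ = ⟪x, L y⟫) ∧ ∀ x, 0 ≤ ⟪L x, x⟫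

def matOf (L : En n →L[ℝ] En n) : Matrix (Fin n) (Fin n) ℝ :=
  Matrix.of fun i j => (L (EuclideanSpace.single i 1)) j

lemma matOf_apply (L : En n →L[ℝ] En n) (i j : Fin n) :
    matOf L i j = (L (EuclideanSpace.single i 1)) j := rfl

lemma en_sum (x : En n) : x = ∑ i, x i • (EuclideanSpace.single i (1:ℝ) : En n) := by
  ext j
  simp [Pi.single_apply]

lemma clm_apply_coord (L : En n →L[ℝ] En n) (x : En n) (j : Fin n) :
    (L x) j = ∑ i, x i * matOf L i j := by
  conv_lhs => rw [en_sum x]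
  simp [matOf_apply]

lemma inner_clm (L : En n →L[ℝ] En n) (x y : En n) :
    ⟪L x, y⟫ = ∑ i, ∑ j, matOf L i j * x i * y j := by
  rw [PiLp.inner_apply]
  simp only [clm_apply_coord, RCLike.inner_apply, conj_trivial]
  rw [Finset.sum_comm]
  simp only [Finset.mul_sum]
  rw [Finset.sum_comm]
  rw [Finset.sum_comm]
  refine Finset.sum_congr rfl fun i _ => ?_
  refine Finset.sum_congr rfl fun j _ => ?_
  ring

open scoped MatrixOrder Matrix.Norms.L2Operator in
lemma PSD.fac {L : En n →L[ℝ] En n} (h : PSD L) :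
    ∃ B : Matrix (Fin n) (Fin n) ℝ, ∀ i j, matOf L i j = ∑ k, B k i * B k j := by
  have hp : (matOf L).PosSemidef := by
    rw [Matrix.posSemidef_iff_dotProduct_mulVec]
    constructor
    · refine Matrix.IsHermitian.ext fun i j => ?_
      have := h.1 (EuclideanSpace.single i (1:ℝ)) (EuclideanSpace.single j (1:ℝ))
      rw [EuclideanSpace.inner_single_right, EuclideanSpace.inner_single_left] at this
      simp only [one_mul, map_one, conj_trivial] at this
      rw [star_trivial, matOf_apply, matOf_apply]
      exact this.symm
    · intro x
      have := h.2 (WithLp.toLp 2 x)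
      rw [inner_clm] at this
      simp only [dotProduct, Matrix.mulVec, star_trivial, Finset.mul_sum]
      refine this.trans (le_of_eq ?_)
      refine Finset.sum_congr rfl fun i _ => ?_
      refine Finset.sum_congr rfl fun j _ => ?_
      simp; ring
  obtain ⟨B, hB⟩ := CStarAlgebra.nonneg_iff_eq_star_mul_self.1 hp.nonneg
  refine ⟨B, fun i j => ?_⟩
  rw [hB, Matrix.mul_apply]
  simp

lemma trc_eq (L : En n →L[ℝ] En n) : trc L = ∑ i, matOf L i i := rfl

lemma PSD.trc_nonneg {L : En n →L[ℝ] En n} (h : PSD L) : 0 ≤ trc L := by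
  obtain ⟨B, hB⟩ := h.fac
  rw [trc_eq]
  refine Finset.sum_nonneg fun i _ => ?_
  rw [hB]; exact Finset.sum_nonneg fun k _ => mul_self_nonneg _

lemma PSD.trA_ge {L : En n →L[ℝ] En n} (h : PSD L) {ν : ℝ} {A : Matrix (Fin n) (Fin n) ℝ}
    (hA : Ell ν A) : ν⁻¹ * trc L ≤ trA A L := by
  obtain ⟨B, hB⟩ := h.fac
  have e1 : trA A L = ∑ k, ∑ i, ∑ j, A i j * B k i * B k j := by
    have : trA A L = ∑ i, ∑ j, A i j * matOf L i j := rfl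
    rw [this]
    simp only [hB, Finset.mul_sum]
    conv_rhs => rw [Finset.sum_comm]
    refine Finset.sum_congr rfl fun i _ => ?_
    rw [Finset.sum_comm]
    refine Finset.sum_congr rfl fun j _ => ?_
    refine Finset.sum_congr rfl fun k _ => ?_
    ring
  have e2 : trc L = ∑ k, ∑ i, B k i ^ 2 := by
    rw [trc_eq, Finset.sum_comm]
    refine Finset.sum_congr rfl fun i _ => ?_
    rw [hB]
    refine Finset.sum_congr rfl fun k _ => ?_
    ring
  rw [e1, e2, Finset.mul_sum]
  exact Finset.sum_le_sum fun k _ => hA.1 (B k)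

lemma PSD.entry_le {L : En n →L[ℝ] En n} (h : PSD L) (i j : Fin n) :
    |matOf L i j| ≤ trc L := by
  obtain ⟨B, hB⟩ := h.fac
  have hd : ∀ i, matOf L i i ≤ trc L := by
    intro i
    rw [trc_eq]
    refine Finset.single_le_sum (f := fun i => matOf L i i) (fun i _ => ?_) (Finset.mem_univ i)
    simp only [hB]; exact Finset.sum_nonneg fun k _ => mul_self_nonneg _
  have h1 : |matOf L i j| ≤ (matOf L i i + matOf L j j) / 2 := by
    rw [hB, hB i i, hB j j, ← Finset.sum_add_distrib, Finset.sum_div]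
    refine (Finset.abs_sum_le_sum_abs _ _).trans (Finset.sum_le_sum fun k _ => ?_)
    rw [abs_le]
    constructor <;> nlinarith [sq_nonneg (B k i - B k j), sq_nonneg (B k i + B k j)]
  linarith [hd i, hd j]

lemma det_matOf (L : En n →L[ℝ] En n) : L.det = (matOf L).det := by
  rw [← Matrix.det_transpose]
  have : (matOf L).transpose = LinearMap.toMatrix (EuclideanSpace.basisFun (Fin n) ℝ).toBasis
      (EuclideanSpace.basisFun (Fin n) ℝ).toBasis (L : En n →ₗ[ℝ] En n) := by
    ext i j
    simp [LinearMap.toMatrix_apply, matOf_apply]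
  rw [this, LinearMap.det_toMatrix]

lemma PSD.det_le {L : En n →L[ℝ] En n} (h : PSD L) :
    |L.det| ≤ n.factorial * trc L ^ n := by
  rw [det_matOf]
  have := Matrix.det_le (A := matOf L) (abv := AbsoluteValue.abs) (x := trc L)
    (fun i j => h.entry_le i j)
  simpa using this

lemma norm_le_of_entry {L : En n →L[ℝ] En n} {T : ℝ} (hT : 0 ≤ T)
    (h : ∀ i j, |matOf L i j| ≤ T) : ‖L‖ ≤ n * T := by
  refine L.opNorm_le_bound (by positivity) fun x => ?_
  have h1 : ∀ j, |(L x) j| ≤ T * ∑ i, |x i| := by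
    intro j
    rw [clm_apply_coord, Finset.mul_sum]
    refine (Finset.abs_sum_le_sum_abs _ _).trans (Finset.sum_le_sum fun k _ => ?_)
    rw [abs_mul, mul_comm]
    exact mul_le_mul_of_nonneg_right (h _ _) (abs_nonneg _)
  have h2 : (∑ i, |x i|) ^ 2 ≤ n * ‖x‖ ^ 2 := by
    have := sq_sum_le_card_mul_sum_sq (s := Finset.univ) (f := fun i => |x i|)
    simp only [sq_abs, Finset.card_univ, Fintype.card_fin] at this
    rw [EuclideanSpace.real_norm_sq_eq]; exact this
  have h3 : ‖L x‖ ^ 2 ≤ (n * T * ‖x‖) ^ 2 := by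
    rw [EuclideanSpace.real_norm_sq_eq]
    calc ∑ j, (L x) j ^ 2 ≤ ∑ j : Fin n, (T * ∑ i, |x i|) ^ 2 := by
          refine Finset.sum_le_sum fun j _ => ?_
          rw [← sq_abs]
          exact pow_le_pow_left₀ (abs_nonneg _) (h1 j) 2
      _ = n * T ^ 2 * (∑ i, |x i|) ^ 2 := by simp; ring
      _ ≤ n * T ^ 2 * (n * ‖x‖ ^ 2) := by gcongr
      _ = _ := by ring
  exact (sq_le_sq₀ (norm_nonneg _) (by positivity)).1 h3

lemma PSD.norm_le {L : En n →L[ℝ] En n} (h : PSD L) : ‖L‖ ≤ n * trc L :=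
  norm_le_of_entry h.trc_nonneg h.entry_le

lemma trA_add (A : Matrix (Fin n) (Fin n) ℝ) (L M : En n →L[ℝ] En n) :
    trA A (L + M) = trA A L + trA A M := by
  simp [trA, mul_add, Finset.sum_add_distrib]

lemma trA_smul (A : Matrix (Fin n) (Fin n) ℝ) (c : ℝ) (M : En n →L[ℝ] En n) :
    trA A (c • M) = c * trA A M := by
  simp only [trA, Finset.mul_sum]
  refine Finset.sum_congr rfl fun i _ => Finset.sum_congr rfl fun j _ => ?_
  simp; ring

lemma trA_neg (A : Matrix (Fin n) (Fin n) ℝ) (M : En n →L[ℝ] En n) :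
    trA A (-M) = - trA A M := by simp [trA]

lemma trA_sub (A : Matrix (Fin n) (Fin n) ℝ) (L M : En n →L[ℝ] En n) :
    trA A (L - M) = trA A L - trA A M := by
  rw [sub_eq_add_neg, trA_add, trA_neg, sub_eq_add_neg]

lemma Ell.entry {ν : ℝ} (hν : 0 ≤ ν) {A : Matrix (Fin n) (Fin n) ℝ} (hA : Ell ν A) (i j : Fin n) :
    |A i j| ≤ ν := by
  have h1 : A i j ^ 2 ≤ ν ^ 2 := by
    refine le_trans ?_ hA.2
    refine le_trans ?_ (Finset.single_le_sum (f := fun i => ∑ j, A i j ^ 2)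
      (fun i _ => Finset.sum_nonneg fun j _ => sq_nonneg _) (Finset.mem_univ i))
    exact Finset.single_le_sum (f := fun j => A i j ^ 2) (fun j _ => sq_nonneg _)
      (Finset.mem_univ j)
  exact abs_le_of_sq_le_sq h1 hν

lemma Ell.trA_abs_le {ν : ℝ} (hν : 0 ≤ ν) {A : Matrix (Fin n) (Fin n) ℝ} (hA : Ell ν A)
    (L : En n →L[ℝ] En n) : |trA A L| ≤ n ^ 2 * ν * ‖L‖ := by
  have h1 : ∀ i j, |(L (EuclideanSpace.single i 1)) j| ≤ ‖L‖ := by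
    intro i j
    have h2 := PiLp.norm_apply_le (L (EuclideanSpace.single i (1:ℝ))) j
    have h3 := L.le_opNorm (EuclideanSpace.single i (1:ℝ))
    simp at h3
    rw [Real.norm_eq_abs] at h2
    linarith
  calc |trA A L| ≤ ∑ i, ∑ j, |A i j * (L (EuclideanSpace.single i 1)) j| :=
        (Finset.abs_sum_le_sum_abs _ _).trans
          (Finset.sum_le_sum fun i _ => Finset.abs_sum_le_sum_abs _ _)
    _ ≤ ∑ i : Fin n, ∑ j : Fin n, ν * ‖L‖ := by
        refine Finset.sum_le_sum fun i _ => Finset.sum_le_sum fun j _ => ?_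
        rw [abs_mul]
        exact mul_le_mul (hA.entry hν i j) (h1 i j) (abs_nonneg _) hν
    _ = _ := by simp; ring

lemma trA_id (A : Matrix (Fin n) (Fin n) ℝ) :
    trA A (ContinuousLinearMap.id ℝ (En n)) = ∑ i, A i i := by
  simp [trA]

lemma Ell.trA_id_le {ν : ℝ} (hν : 0 ≤ ν) {A : Matrix (Fin n) (Fin n) ℝ} (hA : Ell ν A) :
    trA A (ContinuousLinearMap.id ℝ (En n)) ≤ n * ν := by
  rw [trA_id]
  calc ∑ i, A i i ≤ ∑ i : Fin n, ν :=
        Finset.sum_le_sum fun i _ => (le_abs_self _).trans (hA.entry hν i i)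
    _ = _ := by simp

/-- rank one map `v ↦ ⟪x,v⟫ x` -/
def rk1 (x : En n) : En n →L[ℝ] En n := (innerSL ℝ x).smulRight x

lemma trA_rk1 (A : Matrix (Fin n) (Fin n) ℝ) (x : En n) :
    trA A (rk1 x) = ∑ i, ∑ j, A i j * x i * x j := by
  simp only [trA, rk1]
  refine Finset.sum_congr rfl fun i _ => Finset.sum_congr rfl fun j _ => ?_
  simp [EuclideanSpace.inner_single_right]; ring

lemma Ell.trA_rk1_ge {ν : ℝ} {A : Matrix (Fin n) (Fin n) ℝ} (hA : Ell ν A) (x : En n) :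
    ν⁻¹ * ‖x‖ ^ 2 ≤ trA A (rk1 x) := by
  rw [trA_rk1, EuclideanSpace.real_norm_sq_eq]
  exact hA.1 x

lemma Super.mono {ν : ℝ} {β : En n → ℝ≥0∞} {u : En n × ℝ → ℝ} {Q Q' : Set (En n × ℝ)}
    (h : Super ν β u Q) (hQ : Q' ⊆ Q) : Super ν β u Q' := by
  obtain ⟨ut, G, H, hr, hs⟩ := h
  exact ⟨ut, G, H, ⟨fun X hX => hr.dt X (hQ hX), fun X hX => hr.dx X (hQ hX),
    fun X hX => hr.dxx X (hQ hX), hr.cu.mono hQ, hr.cut.mono hQ, hr.cG.mono hQ, hr.cH.mono hQ⟩,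
    fun X hX => hs X (hQ hX)⟩

open Filter Topology in
lemma deriv_nonpos_of_left {f : ℝ → ℝ} {f' t : ℝ} (h : HasDerivAt f f' t)
    (hm : ∀ᶠ s in 𝓝[<] t, f t ≤ f s) : f' ≤ 0 := by
  have h1 : Tendsto (slope f t) (𝓝[<] t) (𝓝 f') :=
    (hasDerivAt_iff_tendsto_slope.1 h).mono_left (nhdsWithin_mono _ (fun s hs => ne_of_lt hs))
  refine le_of_tendsto h1 ?_
  filter_upwards [hm, self_mem_nhdsWithin] with s hs hlt
  rw [slope_def_field]
  exact div_nonpos_of_nonneg_of_nonpos (by linarith) (by simpa using le_of_lt hlt)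

open Filter Topology in
lemma hess_symm {f : En n → ℝ} {g : En n → En n} {L : En n →L[ℝ] En n} {x₀ : En n}
    (hf : ∀ᶠ x in 𝓝 x₀, HasFDerivAt f (innerSL ℝ (g x)) x) (hg : HasFDerivAt g L x₀) :
    ∀ x y, ⟪L x, y⟫ = ⟪x, L y⟫ := by
  let I : En n →L[ℝ] (En n →L[ℝ] ℝ) := innerSL ℝ
  have h1 : HasFDerivAt (fun x => I (g x)) (I.comp L) x₀ := I.hasFDerivAt.comp x₀ hg
  intro x y
  have := second_derivative_symmetric_of_eventually (𝕜 := ℝ) (f := f) (f' := fun x => I (g x)) hf h1 x y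
  have h2 : ⟪L x, y⟫ = ⟪L y, x⟫ := this
  rw [h2, real_inner_comm]

open Filter Topology in
lemma line_mvt {f : En n → ℝ} {g : En n → En n} {x₀ v : En n} {ρ : ℝ}
    (hf : ∀ x ∈ ball x₀ ρ, HasFDerivAt f (innerSL ℝ (g x)) x) (hv : ‖v‖ < ρ) :
    ∃ σ ∈ Ioo (0:ℝ) 1, f (x₀ + v) - f x₀ = ⟪g (x₀ + σ • v), v⟫ := by
  have hmem : ∀ s ∈ Icc (0:ℝ) 1, x₀ + s • v ∈ ball x₀ ρ := by
    intro s hs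
    rw [mem_ball, dist_eq_norm, add_sub_cancel_left, norm_smul, Real.norm_eq_abs, abs_of_nonneg hs.1]
    nlinarith [norm_nonneg v, hs.2]
  have hd : ∀ s ∈ Icc (0:ℝ) 1, HasDerivAt (fun s : ℝ => f (x₀ + s • v)) ⟪g (x₀ + s • v), v⟫ s := by
    intro s hs
    have h1 : HasDerivAt (fun s : ℝ => x₀ + s • v) v s := by
      simpa using ((hasDerivAt_id s).smul_const v).const_add x₀
    exact (hf _ (hmem s hs)).comp_hasDerivAt s h1
  obtain ⟨σ, hσ, h⟩ := exists_hasDerivAt_eq_slope (fun s : ℝ => f (x₀ + s • v))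
    (fun s => ⟪g (x₀ + s • v), v⟫) zero_lt_one
    (fun s hs => (hd s hs).continuousAt.continuousWithinAt)
    (fun s hs => hd s ⟨hs.1.le, hs.2.le⟩)
  refine ⟨σ, hσ, ?_⟩
  rw [h]; simp

open Filter Topology in
lemma hess_psd {f : En n → ℝ} {g : En n → En n} {L : En n →L[ℝ] En n} {x₀ : En n}
    (hf : ∀ᶠ x in 𝓝 x₀, HasFDerivAt f (innerSL ℝ (g x)) x) (hg : HasFDerivAt g L x₀)
    (hm : IsLocalMin f x₀) : g x₀ = 0 ∧ PSD L := by
  have hg0 : g x₀ = 0 := by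
    have h1 := hm.hasFDerivAt_eq_zero hf.self_of_nhds
    have h2 : innerSL ℝ (g x₀) (g x₀) = 0 := by rw [h1]; simp
    simpa using h2
  refine ⟨hg0, hess_symm hf hg, fun v => ?_⟩
  by_contra hneg
  push Not at hneg
  have hv : v ≠ 0 := by rintro rfl; simp at hneg
  have hv' : 0 < ‖v‖ := norm_pos_iff.2 hv
  set c := -⟪L v, v⟫ with hc
  have hcpos : 0 < c := by linarith
  have hε : 0 < c / (2 * ‖v‖ ^ 2) := by positivity
  obtain ⟨ρ1, hρ1, h1⟩ := Metric.eventually_nhds_iff_ball.1 hf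
  obtain ⟨ρ2, hρ2, h2⟩ := Metric.eventually_nhds_iff_ball.1 hm
  obtain ⟨ρ3, hρ3, h3⟩ := Metric.eventually_nhds_iff_ball.1
    ((hasFDerivAt_iff_isLittleO.1 hg).def hε)
  set ρ := min ρ1 (min ρ2 ρ3) with hρdef
  have hρ : 0 < ρ := by positivity
  set s := ρ / (2 * ‖v‖) with hs
  have hspos : 0 < s := by positivity
  have hsv : ‖s • v‖ < ρ := by
    rw [norm_smul, Real.norm_eq_abs, abs_of_pos hspos, hs]
    have : ρ / (2 * ‖v‖) * ‖v‖ = ρ / 2 := by field_simp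
    rw [this]; linarith
  obtain ⟨σ, hσ, he⟩ := line_mvt (v := s • v) (fun x hx => h1 x hx)
    (hsv.trans_le (min_le_left _ _))
  have hb : ∀ τ ∈ Ioc (0:ℝ) 1, x₀ + τ • s • v ∈ ball x₀ ρ := by
    intro τ hτ
    rw [mem_ball, dist_eq_norm, add_sub_cancel_left, norm_smul, Real.norm_eq_abs,
      abs_of_nonneg hτ.1.le]
    nlinarith [norm_nonneg (s • v), hτ.2]
  have e1 : f x₀ ≤ f (x₀ + s • v) := by
    have := h2 (x₀ + (1:ℝ) • s • v)
      (ball_subset_ball ((min_le_right _ _).trans (min_le_left _ _)) (hb 1 (by simp)))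
    simpa using this
  have e2 := h3 (x₀ + σ • s • v)
      (ball_subset_ball ((min_le_right _ _).trans (min_le_right _ _)) (hb σ ⟨hσ.1, hσ.2.le⟩))
  rw [hg0, sub_zero, add_sub_cancel_left] at e2
  have e3 : ⟪g (x₀ + σ • s • v) - L (σ • s • v), v⟫ ≤ σ * s * (c / 2) := by
    refine (real_inner_le_norm _ _).trans ?_
    refine (mul_le_mul_of_nonneg_right e2 hv'.le).trans ?_
    rw [norm_smul, norm_smul, Real.norm_eq_abs, Real.norm_eq_abs, abs_of_pos hspos, abs_of_pos hσ.1]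
    apply le_of_eq
    field_simp
  rw [inner_sub_left, map_smul, map_smul, inner_smul_left, inner_smul_left] at e3
  simp only [conj_trivial] at e3
  rw [inner_smul_right] at he
  have e4 : 0 ≤ ⟪g (x₀ + σ • s • v), v⟫ := by
    have : 0 ≤ s * ⟪g (x₀ + σ • s • v), v⟫ := by linarith
    exact nonneg_of_mul_nonneg_right this hspos
  have e5 : 0 < σ * s := mul_pos hσ.1 hspos
  have e6 : ⟪L v, v⟫ = -c := by rw [hc]; ring
  rw [e6] at e3
  nlinarith

open Filter Topology in
lemma taylor_le {f : En n → ℝ} {g : En n → En n} {L : En n →L[ℝ] En n} {x₀ : En n}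
    (hf : ∀ᶠ x in 𝓝 x₀, HasFDerivAt f (innerSL ℝ (g x)) x) (hg : HasFDerivAt g L x₀)
    {c : ℝ} (hc : ‖L‖ < c) :
    ∃ ρ > 0, ∀ h : En n, ‖h‖ < ρ → f (x₀ + h) ≤ f x₀ + ⟪g x₀, h⟫ + c * ‖h‖ ^ 2 := by
  obtain ⟨ρ1, hρ1, h1⟩ := Metric.eventually_nhds_iff_ball.1 hf
  obtain ⟨ρ3, hρ3, h3⟩ := Metric.eventually_nhds_iff_ball.1
    ((hasFDerivAt_iff_isLittleO.1 hg).def (sub_pos.2 hc))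
  refine ⟨min ρ1 ρ3, by positivity, fun h hh => ?_⟩
  obtain ⟨σ, hσ, he⟩ := line_mvt (v := h) (fun x hx => h1 x hx) (hh.trans_le (min_le_left _ _))
  have hb : x₀ + σ • h ∈ ball x₀ ρ3 := by
    rw [mem_ball, dist_eq_norm, add_sub_cancel_left, norm_smul, Real.norm_eq_abs,
      abs_of_nonneg hσ.1.le]
    have := hh.trans_le (min_le_right _ _)
    nlinarith [norm_nonneg h, hσ.2]
  have e2 := h3 _ hb
  rw [add_sub_cancel_left] at e2
  have e3 : ‖g (x₀ + σ • h) - g x₀‖ ≤ c * ‖h‖ := by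
    have a1 : ‖σ • h‖ ≤ ‖h‖ := by
      rw [norm_smul, Real.norm_eq_abs, abs_of_pos hσ.1]
      nlinarith [norm_nonneg h, hσ.2]
    have a2 : g (x₀ + σ • h) - g x₀ = (g (x₀ + σ • h) - g x₀ - L (σ • h)) + L (σ • h) := by abel
    rw [a2]
    refine (norm_add_le _ _).trans ?_
    have a3 := L.le_opNorm (σ • h)
    have a4 : 0 ≤ ‖L‖ := norm_nonneg L
    nlinarith
  have e4 : ⟪g (x₀ + σ • h) - g x₀, h⟫ ≤ c * ‖h‖ * ‖h‖ :=
    (real_inner_le_norm _ _).trans (mul_le_mul_of_nonneg_right e3 (norm_nonneg _))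
  rw [inner_sub_left] at e4
  nlinarith

/-- parabolic rescaling of a point -/
def psc (x₀ : En n) (t₀ r : ℝ) (X : En n × ℝ) : En n × ℝ := (x₀ + r • X.1, t₀ + r ^ 2 * X.2)

lemma psc_cont (x₀ : En n) (t₀ r : ℝ) : Continuous (psc x₀ t₀ r) := by
  unfold psc; fun_prop

lemma Super.scale {ν : ℝ} {β : En n → ℝ≥0∞} {u : En n × ℝ → ℝ} {Q Q' : Set (En n × ℝ)}
    (h : Super ν β u Q) (x₀ : En n) (t₀ : ℝ) {r c : ℝ} (d : ℝ) (hr : 0 < r) (hc : 0 ≤ c)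
    (hQ : ∀ X ∈ Q', psc x₀ t₀ r X ∈ Q) :
    Super ν (fun x => ENNReal.ofReal r * β (x₀ + r • x)) (fun X => c * u (psc x₀ t₀ r X) + d) Q' := by
  obtain ⟨ut, G, H, hR, hs⟩ := h
  have hm : MapsTo (psc x₀ t₀ r) Q' Q := hQ
  have hcs := (psc_cont x₀ t₀ r).continuousOn (s := Q')
  refine ⟨fun X => c * r ^ 2 * ut (psc x₀ t₀ r X), fun X => (c * r) • G (psc x₀ t₀ r X),
    fun X => (c * r ^ 2) • H (psc x₀ t₀ r X), ⟨?_, ?_, ?_, ?_, ?_, ?_, ?_⟩, ?_⟩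
  · intro X hX
    have h1 := hR.dt _ (hQ X hX)
    have h2 : HasDerivAt (fun t : ℝ => t₀ + r ^ 2 * t) (r ^ 2) X.2 := by
      simpa using ((hasDerivAt_id X.2).const_mul (r ^ 2)).const_add t₀
    have h3 := ((h1.comp X.2 h2).const_mul c).add_const d
    refine h3.congr_deriv ?_
    ring
  · intro X hX
    have h1 := hR.dx _ (hQ X hX)
    have h2 : HasFDerivAt (fun x : En n => x₀ + r • x) (r • ContinuousLinearMap.id ℝ (En n)) X.1 :=
      ((hasFDerivAt_id X.1).const_smul r).const_add x₀
    have h3 := ((h1.comp X.1 h2).const_mul c).add_const d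
    refine h3.congr_fderiv ?_
    ext v
    simp; ring
  · intro X hX
    have h1 := hR.dxx _ (hQ X hX)
    have h2 : HasFDerivAt (fun x : En n => x₀ + r • x) (r • ContinuousLinearMap.id ℝ (En n)) X.1 :=
      ((hasFDerivAt_id X.1).const_smul r).const_add x₀
    have h3 := ((h1.comp X.1 h2).const_smul (c * r))
    refine h3.congr_fderiv ?_
    ext v
    simp; ring
  · exact ((hR.cu.comp hcs hm).const_smul c).add continuousOn_const
  · exact (hR.cut.comp hcs hm).const_smul (c * r ^ 2)
  · exact (hR.cG.comp hcs hm).const_smul (c * r)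
  · exact (hR.cH.comp hcs hm).const_smul (c * r ^ 2)
  · intro X hX
    obtain ⟨A, hA, h1⟩ := hs _ (hQ X hX)
    refine ⟨A, hA, ?_⟩
    have e1 : trA A ((c * r ^ 2) • H (psc x₀ t₀ r X)) - c * r ^ 2 * ut (psc x₀ t₀ r X)
      = (c * r ^ 2) * (trA A (H (psc x₀ t₀ r X)) - ut (psc x₀ t₀ r X)) := by
      rw [trA_smul]; ring
    simp only
    rw [e1, ENNReal.ofReal_mul (by positivity)]
    have e2 : ‖(c * r) • G (psc x₀ t₀ r X)‖ₑ = ENNReal.ofReal (c * r) * ‖G (psc x₀ t₀ r X)‖ₑ := by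
      rw [enorm_smul]; congr 1
      rw [Real.enorm_eq_ofReal (by positivity)]
    rw [e2]
    have e3 : ENNReal.ofReal (c * r ^ 2) = ENNReal.ofReal r * ENNReal.ofReal (c * r) := by
      rw [← ENNReal.ofReal_mul hr.le]; congr 1; ring
    rw [e3]
    calc _ ≤ ENNReal.ofReal r * ENNReal.ofReal (c * r) * (β (psc x₀ t₀ r X).1 * ‖G (psc x₀ t₀ r X)‖ₑ) := by
          gcongr
      _ = _ := by simp only [psc]; ring

lemma map_affine (x₀ : En n) {r : ℝ} (hr : 0 < r) :
    Measure.map (fun x : En n => x₀ + r • x) volume = ENNReal.ofReal ((r ^ n)⁻¹) • volume := by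
  have : (fun x : En n => x₀ + r • x) = (fun y => x₀ + y) ∘ (fun x : En n => r • x) := rfl
  rw [this, ← Measure.map_map (by fun_prop) (by fun_prop), Measure.map_addHaar_smul _ hr.ne',
    Measure.map_smul, map_add_left_eq_self]
  simp [abs_of_pos hr]

lemma map_affine1 (t₀ : ℝ) {r : ℝ} (hr : 0 < r) :
    Measure.map (fun t : ℝ => t₀ + r * t) volume = ENNReal.ofReal (r⁻¹) • volume := by
  have : (fun t : ℝ => t₀ + r * t) = (fun y => t₀ + y) ∘ (fun t : ℝ => r * t) := rfl
  rw [this, ← Measure.map_map (by fun_prop) (by fun_prop), Real.map_volume_mul_left hr.ne',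
    Measure.map_smul, map_add_left_eq_self]
  simp [abs_of_pos hr]

lemma map_psc (x₀ : En n) (t₀ : ℝ) {r : ℝ} (hr : 0 < r) :
    Measure.map (psc x₀ t₀ r) volume = ENNReal.ofReal ((r ^ (n + 2))⁻¹) • volume := by
  have h : psc x₀ t₀ r = Prod.map (fun x : En n => x₀ + r • x) (fun t : ℝ => t₀ + r ^ 2 * t) := by
    ext X <;> rfl
  rw [h, Measure.volume_eq_prod, ← Measure.map_prod_map _ _ (by fun_prop) (by fun_prop),
    map_affine x₀ hr, map_affine1 t₀ (by positivity : 0 < r ^ 2), Measure.prod_smul_left,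
    Measure.prod_smul_right, smul_smul, ← ENNReal.ofReal_mul (by positivity)]
  congr 2
  rw [← mul_inv]; congr 1; ring

lemma vol_psc (x₀ : En n) (t₀ : ℝ) {r : ℝ} (hr : 0 < r) {E : Set (En n × ℝ)}
    (hE : MeasurableSet E) :
    volume (psc x₀ t₀ r ⁻¹' E) = ENNReal.ofReal ((r ^ (n + 2))⁻¹) * volume E := by
  rw [← Measure.map_apply (psc_cont x₀ t₀ r).measurable hE, map_psc x₀ t₀ hr]
  rfl

lemma lint_scale {β : En n → ℝ≥0∞} (hβ : Measurable β) (x₀ : En n) {r : ℝ} (hr : 0 < r) (ρ : ℝ) :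
    ∫⁻ x in ball (0 : En n) ρ, (ENNReal.ofReal r * β (x₀ + r • x)) ^ n
      = ∫⁻ x in ball x₀ (r * ρ), β x ^ n := by
  have hpre : (fun x : En n => x₀ + r • x) ⁻¹' (ball x₀ (r * ρ)) = ball 0 ρ := by
    ext x
    simp [mem_ball, dist_eq_norm, norm_smul, abs_of_pos hr, hr]
  have h1 : ∫⁻ x in ball x₀ (r * ρ), β x ^ n =
      ENNReal.ofReal (r ^ n) * ∫⁻ x in ball x₀ (r * ρ), β x ^ n ∂(Measure.map (fun x : En n => x₀ + r • x) volume) := by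
    rw [map_affine x₀ hr, Measure.restrict_smul, lintegral_smul_measure, smul_eq_mul, ← mul_assoc,
      ← ENNReal.ofReal_mul (by positivity), mul_inv_cancel₀ (by positivity)]
    simp
  rw [h1, setLIntegral_map measurableSet_ball (hβ.pow_const n) (by fun_prop), hpre,
    ← lintegral_const_mul _ (by fun_prop)]
  refine lintegral_congr fun x => ?_
  rw [mul_pow, ENNReal.ofReal_pow hr.le]

lemma vol_lip {f : En n → En n} {s : Set (En n)} {K : ℝ≥0} (h : LipschitzOnWith K f s) :
    volume (f '' s) ≤ (K : ℝ≥0∞) ^ n * volume s := by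
  have hfr : Module.finrank ℝ (En n) = n := by simp
  have h0 : (Measure.hausdorffMeasure (n : ℝ) : Measure (En n)).IsAddHaarMeasure := by
    have := isAddHaarMeasure_hausdorffMeasure (E := En n)
    rwa [hfr] at this
  have h1 := Measure.isAddLeftInvariant_eq_smul (volume : Measure (En n))
    (Measure.hausdorffMeasure (n : ℝ))
  have h2 := h.hausdorffMeasure_image_le (d := (n : ℝ)) (by positivity)
  rw [ENNReal.rpow_natCast] at h2
  rw [h1, Measure.smul_apply, Measure.smul_apply]
  calc _ ≤ _ := by
        change _ ≤ (Measure.addHaarScalarFactor volume (Measure.hausdorffMeasure (n:ℝ) : Measure (En n)) : ℝ≥0∞) * ((K : ℝ≥0∞) ^ n * Measure.hausdorffMeasure (n:ℝ) s)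
        exact mul_le_mul_right h2 _
    _ = _ := by
        change _ = _ * ((_ : ℝ≥0∞) * _)
        ring

open Filter Topology in
lemma vol_lip_loc {f : En n → En n} {A : Set (En n)} {K : ℝ≥0}
    (h : ∀ x ∈ A, ∀ᶠ x' in 𝓝[A] x, dist (f x') (f x) ≤ K * dist x' x) :
    volume (f '' A) ≤ (K : ℝ≥0∞) ^ n * volume A := by
  let Am : ℕ → Set (En n) := fun m =>
    {x ∈ A | ∀ x' ∈ A, dist x' x < 1 / ((m : ℝ) + 1) → dist (f x') (f x) ≤ K * dist x' x}
  have hmono : Monotone Am := by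
    intro m m' hmm x hx
    refine ⟨hx.1, fun x' hx' hd => hx.2 x' hx' (hd.trans_le ?_)⟩
    apply one_div_le_one_div_of_le (by positivity)
    have : (m : ℝ) ≤ m' := by exact_mod_cast hmm
    linarith
  have hU : (⋃ m, Am m) = A := by
    apply Subset.antisymm
    · exact iUnion_subset fun m x hx => hx.1
    · intro x hx
      obtain ⟨ρ, hρ, h1⟩ := Metric.eventually_nhds_iff.1 (eventually_nhdsWithin_iff.1 (h x hx))
      obtain ⟨m, hm⟩ := exists_nat_one_div_lt hρ
      exact mem_iUnion.2 ⟨m, hx, fun x' hx' hd => h1 (hd.trans hm) hx'⟩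
  have key : ∀ m, volume (f '' (Am m)) ≤ (K : ℝ≥0∞) ^ n * volume A := by
    intro m
    set δ : ℝ := 1 / ((m : ℝ) + 1) / 2 with hδ
    have hδpos : 0 < δ := by positivity
    obtain ⟨s, hs, hcov⟩ : ∃ s : Set (En n), s.Countable ∧ (⋃ y ∈ s, ball y δ) = univ := by
      obtain ⟨s, hs, h2⟩ := TopologicalSpace.isOpen_biUnion_countable (univ : Set (En n))
        (fun y => ball y δ) (fun y _ => isOpen_ball)
      refine ⟨s, h2.1, ?_⟩
      rw [h2.2]
      exact eq_univ_of_forall fun x => mem_iUnion₂.2 ⟨x, trivial, mem_ball_self hδpos⟩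
    have hne : s.Nonempty := by
      by_contra hemp
      rw [not_nonempty_iff_eq_empty] at hemp
      have : (0 : En n) ∈ (⋃ y ∈ s, ball y δ) := by rw [hcov]; trivial
      simp [hemp] at this
    obtain ⟨e, rfl⟩ := hs.exists_eq_range hne
    set C := disjointed (fun i => ball (e i) δ) with hC
    have hCm : ∀ i, MeasurableSet (C i) := MeasurableSet.disjointed fun i => measurableSet_ball
    have hCU : (⋃ i, C i) = univ := by
      rw [hC, iUnion_disjointed]; rw [← hcov]; simp
    have hCs : ∀ i, C i ⊆ ball (e i) δ := disjointed_subset _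
    have hB := subset_toMeasurable (volume : Measure (En n)) A
    have h1 : f '' Am m ⊆ ⋃ i, f '' (Am m ∩ C i) := by
      rw [← image_iUnion, ← inter_iUnion, hCU, inter_univ]
    refine (measure_mono h1).trans ((measure_iUnion_le _).trans ?_)
    have h2 : ∀ i, volume (f '' (Am m ∩ C i)) ≤ (K : ℝ≥0∞) ^ n *
        volume (toMeasurable volume A ∩ C i) := by
      intro i
      refine (vol_lip (K := K) ?_).trans ?_
      · rw [lipschitzOnWith_iff_dist_le_mul]
        intro x hx y hy
        refine hy.1.2 x hx.1.1 ?_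
        have a1 := hCs i hx.2
        have a2 := hCs i hy.2
        rw [mem_ball] at a1 a2
        have : dist x y ≤ dist x (e i) + dist y (e i) := dist_triangle_right _ _ _
        calc dist x y < δ + δ := by linarith
          _ = _ := by rw [hδ]; ring
      · gcongr
        exact fun x hx => hB hx.1
    refine (ENNReal.tsum_le_tsum h2).trans ?_
    rw [ENNReal.tsum_mul_left, ← measure_iUnion, ← inter_iUnion, hCU, inter_univ, measure_toMeasurable]
    · exact fun i j hij => ((disjoint_disjointed _) hij).mono inter_subset_right inter_subset_right
    · exact fun i => (measurableSet_toMeasurable _ _).inter (hCm i)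
  rw [← hU, image_iUnion, hU]
  rw [Monotone.measure_iUnion (fun m m' hmm => image_mono (hmono hmm))]
  exact iSup_le key

open Filter Topology in
lemma LipM (hn : 0 < n) {f : En n → En n} {E : Set (En n)} (hE : MeasurableSet E)
    {l : En n → ℝ≥0∞} (hl : Measurable l)
    (h : ∀ x ∈ E, ∃ K : ℝ≥0, (K : ℝ≥0∞) ≤ l x ∧
      ∀ᶠ x' in 𝓝[E] x, dist (f x') (f x) ≤ K * dist x' x) {δ : ℝ≥0} (hδ : 0 < δ) :
    volume (f '' E) ≤ ∫⁻ x in E, (l x + δ) ^ n := by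
  let Ek : ℕ → Set (En n) := fun k => E ∩ l ⁻¹' (Ico ((k : ℝ≥0∞) * δ) ((k + 1 : ℕ) * δ))
  let Ei : ℕ → Set (En n) := fun j => {x ∈ E | l x = ∞ ∧
      ∀ᶠ x' in 𝓝[E] x, dist (f x') (f x) ≤ ((j : ℝ≥0) : ℝ) * dist x' x}
  by_cases hinf : volume (E ∩ l ⁻¹' {∞}) = 0
  swap
  · have hm : MeasurableSet (E ∩ l ⁻¹' {∞}) := hE.inter (hl (measurableSet_singleton _))
    have : (∫⁻ x in E, (l x + δ) ^ n) = ∞ := by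
      rw [eq_top_iff]
      calc ∞ = ∫⁻ x in E ∩ l ⁻¹' {∞}, ∞ := by
            rw [setLIntegral_const, ENNReal.top_mul hinf]
        _ ≤ ∫⁻ x in E ∩ l ⁻¹' {∞}, (l x + δ) ^ n := by
            refine setLIntegral_mono' hm fun x hx => ?_
            have : l x = ∞ := hx.2
            rw [this]; simp [hn.ne']
        _ ≤ _ := lintegral_mono_set inter_subset_left
    rw [this]; exact le_top
  have hcover : E ⊆ (⋃ k, Ek k) ∪ ⋃ j, Ei j := by
    intro x hx
    obtain ⟨K, hK, hx2⟩ := h x hx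
    by_cases htop : l x = ∞
    · right
      obtain ⟨j, hj⟩ := exists_nat_ge K
      refine mem_iUnion.2 ⟨j, hx, htop, ?_⟩
      filter_upwards [hx2] with x' hx'
      refine hx'.trans ?_
      gcongr
    · left
      lift l x to ℝ≥0 using htop with lx hlx
      refine mem_iUnion.2 ⟨⌊lx / δ⌋₊, hx, ?_⟩
      have a1 : (⌊lx / δ⌋₊ : ℝ≥0) ≤ lx / δ := Nat.floor_le (by positivity)
      have a2 : lx / δ < (⌊lx / δ⌋₊ : ℝ≥0) + 1 := Nat.lt_floor_add_one _
      rw [le_div_iff₀ hδ] at a1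
      rw [div_lt_iff₀ hδ] at a2
      rw [mem_preimage, ← hlx, mem_Ico]
      constructor
      · exact_mod_cast a1
      · push_cast; exact_mod_cast a2
  have hEk : ∀ k, MeasurableSet (Ek k) := fun k => hE.inter (hl measurableSet_Ico)
  have hdis : Pairwise (Function.onFun Disjoint Ek) := by
    have key : ∀ i j, i < j → Disjoint (Ek i) (Ek j) := by
      intro i j hij
      rw [Set.disjoint_left]
      rintro x ⟨_, hx1⟩ ⟨_, hx2⟩
      have b1 := hx1.2
      have b2 := hx2.1
      have : ((i + 1 : ℕ) : ℝ≥0∞) * δ ≤ (j : ℝ≥0∞) * δ := by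
        gcongr; exact hij
      exact absurd (b1.trans_le (this.trans b2)) (lt_irrefl _)
    intro i j hij
    rcases lt_or_gt_of_ne hij with h1 | h1
    · exact key i j h1
    · exact (key j i h1).symm
  have hk : ∀ k, volume (f '' Ek k) ≤ ∫⁻ x in Ek k, (l x + δ) ^ n := by
    intro k
    have h1 : volume (f '' Ek k) ≤ (((k + 1 : ℕ) * δ : ℝ≥0) : ℝ≥0∞) ^ n * volume (Ek k) := by
      apply vol_lip_loc
      intro x hx
      obtain ⟨K, hK, hx2⟩ := h x hx.1
      have hx3 := hx2.filter_mono (nhdsWithin_mono x (inter_subset_left : Ek k ⊆ E))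
      filter_upwards [hx3] with x' hx'
      refine hx'.trans ?_
      have : K ≤ ((k + 1 : ℕ) * δ : ℝ≥0) := by
        have := (hK.trans_lt hx.2.2).le
        exact_mod_cast this
      gcongr
    refine h1.trans ?_
    rw [← setLIntegral_const]
    refine setLIntegral_mono' (hEk k) fun x hx => ?_
    gcongr
    have := hx.2.1
    push_cast
    rw [add_mul, one_mul]
    gcongr
  have hj : ∀ j, volume (f '' Ei j) = 0 := by
    intro j
    rw [← nonpos_iff_eq_zero]
    have hz : volume (Ei j) = 0 :=
      measure_mono_null (t := E ∩ l ⁻¹' {∞}) (fun x hx => ⟨hx.1, hx.2.1⟩) hinf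
    have := vol_lip_loc (f := f) (A := Ei j) (K := j) (fun x hx =>
      hx.2.2.filter_mono (nhdsWithin_mono x (fun y hy => hy.1)))
    rwa [hz, mul_zero] at this
  calc volume (f '' E) ≤ volume (f '' (⋃ k, Ek k) ∪ f '' (⋃ j, Ei j)) := by
        rw [← image_union]; exact measure_mono (image_mono hcover)
    _ ≤ volume (f '' (⋃ k, Ek k)) + volume (f '' ⋃ j, Ei j) := measure_union_le _ _
    _ ≤ (∑' k, volume (f '' Ek k)) + ∑' j, volume (f '' Ei j) := by
        rw [image_iUnion, image_iUnion]
        gcongr <;> exact measure_iUnion_le _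
    _ ≤ (∑' k, ∫⁻ x in Ek k, (l x + δ) ^ n) := by
        simp only [hj, tsum_zero, add_zero]
        exact ENNReal.tsum_le_tsum hk
    _ = ∫⁻ x in ⋃ k, Ek k, (l x + δ) ^ n := (lintegral_iUnion hEk hdis _).symm
    _ ≤ _ := lintegral_mono_set (iUnion_subset fun k => inter_subset_left)

/-! ### Radial barrier -/

lemma hasDerivAt_invpow (m : ℕ) {s : ℝ} (hs : s ≠ 0) :
    HasDerivAt (fun s : ℝ => (s ^ m)⁻¹) (-(m : ℝ) * (s ^ (m + 1))⁻¹) s := by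
  have h := hasDerivAt_zpow (-(m : ℤ)) s (Or.inl hs)
  have e : (fun s : ℝ => (s ^ m)⁻¹) = fun s => s ^ (-(m : ℤ)) := by
    ext s; simp
  rw [e]
  refine h.congr_deriv ?_
  have : (-(m : ℤ) - 1) = -((m + 1 : ℕ) : ℤ) := by push_cast; ring
  rw [this, zpow_neg, zpow_natCast]; push_cast; ring

lemma hasFDerivAt_nsq (x : En n) :
    HasFDerivAt (fun x : En n => ‖x‖ ^ 2) ((2:ℝ) • innerSL ℝ x) x := by
  have := (hasStrictFDerivAt_norm_sq x).hasFDerivAt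
  refine this.congr_fderiv ?_
  ext v; simp [two_smul, two_mul]

def Gf (m : ℕ) (x : En n) : ℝ := ((‖x‖ ^ 2) ^ m)⁻¹ - 4 ^ m
def Gg (m : ℕ) (x : En n) : En n := (-(2 * m : ℝ) * ((‖x‖ ^ 2) ^ (m + 1))⁻¹) • x
def Gh (m : ℕ) (x : En n) : En n →L[ℝ] En n :=
  (-(2 * m : ℝ) * ((‖x‖ ^ 2) ^ (m + 1))⁻¹) • ContinuousLinearMap.id ℝ (En n) +
    (4 * m * (m + 1) * ((‖x‖ ^ 2) ^ (m + 2))⁻¹ : ℝ) • rk1 x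

lemma Gf_dx (m : ℕ) {x : En n} (hx : x ≠ 0) : HasFDerivAt (Gf m) (innerSL ℝ (Gg m x)) x := by
  have hs : ‖x‖ ^ 2 ≠ 0 := by simpa using hx
  have h1 := ((hasDerivAt_invpow m hs).comp_hasFDerivAt x (hasFDerivAt_nsq x)).sub_const (4 ^ m)
  refine h1.congr_fderiv ?_
  ext v
  simp [Gg]; ring

lemma Gg_dx (m : ℕ) {x : En n} (hx : x ≠ 0) : HasFDerivAt (Gg m) (Gh m x) x := by
  have hs : ‖x‖ ^ 2 ≠ 0 := by simpa using hx
  have h1 := ((hasDerivAt_invpow (m + 1) hs).comp_hasFDerivAt x (hasFDerivAt_nsq x)).const_mul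
    (-(2 * m : ℝ))
  have h2 := h1.smul (hasFDerivAt_id x)
  refine h2.congr_fderiv ?_
  ext v i
  simp [Gh, rk1]
  ring

lemma Gh_tr {ν : ℝ} (hν : 1 ≤ ν) {m : ℕ} (hm : 1 ≤ m) (hm2 : n * ν ^ 2 ≤ 2 * m + 1)
    {A : Matrix (Fin n) (Fin n) ℝ} (hA : Ell ν A) {x : En n} (hx : x ≠ 0) (hx1 : ‖x‖ ≤ 1 / 2) :
    ν⁻¹ ≤ trA A (Gh m x) := by
  have hν0 : 0 < ν := by linarith
  have hxp : 0 < ‖x‖ := norm_pos_iff.2 hx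
  have hs : 0 < ‖x‖ ^ 2 := by positivity
  rw [Gh, trA_add, trA_smul, trA_smul]
  have h1 := hA.trA_id_le hν0.le
  have h2 := hA.trA_rk1_ge x
  set s := ‖x‖ ^ 2 with hsd
  have hs1 : s ≤ 1 := by rw [hsd]; nlinarith
  have hmr : (1:ℝ) ≤ m := by exact_mod_cast hm
  have e1 : ((s ^ (m + 2))⁻¹ : ℝ) = (s ^ (m + 1))⁻¹ * s⁻¹ := by rw [← mul_inv, ← pow_succ]
  have hP : 1 ≤ (s ^ (m + 1))⁻¹ := (one_le_inv₀ (by positivity)).2 (pow_le_one₀ hs.le hs1)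
  set P := (s ^ (m + 1))⁻¹ with hPd
  rw [e1]
  have h3 : 4 * (m:ℝ) * (m + 1) * (P * s⁻¹) * (ν⁻¹ * s) ≤
      4 * (m:ℝ) * (m + 1) * (P * s⁻¹) * trA A (rk1 x) := by gcongr
  have h4 : 4 * (m:ℝ) * (m + 1) * (P * s⁻¹) * (ν⁻¹ * s) = 4 * m * (m + 1) * P * ν⁻¹ := by
    field_simp
  have h5 : 2 * m * P * trA A (ContinuousLinearMap.id ℝ (En n)) ≤ 2 * m * P * (n * ν) := by gcongr
  have h6 : n * ν ≤ (2 * m + 1) * ν⁻¹ := by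
    rw [← div_eq_mul_inv, le_div_iff₀ hν0]; nlinarith
  have h7 : 2 * m * P * (n * ν) ≤ 2 * m * P * ((2 * m + 1) * ν⁻¹) := by gcongr
  have hνi : 0 < ν⁻¹ := by positivity
  have h8 : ν⁻¹ ≤ 2 * m * P * ν⁻¹ := by
    have : 1 ≤ 2 * m * P := by nlinarith
    nlinarith
  nlinarith

lemma Gg_norm (m : ℕ) {x : En n} (hx : x ≠ 0) : ‖Gg m x‖ = 2 * m * (‖x‖ ^ (2 * m + 1))⁻¹ := by
  have hxp : 0 < ‖x‖ := norm_pos_iff.2 hx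
  rw [Gg, norm_smul, Real.norm_eq_abs, neg_mul, abs_neg, abs_of_nonneg (by positivity)]
  rw [← pow_mul]
  have : ‖x‖ ^ (2 * (m + 1)) = ‖x‖ ^ (2 * m + 1) * ‖x‖ := by rw [← pow_succ]; ring_nf
  rw [this]
  field_simp

lemma Gg_ge {m : ℕ} (hm : 1 ≤ m) {x : En n} (hx : x ≠ 0) (hx1 : ‖x‖ ≤ 1 / 2) : 16 ≤ ‖Gg m x‖ := by
  have hxp : 0 < ‖x‖ := norm_pos_iff.2 hx
  rw [Gg_norm m hx]
  have h1 : ‖x‖ ^ (2 * m + 1) ≤ (1 / 2) ^ 3 :=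
    (pow_le_pow_left₀ hxp.le hx1 _).trans (pow_le_pow_of_le_one (by norm_num) (by norm_num) (by omega))
  have h2 : 8 ≤ (‖x‖ ^ (2 * m + 1))⁻¹ := by
    rw [le_inv_comm₀ (by norm_num) (by positivity)]; norm_num at h1 ⊢; exact h1
  have hmr : (1:ℝ) ≤ m := by exact_mod_cast hm
  nlinarith

lemma Gg_le {m : ℕ} {x : En n} {κ : ℝ} (hκ : 0 < κ) (hx1 : κ ≤ ‖x‖) :
    ‖Gg m x‖ ≤ 2 * m * (κ ^ (2 * m + 1))⁻¹ := by
  have hx : x ≠ 0 := norm_pos_iff.1 (hκ.trans_le hx1)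
  rw [Gg_norm m hx]
  gcongr

lemma Gf_nonneg_le {m : ℕ} {x : En n} {κ : ℝ} (hκ : 0 < κ) (hx1 : κ ≤ ‖x‖) :
    Gf m x ≤ ((κ ^ 2) ^ m)⁻¹ := by
  rw [Gf]
  have : ((‖x‖ ^ 2) ^ m)⁻¹ ≤ ((κ ^ 2) ^ m)⁻¹ := by gcongr
  have : (0:ℝ) ≤ 4 ^ m := by positivity
  linarith

lemma Gf_half (m : ℕ) {x : En n} (hx : ‖x‖ = 1 / 2) : Gf m x = 0 := by
  rw [Gf, hx, ← inv_pow]; norm_num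

lemma Gf_quarter {m : ℕ} (hm : 1 ≤ m) {x : En n} (hx0 : x ≠ 0) (hx : ‖x‖ ≤ 1 / 4) : 12 ≤ Gf m x := by
  have hxp : 0 < ‖x‖ := norm_pos_iff.2 hx0
  rw [Gf]
  have h1 : (16:ℝ) ^ m ≤ ((‖x‖ ^ 2) ^ m)⁻¹ := by
    rw [← inv_pow]
    gcongr
    rw [le_inv_comm₀ (by norm_num) (by positivity)]
    nlinarith
  have h2 : (16:ℝ) ^ m = 4 ^ m * 4 ^ m := by rw [← mul_pow]; norm_num
  have h3 : (4:ℝ) ≤ 4 ^ m := by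
    calc (4:ℝ) = 4 ^ 1 := by norm_num
      _ ≤ _ := pow_le_pow_right₀ (by norm_num) hm
  nlinarith

lemma ennreal_add_pow (a b : ℝ≥0∞) (k : ℕ) : (a + b) ^ k ≤ 2 ^ k * (a ^ k + b ^ k) := by
  have h1 : a + b ≤ 2 * max a b := by
    rw [two_mul]; exact add_le_add (le_max_left _ _) (le_max_right _ _)
  calc (a + b) ^ k ≤ (2 * max a b) ^ k := by gcongr
    _ = 2 ^ k * (max a b) ^ k := mul_pow _ _ _
    _ ≤ _ := by
      gcongr
      rcases le_total a b with h | h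
      · rw [max_eq_right h]; exact le_add_self
      · rw [max_eq_left h]; exact le_self_add

lemma ennreal_absorb {v X : ℝ≥0∞} (hv : v ≠ ∞) (h : v ≤ X + v / 2) : v ≤ 2 * X := by
  have h2 : v / 2 + v / 2 ≤ X + v / 2 := by rwa [ENNReal.add_halves]
  have h3 : v / 2 ≤ X := by
    refine (ENNReal.add_le_add_iff_right ?_).1 h2
    exact (ENNReal.div_lt_top hv (by norm_num)).ne
  calc v = v / 2 + v / 2 := (ENNReal.add_halves v).symm
    _ ≤ X + X := by gcongr
    _ = 2 * X := (two_mul X).symm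

set_option maxHeartbeats 2000000 in
open Filter Topology in
theorem E_core (hn : 0 < n) {ν : ℝ} (hν : 1 ≤ ν) {m : ℕ} (hm : 1 ≤ m)
    (hm2 : n * ν ^ 2 ≤ 2 * m + 1) {β : En n → ℝ≥0∞} (hβ : Measurable β)
    {u ut : En n × ℝ → ℝ} {G : En n × ℝ → En n} {H : En n × ℝ → En n →L[ℝ] En n} {a b : ℝ}
    (hR : Reg u ut G H (ball 0 1 ×ˢ Ioo a b))
    (hS : ∀ X ∈ (ball (0 : En n) 1 ×ˢ Ioo a b), ∃ A, Ell ν A ∧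
      ENNReal.ofReal (trA A (H X) - ut X) ≤ β X.1 * ‖G X‖ₑ)
    {κ t0 ts B η d2 : ℝ} (hκ : 0 < κ) (ha : a < t0) (ht : t0 < ts) (hb : ts < b) (hη : 0 < η)
    (hB : B ≤ η * ν⁻¹) (hd2 : d2 = 2 * m * (κ ^ (2 * m + 1))⁻¹ + 1)
    {xs : En n} (hxs : κ < ‖xs‖) (hxs4 : ‖xs‖ ≤ 1 / 4)
    (hbd : ∀ x : En n, κ ≤ ‖x‖ → ‖x‖ ≤ 1 / 2 → ∀ t ∈ Icc t0 ts,
      (‖x‖ = κ ∨ ‖x‖ = 1 / 2 ∨ t = t0) → 0 ≤ u (x, t) + B * (ts - t) - η * Gf m x)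
    (hx : u (xs, ts) - η * Gf m xs ≤ -2 * η) :
    ∃ E : Set (En n), MeasurableSet E ∧ E ⊆ ball 0 1 ∧
      (∀ x ∈ E, ∀ t ∈ Icc t0 ts,
        (∀ s ∈ Icc t0 ts, u (x, t) + B * (ts - t) ≤ u (x, s) + B * (ts - s)) →
        15 * η ≤ ‖G (x, t)‖ ∧ ‖G (x, t)‖ ≤ d2 * η) ∧
      volume (ball (0 : En n) 1) ≤ 2 * (ENNReal.ofReal (8 * n * ν * d2) ^ n * ∫⁻ x in E, β x ^ n) := by
  have hν0 : 0 < ν := by linarith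
  have hd2pos : 0 < d2 := by rw [hd2]; positivity
  set W : En n × ℝ → ℝ := fun X => u X + B * (ts - X.2) - η * Gf m X.1 with hW
  set Ann : Set (En n) := {x | κ ≤ ‖x‖ ∧ ‖x‖ ≤ 1 / 2} with hAnn
  have hAnnC : IsCompact Ann := by
    have : Ann = closedBall 0 (1 / 2) ∩ {x | κ ≤ ‖x‖} := by
      ext x; simp [hAnn, and_comm]
    rw [this]
    exact (isCompact_closedBall _ _).inter_right (isClosed_le continuous_const continuous_norm)
  have hAnn0 : ∀ x ∈ Ann, x ≠ 0 := fun x hx => norm_pos_iff.1 (hκ.trans_le hx.1)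
  have hxsA : xs ∈ Ann := ⟨hxs.le, by linarith⟩
  have hsubQ : Ann ×ˢ Icc t0 ts ⊆ (ball (0 : En n) 1 ×ˢ Ioo a b) := by
    rintro ⟨x, t⟩ ⟨hx1, hx2⟩
    refine ⟨?_, ?_, ?_⟩
    · rw [mem_ball_zero_iff]; exact hx1.2.trans_lt (by norm_num)
    · exact ha.trans_le hx2.1
    · exact hx2.2.trans_lt hb
  have hGfc : ContinuousOn (Gf m) Ann := fun x hx =>
    (Gf_dx m (hAnn0 x hx)).continuousAt.continuousWithinAt
  have hWc : ContinuousOn W (Ann ×ˢ Icc t0 ts) := by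
    refine ((hR.cu.mono hsubQ).add (by fun_prop)).sub ?_
    exact (hGfc.comp continuousOn_fst (fun X hX => hX.1)).const_smul η
  let Con : En n → ℝ → En n → Prop := fun x t p => x ∈ Ann ∧ t ∈ Icc t0 ts ∧ ‖p‖ ≤ η ∧
    ∀ Y ∈ Ann ×ˢ Icc t0 ts, W (x, t) - ⟪p, x⟫ ≤ W Y - ⟪p, Y.1⟫
  have hts : ts ∈ Icc t0 ts := ⟨ht.le, le_rfl⟩
  have fact1 : ∀ x t p, Con x t p → κ < ‖x‖ ∧ ‖x‖ < 1 / 2 ∧ t0 < t := by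
    rintro x t p ⟨h1, h2, h3, h4⟩
    have h5 := h4 (xs, ts) ⟨hxsA, hts⟩
    have h6 : W (xs, ts) ≤ -2 * η := by simp only [hW, sub_self, mul_zero, add_zero]; exact hx
    have h7 : ⟪p, x⟫ - ⟪p, xs⟫ ≤ η * (3 / 4) := by
      rw [← inner_sub_right]
      refine (real_inner_le_norm _ _).trans ?_
      have : ‖x - xs‖ ≤ 3 / 4 := (norm_sub_le _ _).trans (by linarith [h1.2])
      gcongr
    have h8 : W (x, t) < 0 := by simp only at h5; linarith
    have h9 : ¬ (‖x‖ = κ ∨ ‖x‖ = 1 / 2 ∨ t = t0) := fun hor =>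
      absurd (hbd x h1.1 h1.2 t h2 hor) (not_le.2 h8)
    push Not at h9
    exact ⟨lt_of_le_of_ne h1.1 (Ne.symm h9.1), lt_of_le_of_ne h1.2 h9.2.1,
      lt_of_le_of_ne h2.1 (Ne.symm h9.2.2)⟩
  have hopen : IsOpen {x : En n | κ < ‖x‖ ∧ ‖x‖ < 1 / 2} :=
    (isOpen_lt continuous_const continuous_norm).inter (isOpen_lt continuous_norm continuous_const)
  have hWx : ∀ x t, x ∈ Ann → t ∈ Icc t0 ts →
      HasFDerivAt (fun y => W (y, t)) (innerSL ℝ (G (x, t) - η • Gg m x)) x := by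
    intro x t h1 h2
    have a1 := hR.dx (x, t) (hsubQ ⟨h1, h2⟩)
    have a2 := (Gf_dx m (hAnn0 x h1)).const_mul η
    have a3 := (a1.add_const (B * (ts - t))).sub a2
    refine a3.congr_fderiv ?_
    ext v
    simp
  have hWxx : ∀ x t, x ∈ Ann → t ∈ Icc t0 ts →
      HasFDerivAt (fun y => G (y, t) - η • Gg m y) (H (x, t) - η • Gh m x) x := by
    intro x t h1 h2
    exact (hR.dxx (x, t) (hsubQ ⟨h1, h2⟩)).sub ((Gg_dx m (hAnn0 x h1)).const_smul η)
  have hWev : ∀ x t p, Con x t p → ∀ᶠ y in 𝓝 x,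
      HasFDerivAt (fun y => W (y, t)) (innerSL ℝ (G (y, t) - η • Gg m y)) y := by
    intro x t p hc
    obtain ⟨f1, f2, f3⟩ := fact1 x t p hc
    filter_upwards [hopen.mem_nhds ⟨f1, f2⟩] with y hy
    exact hWx y t ⟨hy.1.le, hy.2.le⟩ hc.2.1
  have fact2 : ∀ x t p, Con x t p → G (x, t) - η • Gg m x = p ∧ PSD (H (x, t) - η • Gh m x) ∧
      ut (x, t) ≤ B := by
    rintro x t p hc
    obtain ⟨f1, f2, f3⟩ := fact1 x t p hc
    have hev := hWev x t p hc
    obtain ⟨h1, h2, h3, h4⟩ := hc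
    have e1 : ∀ᶠ y in 𝓝 x, HasFDerivAt (fun y => W (y, t) - ⟪p, y⟫)
        (innerSL ℝ (G (y, t) - η • Gg m y - p)) y := by
      filter_upwards [hev] with y hy
      refine (hy.sub ((innerSL ℝ p).hasFDerivAt)).congr_fderiv ?_
      ext v; simp
    have e2 := (hWxx x t h1 h2).sub_const p
    have e3 : IsLocalMin (fun y => W (y, t) - ⟪p, y⟫) x := by
      filter_upwards [hopen.mem_nhds ⟨f1, f2⟩] with y hy
      exact h4 (y, t) ⟨⟨hy.1.le, hy.2.le⟩, h2⟩
    obtain ⟨e4, e5⟩ := hess_psd e1 e2 e3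
    refine ⟨sub_eq_zero.1 e4, e5, ?_⟩
    have a1 := hR.dt (x, t) (hsubQ ⟨h1, h2⟩)
    have a2 : HasDerivAt (fun s : ℝ => B * (ts - s)) (B * (-1)) t := by
      simpa using (((hasDerivAt_id t).const_sub ts).const_mul B)
    have a3 := deriv_nonpos_of_left (a1.add a2) (by
      have : Ioo t0 t ∈ 𝓝[<] t := Ioo_mem_nhdsLT f3
      filter_upwards [this] with s hs
      have := h4 (x, s) ⟨h1, hs.1.le, hs.2.le.trans h2.2⟩
      simp only [hW] at this
      simp only [Pi.add_apply]
      linarith)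
    linarith
  -- transfer to other argmins
  have transf : ∀ x t p, Con x t p → ∀ t' ∈ Icc t0 ts,
      (∀ s ∈ Icc t0 ts, u (x, t') + B * (ts - t') ≤ u (x, s) + B * (ts - s)) → Con x t' p := by
    rintro x t p ⟨h1, h2, h3, h4⟩ t' ht' hmin
    refine ⟨h1, ht', h3, fun Y hY => le_trans ?_ (h4 Y hY)⟩
    have := hmin t h2
    simp only [hW]; linarith
  have argm : ∀ x t p, Con x t p →
      ∀ s ∈ Icc t0 ts, u (x, t) + B * (ts - t) ≤ u (x, s) + B * (ts - s) := by
    rintro x t p ⟨h1, h2, h3, h4⟩ s hs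
    have := h4 (x, s) ⟨h1, hs⟩
    simp only [hW] at this; linarith
  have gb : ∀ x t p, Con x t p → 15 * η ≤ ‖G (x, t)‖ ∧ ‖G (x, t)‖ ≤ d2 * η := by
    intro x t p hc
    obtain ⟨f1, -, -⟩ := fact2 x t p hc
    have hG : G (x, t) = p + η • Gg m x := by rw [← f1]; abel
    have g1 := Gg_ge hm (hAnn0 x hc.1) hc.1.2
    have g2 := Gg_le (m := m) hκ hc.1.1
    have g3 : ‖η • Gg m x‖ = η * ‖Gg m x‖ := by rw [norm_smul, Real.norm_eq_abs, abs_of_pos hη]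
    have hp := hc.2.2.1
    rw [hG]
    constructor
    · have := norm_sub_le (p + η • Gg m x) p
      rw [add_sub_cancel_left, g3] at this
      nlinarith
    · have := norm_add_le p (η • Gg m x)
      rw [g3] at this
      rw [hd2]; nlinarith
  -- the contact set
  set E : Set (En n) := {x | ∃ t p, Con x t p} with hE
  have hEc : IsCompact E := by
    set Z : Set (En n × ℝ × En n) := Ann ×ˢ (Icc t0 ts ×ˢ closedBall 0 η) with hZ
    have hZc : IsCompact Z := hAnnC.prod (isCompact_Icc.prod (isCompact_closedBall _ _))
    set C : Set (En n × ℝ × En n) := Z ∩ ⋂ Y ∈ Ann ×ˢ Icc t0 ts,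
      {z ∈ Z | W (z.1, z.2.1) - ⟪z.2.2, z.1⟫ ≤ W Y - ⟪z.2.2, Y.1⟫} with hC
    have hCc : IsCompact C := by
      refine hZc.inter_right (isClosed_biInter fun Y hY => ?_)
      refine hZc.isClosed.isClosed_le ?_ (by fun_prop)
      refine ContinuousOn.sub ?_ (by fun_prop)
      exact hWc.comp (f := fun z : En n × ℝ × En n => (z.1, z.2.1)) (by fun_prop)
        (fun z hz => ⟨hz.1, hz.2.1⟩)
    have : E = Prod.fst '' C := by
      ext x
      constructor
      · rintro ⟨t, p, h1, h2, h3, h4⟩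
        have hz : (x, t, p) ∈ Z := ⟨h1, h2, by simpa using h3⟩
        refine ⟨(x, t, p), ⟨hz, ?_⟩, rfl⟩
        exact mem_iInter₂.2 fun Y hY => ⟨hz, h4 Y hY⟩
      · rintro ⟨⟨x', t, p⟩, ⟨hz, hz2⟩, rfl⟩
        refine ⟨t, p, hz.1, hz.2.1, by simpa using hz.2.2, fun Y hY => ?_⟩
        exact (mem_iInter₂.1 hz2 Y hY).2
    rw [this]
    exact hCc.image continuous_fst
  have hEm : MeasurableSet E := hEc.measurableSet
  choose! tt pp hcon using fun (x : En n) (hx : x ∈ E) => hx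
  have uniq : ∀ x t p, Con x t p → pp x = p := by
    intro x t p hc
    have hxE : x ∈ E := ⟨t, p, hc⟩
    have h1 := hcon x hxE
    have h2 := transf x t p hc (tt x) h1.2.1 (argm x _ _ h1)
    rw [← (fact2 _ _ _ h1).1, ← (fact2 _ _ _ h2).1]
  have hsurj : closedBall 0 η ⊆ pp '' E := by
    intro p hp
    obtain ⟨⟨x, t⟩, hX, hmin⟩ := (hAnnC.prod (isCompact_Icc (a := t0) (b := ts))).exists_isMinOn
      ⟨(xs, ts), hxsA, hts⟩ (f := fun Y : En n × ℝ => W Y - ⟪p, Y.1⟫)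
      (hWc.sub (by fun_prop))
    have hc : Con x t p := ⟨hX.1, hX.2, by simpa using hp, fun Y hY => hmin hY⟩
    exact ⟨x, ⟨t, p, hc⟩, uniq x t p hc⟩
  have hEsub : E ⊆ ball 0 1 := by
    rintro x ⟨t, p, hc⟩
    rw [mem_ball_zero_iff]; exact hc.1.2.trans_lt (by norm_num)
  refine ⟨E, hEm, hEsub, ?_, ?_⟩
  · intro x hxE t ht' hmin
    exact gb x t _ (transf x _ _ (hcon x hxE) t ht' hmin)
  -- measure estimate
  set δ : ℝ≥0 := Real.toNNReal (η / 16) with hδ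
  have hδpos : 0 < δ := by rw [hδ, Real.toNNReal_pos]; positivity
  have hδr : (δ : ℝ) = η / 16 := Real.coe_toNNReal _ (by positivity)
  have hδe : (δ : ℝ≥0∞) = ENNReal.ofReal (η / 16) := rfl
  set l : En n → ℝ≥0∞ := fun x => ENNReal.ofReal (4 * n * ν * d2 * η) * β x + δ with hl
  have hlm : Measurable l := by fun_prop
  have hLip := LipM hn (f := pp) hEm hlm (δ := δ) (by
    intro x hxE
    have hc := hcon x hxE
    set t := tt x
    set p := pp x with hp
    obtain ⟨f1, f2, f3⟩ := fact1 _ _ _ hc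
    obtain ⟨g1, g2, g3⟩ := fact2 _ _ _ hc
    set L := H (x, t) - η • Gh m x with hL
    obtain ⟨A, hA, hAeq⟩ := hS (x, t) (hsubQ ⟨hc.1, hc.2.1⟩)
    have hT : ν⁻¹ * trc L ≤ trA A (H (x, t)) - ut (x, t) := by
      have b1 := g2.trA_ge hA
      rw [hL, trA_sub, trA_smul] at b1
      have b2 := Gh_tr hν hm hm2 hA (hAnn0 x hc.1) hc.1.2
      have b3 : η * ν⁻¹ ≤ η * trA A (Gh m x) := by gcongr
      linarith
    have hLn : ‖L‖ ≤ n * ν * (ν⁻¹ * trc L) := by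
      have := g2.norm_le
      calc ‖L‖ ≤ n * trc L := this
        _ = _ := by field_simp
    have hLe : ENNReal.ofReal (4 * ‖L‖) ≤ ENNReal.ofReal (4 * n * ν * d2 * η) * β x := by
      calc ENNReal.ofReal (4 * ‖L‖) ≤ ENNReal.ofReal ((4 * n * ν) * (trA A (H (x, t)) - ut (x, t))) := by
            apply ENNReal.ofReal_le_ofReal
            have : (n : ℝ) * ν * (ν⁻¹ * trc L) ≤ n * ν * (trA A (H (x, t)) - ut (x, t)) := by gcongr
            nlinarith
        _ = ENNReal.ofReal (4 * n * ν) * ENNReal.ofReal (trA A (H (x, t)) - ut (x, t)) :=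
            ENNReal.ofReal_mul (by positivity)
        _ ≤ ENNReal.ofReal (4 * n * ν) * (β x * ENNReal.ofReal (d2 * η)) := by
            refine mul_le_mul_right (hAeq.trans ?_) _
            refine mul_le_mul_right ?_ _
            rw [← ofReal_norm]
            exact ENNReal.ofReal_le_ofReal (gb x t p hc).2
        _ = ENNReal.ofReal (4 * n * ν) * ENNReal.ofReal (d2 * η) * β x := by ring
        _ = _ := by
            rw [← ENNReal.ofReal_mul (by positivity)]
            congr 2; ring
    refine ⟨Real.toNNReal (4 * ‖L‖) + δ, ?_, ?_⟩
    · push_cast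
      exact add_le_add_left hLe _
    have hcl : ‖L‖ < ‖L‖ + δ / 4 := by
      have : (0:ℝ) < δ := hδpos
      linarith
    obtain ⟨ρ, hρ, htay⟩ := taylor_le (hWev _ _ _ hc) (hWxx x t hc.1 hc.2.1) hcl
    obtain ⟨ρ2, hρ2, hball⟩ := Metric.isOpen_iff.1 hopen x ⟨f1, f2⟩
    have hnb : ball x (min ρ ρ2 / 3) ∈ 𝓝 x := ball_mem_nhds _ (by positivity)
    filter_upwards [self_mem_nhdsWithin, nhdsWithin_le_nhds hnb] with x' hx'E hx'b
    have hc' := hcon x' hx'E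
    set q := pp x' with hq
    by_cases hqp : q = p
    · rw [hqp, dist_self]; positivity
    have hqp' : 0 < ‖q - p‖ := norm_pos_iff.2 (sub_ne_zero.2 hqp)
    set r := ‖x' - x‖ with hr
    have hr3 : r < min ρ ρ2 / 3 := by rw [hr, ← dist_eq_norm]; exact hx'b
    have hr0 : 0 ≤ r := norm_nonneg _
    set h : En n := (x' - x) + (r / ‖q - p‖) • (q - p) with hh
    have hhn : ‖h‖ ≤ 2 * r := by
      refine (norm_add_le _ _).trans ?_
      rw [norm_smul, Real.norm_eq_abs, abs_of_nonneg (by positivity), div_mul_cancel₀ _ hqp'.ne']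
      linarith
    have hlt : ‖h‖ < min ρ ρ2 := by
      have : 0 < min ρ ρ2 := lt_min hρ hρ2
      linarith
    have k1 := htay h (hlt.trans_le (min_le_left _ _))
    have hmem : x + h ∈ {x : En n | κ < ‖x‖ ∧ ‖x‖ < 1 / 2} := hball (by
      rw [mem_ball, dist_eq_norm, add_sub_cancel_left]; exact hlt.trans_le (min_le_right _ _))
    have k2 := hc'.2.2.2 (x + h, t) ⟨⟨hmem.1.le, hmem.2.le⟩, hc.2.1⟩
    have k3 := hc.2.2.2 (x', tt x') ⟨hc'.1, hc'.2.1⟩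
    simp only at k2 k3
    have g1' : G (x, t) - η • Gg m x = p := g1
    rw [g1'] at k1
    have k4 : ⟪q - p, h - (x' - x)⟫ ≤ (‖L‖ + δ / 4) * ‖h‖ ^ 2 := by
      have i1 : ⟪q - p, h - (x' - x)⟫ = ⟪q, x + h⟫ - ⟪q, x'⟫ - ⟪p, h⟫ + ⟪p, x'⟫ - ⟪p, x⟫ := by
        simp only [inner_sub_left, inner_sub_right, inner_add_right]; ring
      rw [i1]; linarith
    have k5 : ⟪q - p, h - (x' - x)⟫ = r * ‖q - p‖ := by
      rw [hh, add_sub_cancel_left, inner_smul_right, real_inner_self_eq_norm_sq]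
      field_simp
    have k6 : ‖h‖ ^ 2 ≤ 4 * r ^ 2 := by nlinarith [norm_nonneg h]
    have k7 : r * ‖q - p‖ ≤ r * ((4 * ‖L‖ + δ) * r) := by
      have : 0 ≤ ‖L‖ + δ / 4 := by positivity
      rw [k5] at k4
      nlinarith
    rw [dist_eq_norm, dist_eq_norm, ← hr]
    push_cast
    rw [Real.coe_toNNReal _ (by positivity)]
    rcases hr0.eq_or_lt with h0 | h0
    · exfalso
      have : x' = x := by rw [← sub_eq_zero, ← norm_eq_zero, ← hr, ← h0]
      exact hqp (by rw [hq, this])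
    · exact le_of_mul_le_mul_left k7 h0) hδpos
  have hlast : ∫⁻ x in E, (l x + δ) ^ n ≤ ENNReal.ofReal (η ^ n) *
      (ENNReal.ofReal (8 * n * ν * d2) ^ n * (∫⁻ x in E, β x ^ n) + volume (ball (0 : En n) 1) / 2) := by
    have hpt : ∀ x, (l x + δ) ^ n ≤ ENNReal.ofReal (η ^ n) *
        (ENNReal.ofReal (8 * n * ν * d2) ^ n * β x ^ n + 2⁻¹) := by
      intro x
      have c1 : l x + δ = ENNReal.ofReal η * (ENNReal.ofReal (4 * n * ν * d2) * β x + ENNReal.ofReal (1 / 8)) := by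
        simp only [hl]
        rw [mul_add, ← mul_assoc, ← ENNReal.ofReal_mul hη.le, ← ENNReal.ofReal_mul hη.le, add_assoc,
          hδe, ← ENNReal.ofReal_add (by positivity) (by positivity)]
        congr 3 <;> ring
      rw [c1, mul_pow, ENNReal.ofReal_pow hη.le]
      refine mul_le_mul_right ?_ _
      have c2 : (ENNReal.ofReal (4 * n * ν * d2) * β x + ENNReal.ofReal (1 / 8)) ^ n ≤
          2 ^ n * ((ENNReal.ofReal (4 * n * ν * d2) * β x) ^ n + ENNReal.ofReal (1 / 8) ^ n) :=
        ennreal_add_pow _ _ n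
      refine c2.trans ?_
      rw [mul_add, ← mul_pow, ← mul_pow, ← mul_assoc, mul_pow]
      have c3 : (2:ℝ≥0∞) * ENNReal.ofReal (4 * n * ν * d2) = ENNReal.ofReal (8 * n * ν * d2) := by
        rw [show (2:ℝ≥0∞) = ENNReal.ofReal 2 by simp, ← ENNReal.ofReal_mul (by norm_num)]
        congr 1; ring
      rw [c3]
      gcongr
      have c4 : (2:ℝ≥0∞) * ENNReal.ofReal (1 / 8) = ENNReal.ofReal (1 / 4) := by
        rw [show (2:ℝ≥0∞) = ENNReal.ofReal 2 by simp, ← ENNReal.ofReal_mul (by norm_num)]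
        congr 1; norm_num
      rw [c4, ← ENNReal.ofReal_pow (by norm_num),
        show (2⁻¹ : ℝ≥0∞) = ENNReal.ofReal (2⁻¹) by
          rw [ENNReal.ofReal_inv_of_pos (by norm_num)]; simp]
      apply ENNReal.ofReal_le_ofReal
      calc ((1:ℝ) / 4) ^ n ≤ (1 / 4) ^ 1 := pow_le_pow_of_le_one (by norm_num) (by norm_num) hn
        _ ≤ _ := by norm_num
    refine (lintegral_mono hpt).trans ?_
    rw [lintegral_const_mul _ (by fun_prop), lintegral_add_right _ measurable_const,
      lintegral_const_mul _ (by fun_prop), setLIntegral_const]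
    gcongr
    rw [mul_comm, div_eq_mul_inv]
    gcongr
  have hvol : volume (closedBall (0 : En n) η) = ENNReal.ofReal (η ^ n) * volume (ball (0 : En n) 1) := by
    rw [Measure.addHaar_closedBall _ _ hη.le]; simp
  have hfin := (measure_mono hsurj).trans (hLip.trans hlast)
  rw [hvol] at hfin
  have hηn : ENNReal.ofReal (η ^ n) ≠ 0 := by simp; positivity
  have hfin2 := (ENNReal.mul_le_mul_iff_right hηn ENNReal.ofReal_ne_top).1 hfin
  exact ennreal_absorb measure_ball_lt_top.ne hfin2

set_option maxHeartbeats 1000000 in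
theorem lemE (hn : 0 < n) {ν : ℝ} (hν : 1 ≤ ν) {κ : ℝ} (hκ : 0 < κ) (hκ4 : κ < 1 / 4) (S : ℝ) :
    ∃ T c : ℝ, 0 < T ∧ 0 < c ∧ ∀ (β : En n → ℝ≥0∞) (u : En n × ℝ → ℝ) (a b ts δ : ℝ),
      Measurable β → Super ν β u (ball 0 1 ×ˢ Ioo a b) → a < ts - T → ts < b → 0 < δ →
      (∀ X ∈ (ball (0 : En n) 1 ×ˢ Ioo a b), 0 ≤ u X) →
      (∫⁻ x in ball (0 : En n) 1, β x ^ n) ≤ ENNReal.ofReal S →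
      (∀ x : En n, ‖x‖ ≤ κ → ∀ t ∈ Icc (ts - T) ts, δ ≤ u (x, t)) →
      ∀ x : En n, ‖x‖ ≤ 1 / 4 → c * δ ≤ u (x, ts) := by
  have hν0 : 0 < ν := by linarith
  set m : ℕ := ⌈(n:ℝ) * ν ^ 2⌉₊ + 1 with hmdef
  have hm : 1 ≤ m := by omega
  have hm2 : n * ν ^ 2 ≤ 2 * m + 1 := by
    have h1 := Nat.le_ceil ((n:ℝ) * ν ^ 2)
    have h2 : (m : ℝ) = (⌈(n:ℝ) * ν ^ 2⌉₊ : ℝ) + 1 := by rw [hmdef]; push_cast; ring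
    have h3 : (0:ℝ) ≤ (⌈(n:ℝ) * ν ^ 2⌉₊ : ℝ) := by positivity
    linarith
  set d2 : ℝ := 2 * m * (κ ^ (2 * m + 1))⁻¹ + 1 with hd2
  have hd21 : 1 ≤ d2 := by
    have : 0 ≤ 2 * m * (κ ^ (2 * m + 1))⁻¹ := by positivity
    linarith
  have hd2p : 0 < d2 := by linarith
  set lam : ℝ := d2⁻¹ with hlam
  have hlamp : 0 < lam := by positivity
  have hlam1 : lam ≤ 1 := inv_le_one_of_one_le₀ hd21
  set A : ℝ := ((κ ^ 2) ^ m)⁻¹ with hA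
  have hAp : 0 < A := by positivity
  set Cn : ℝ≥0∞ := ENNReal.ofReal (8 * n * ν * d2) ^ n with hCn
  set v1 : ℝ≥0∞ := volume (ball (0 : En n) 1) with hv1
  have hv1p : 0 < v1 := measure_ball_pos _ _ one_pos
  have hv1t : v1 ≠ ∞ := measure_ball_lt_top.ne
  have hXt : 2 * (Cn * ENNReal.ofReal S) ≠ ∞ := by
    refine ENNReal.mul_ne_top (by norm_num) (ENNReal.mul_ne_top ?_ ENNReal.ofReal_ne_top)
    exact ENNReal.pow_ne_top ENNReal.ofReal_ne_top
  obtain ⟨K, hK⟩ := ENNReal.exists_nat_mul_gt hv1p.ne' hXt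
  refine ⟨(lam ^ K)⁻¹ * A * ν, min 1 (10 * lam ^ K / (2 * A)), by positivity, by positivity, ?_⟩
  intro β u a b ts δ hβ hSu ha hb hδ hpos hint hlow xs hxs4
  set T : ℝ := (lam ^ K)⁻¹ * A * ν with hT
  have hTp : 0 < T := by positivity
  by_cases hxk : ‖xs‖ ≤ κ
  · have h1 := hlow xs hxk ts ⟨by linarith, le_rfl⟩
    have h2 : min 1 (10 * lam ^ K / (2 * A)) ≤ 1 := min_le_left _ _
    nlinarith
  push Not at hxk
  have hxs0 : xs ≠ 0 := norm_pos_iff.1 (hκ.trans hxk)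
  by_contra hcon
  push Not at hcon
  set η0 : ℝ := δ / (2 * A) with hη0
  have hη0p : 0 < η0 := by positivity
  have hsmall : u (xs, ts) < 10 * (η0 * lam ^ K) := by
    refine hcon.trans_le ?_
    calc min 1 (10 * lam ^ K / (2 * A)) * δ ≤ 10 * lam ^ K / (2 * A) * δ := by
          gcongr; exact min_le_right _ _
      _ = _ := by rw [hη0]; ring
  set B : ℝ := η0 * lam ^ K * ν⁻¹ with hB
  have hBp : 0 < B := by positivity
  have hBT : B * T = η0 * A := by rw [hB, hT]; field_simp
  obtain ⟨ut, G, H, hR, hS⟩ := hSu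
  have hη0A : η0 * A = δ / 2 := by rw [hη0]; field_simp
  have key : ∀ k : ℕ, k < K → _ := fun k hk =>
    E_core hn hν hm hm2 hβ hR hS (t0 := ts - T) (ts := ts) (B := B) (η := η0 * lam ^ k) hκ ha
    (by linarith) hb (by positivity)
    (by
      rw [hB]
      have : lam ^ K ≤ lam ^ k := pow_le_pow_of_le_one hlamp.le hlam1 hk.le
      gcongr) hd2 (xs := xs) hxk hxs4
    (by
      intro x hx1 hx2 t ht hor
      have hη : η0 * lam ^ k ≤ η0 := by
        have : lam ^ k ≤ 1 := pow_le_one₀ hlamp.le hlam1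
        nlinarith
      have hηp : 0 < η0 * lam ^ k := by positivity
      have hGA := Gf_nonneg_le (m := m) hκ hx1
      have hx1' : x ∈ ball (0 : En n) 1 := by
        rw [mem_ball_zero_iff]; linarith
      have hu := hpos (x, t) ⟨hx1', by linarith [ht.1], by linarith [ht.2]⟩
      have hle : η0 * lam ^ k * Gf m x ≤ η0 * A := by
        calc η0 * lam ^ k * Gf m x ≤ η0 * lam ^ k * A := by gcongr
          _ ≤ η0 * A := by gcongr
      have hBt : 0 ≤ B * (ts - t) := mul_nonneg hBp.le (by linarith [ht.2])
      rcases hor with h | h | h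
      · have := hlow x h.le t ht
        linarith
      · rw [Gf_half m h]; linarith
      · rw [h]
        have : ts - (ts - T) = T := by ring
        rw [this, hBT]
        rw [h] at hu
        linarith)
    (by
      have h12 := Gf_quarter hm hxs0 hxs4
      have hηp : 0 < η0 * lam ^ k := by positivity
      have : lam ^ K ≤ lam ^ k := pow_le_pow_of_le_one hlamp.le hlam1 hk.le
      have h3 : η0 * lam ^ K ≤ η0 * lam ^ k := by gcongr
      have h4 : η0 * lam ^ k * 12 ≤ η0 * lam ^ k * Gf m xs := by gcongr
      linarith)
  choose! E hEm hEs hEg hEv using key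
  have hdis : ∀ i j, i < j → j < K → Disjoint (E i) (E j) := by
    intro i j hij hj
    rw [Set.disjoint_left]
    intro x hxi hxj
    have hxb := hEs j hj hxj
    obtain ⟨t, ht, hmin⟩ := (isCompact_Icc (a := ts - T) (b := ts)).exists_isMinOn
      ⟨ts, by constructor <;> linarith⟩ (f := fun t => u (x, t) + B * (ts - t)) (by
        refine ContinuousOn.add ?_ (by fun_prop)
        refine hR.cu.comp (by fun_prop) ?_
        intro t ht
        exact ⟨hxb, by linarith [ht.1], by linarith [ht.2]⟩)
    have h1 := hEg i (hij.trans hj) x hxi t ht (fun s hs => hmin hs)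
    have h2 := hEg j hj x hxj t ht (fun s hs => hmin hs)
    have h3 : d2 * (η0 * lam ^ j) ≤ η0 * lam ^ i := by
      have : lam ^ j ≤ lam ^ (i + 1) := pow_le_pow_of_le_one hlamp.le hlam1 hij
      calc d2 * (η0 * lam ^ j) ≤ d2 * (η0 * lam ^ (i + 1)) := by gcongr
        _ = (d2 * lam) * (η0 * lam ^ i) := by ring
        _ = _ := by rw [hlam, mul_inv_cancel₀ hd2p.ne', one_mul]
    have hηp : 0 < η0 * lam ^ i := by positivity
    linarith [h1.1, h2.2]
  have hsum : (K : ℝ≥0∞) * v1 ≤ 2 * (Cn * ENNReal.ofReal S) := by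
    calc (K : ℝ≥0∞) * v1 = ∑ k ∈ Finset.range K, v1 := by simp
      _ ≤ ∑ k ∈ Finset.range K, 2 * (Cn * ∫⁻ x in E k, β x ^ n) :=
          Finset.sum_le_sum fun k hk => hEv k (Finset.mem_range.1 hk)
      _ = 2 * (Cn * ∑ k ∈ Finset.range K, ∫⁻ x in E k, β x ^ n) := by
          rw [Finset.mul_sum, Finset.mul_sum]
      _ = 2 * (Cn * ∫⁻ x in ⋃ k ∈ Finset.range K, E k, β x ^ n) := by
          rw [lintegral_biUnion_finset]
          · intro i hi j hj hij
            rcases lt_or_gt_of_ne hij with h | h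
            · exact hdis i j h (Finset.mem_range.1 hj)
            · exact (hdis j i h (Finset.mem_range.1 hi)).symm
          · exact fun k hk => hEm k (Finset.mem_range.1 hk)
      _ ≤ 2 * (Cn * ENNReal.ofReal S) := by
          gcongr
          refine (lintegral_mono_set ?_).trans hint
          exact iUnion₂_subset fun k hk => hEs k (Finset.mem_range.1 hk)
  exact absurd hK (not_lt.2 hsum)

/-! ### ABP -/

def abpF (w : En n × ℝ → ℝ) (G : En n × ℝ → En n) (X : En n × ℝ) : En n × ℝ :=
  (G X, w X - ⟪X.1, G X⟫)

def abpD (x g : En n) (wt : ℝ) (L : En n →L[ℝ] En n) : En n × ℝ →L[ℝ] En n × ℝ :=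
  (L.coprod (ContinuousLinearMap.toSpanSingleton ℝ g)).prod
    ((ContinuousLinearMap.toSpanSingleton ℝ wt).comp (ContinuousLinearMap.snd ℝ (En n) ℝ)
      - (innerSL ℝ x).comp (L.coprod (ContinuousLinearMap.toSpanSingleton ℝ g)))

lemma abpD_det (x g : En n) (wt : ℝ) (L : En n →L[ℝ] En n) :
    (abpD x g wt L).det = wt * L.det := by
  have key : ((abpD x g wt L : En n × ℝ →L[ℝ] En n × ℝ) : En n × ℝ →ₗ[ℝ] En n × ℝ) =
      (LinearMap.transvection
        (-((innerSL ℝ x : En n →L[ℝ] ℝ) : En n →ₗ[ℝ] ℝ) ∘ₗ LinearMap.fst ℝ (En n) ℝ)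
          ((0, 1) : En n × ℝ)) ∘ₗ
      (LinearMap.prodMap (LinearMap.id : En n →ₗ[ℝ] En n) (wt • (LinearMap.id : ℝ →ₗ[ℝ] ℝ))) ∘ₗ
      (LinearMap.transvection (LinearMap.snd ℝ (En n) ℝ) ((g, 0) : En n × ℝ)) ∘ₗ
      (LinearMap.prodMap (L : En n →ₗ[ℝ] En n) (LinearMap.id : ℝ →ₗ[ℝ] ℝ)) := by
    refine LinearMap.ext fun v => ?_
    simp only [abpD, LinearMap.comp_apply, LinearMap.transvection.apply]
    ext
    · simp
    · simp
      ring
  rw [ContinuousLinearMap.det, key, LinearMap.det_comp, LinearMap.det_comp, LinearMap.det_comp,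
    LinearMap.transvection.det, LinearMap.transvection.det, LinearMap.det_prodMap,
    LinearMap.det_prodMap]
  simp

lemma Reg.strict {w wt : En n × ℝ → ℝ} {G H Q} (h : Reg w wt G H Q) (hQ : IsOpen Q)
    {X : En n × ℝ} (hX : X ∈ Q) :
    HasFDerivAt w ((innerSL ℝ (G X)).coprod (ContinuousLinearMap.toSpanSingleton ℝ (wt X))) X := by
  have hn : Q ∈ nhds X := hQ.mem_nhds hX
  exact (hasStrictFDerivAt_uncurry_coprod (𝕜 := ℝ) (u := X) (f := fun x t => w (x,t))
    (f₁ := fun x t => innerSL ℝ (G (x,t)))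
    (f₂ := fun x t => ContinuousLinearMap.toSpanSingleton ℝ (wt (x,t)))
    (Filter.eventually_of_mem hn fun Y hY => h.dx Y hY)
    (Filter.eventually_of_mem hn fun Y hY => (h.dt Y hY).hasFDerivAt)
    ((innerSL ℝ).continuous.continuousAt.comp (h.cG.continuousAt hn))
    ((ContinuousLinearMap.toSpanSingletonCLE (𝕜 := ℝ) (E := ℝ)).continuous.continuousAt.comp
      (h.cut.continuousAt hn))).hasFDerivAt

lemma Reg.strictG {w wt : En n × ℝ → ℝ} {G H Q} {g : En n × ℝ → En n}
    (h : Reg w wt G H Q) (hQ : IsOpen Q)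
    (hg : ∀ X ∈ Q, HasDerivAt (fun t => G (X.1,t)) (g X) X.2) (cg : ContinuousOn g Q)
    {X : En n × ℝ} (hX : X ∈ Q) :
    HasFDerivAt G ((H X).coprod (ContinuousLinearMap.toSpanSingleton ℝ (g X))) X := by
  have hn : Q ∈ nhds X := hQ.mem_nhds hX
  exact (hasStrictFDerivAt_uncurry_coprod (𝕜 := ℝ) (u := X) (f := fun x t => G (x,t))
    (f₁ := fun x t => H (x,t))
    (f₂ := fun x t => ContinuousLinearMap.toSpanSingleton ℝ (g (x,t)))
    (Filter.eventually_of_mem hn fun Y hY => h.dxx Y hY)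
    (Filter.eventually_of_mem hn fun Y hY => (hg Y hY).hasFDerivAt)
    (h.cH.continuousAt hn)
    ((ContinuousLinearMap.toSpanSingletonCLE (𝕜 := ℝ) (E := En n)).continuous.continuousAt.comp
      (cg.continuousAt hn))).hasFDerivAt

lemma abpF_deriv {w wt : En n × ℝ → ℝ} {G H Q} {g : En n × ℝ → En n}
    (h : Reg w wt G H Q) (hQ : IsOpen Q)
    (hg : ∀ X ∈ Q, HasDerivAt (fun t => G (X.1,t)) (g X) X.2) (cg : ContinuousOn g Q)
    {X : En n × ℝ} (hX : X ∈ Q) :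
    HasFDerivAt (abpF w G) (abpD X.1 (g X) (wt X) (H X)) X := by
  have h1 := h.strict hQ hX
  have h2 := h.strictG hQ hg cg hX
  have h3 := h2.prodMk (h1.sub (hasFDerivAt_fst.inner ℝ h2))
  refine h3.congr_fderiv ?_
  refine ContinuousLinearMap.ext fun v => ?_
  simp only [abpD]
  ext
  · simp
  · simp [real_inner_comm]
    ring

def abpK (n : ℕ) (t1 : ℝ) : Set (En n × ℝ) := closedBall 0 3 ×ˢ Icc 0 t1

lemma abpK_compact (t1 : ℝ) : IsCompact (abpK n t1) :=
  (isCompact_closedBall _ _).prod isCompact_Icc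

def abpS (w wt : En n × ℝ → ℝ) (G : En n × ℝ → En n) (H : En n × ℝ → En n →L[ℝ] En n)
    (t1 : ℝ) : Set (En n × ℝ) :=
  {X | X ∈ abpK n t1 ∧ w X ∈ Icc (-5/2:ℝ) (-1/2) ∧ (∀ τ ∈ Icc (0:ℝ) 1, w X ≤ w (X.1, τ * X.2)) ∧
    PSD (H X) ∧ ‖G X‖ ≤ 1/6 ∧ wt X ≤ 0}

lemma isClosed_PSD : IsClosed {L : En n →L[ℝ] En n | PSD L} := by
  have : {L : En n →L[ℝ] En n | PSD L} =
      (⋂ x, ⋂ y, {L : En n →L[ℝ] En n | ⟪L x, y⟫ = ⟪x, L y⟫}) ∩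
      ⋂ x, {L : En n →L[ℝ] En n | 0 ≤ ⟪L x, x⟫} := by
    ext L; simp [PSD]
  rw [this]
  refine IsClosed.inter (isClosed_iInter fun x => isClosed_iInter fun y => ?_)
    (isClosed_iInter fun x => ?_)
  · exact isClosed_eq (by fun_prop) (by fun_prop)
  · exact isClosed_le (by fun_prop) (by fun_prop)

lemma abpS_closed {w wt : En n × ℝ → ℝ} {G H U t1} (h : Reg w wt G H U)
    (hK : abpK n t1 ⊆ U) : IsClosed (abpS w wt G H t1) := by
  have hc : IsClosed (abpK n t1) := (abpK_compact t1).isClosed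
  have e : abpS w wt G H t1 =
      (abpK n t1 ∩ w ⁻¹' Icc (-5/2:ℝ) (-1/2)) ∩
      (⋂ τ : Icc (0:ℝ) 1, {X | X ∈ abpK n t1 ∧ w X ≤ w (X.1, τ.1 * X.2)}) ∩
      (abpK n t1 ∩ H ⁻¹' {L | PSD L}) ∩ (abpK n t1 ∩ (fun X => ‖G X‖) ⁻¹' Iic (1/6)) ∩
      (abpK n t1 ∩ wt ⁻¹' Iic 0) := by
    ext X
    simp only [abpS, mem_ofPred_eq, mem_inter_iff, mem_preimage, mem_iInter, Subtype.forall,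
      mem_Iic]
    constructor
    · rintro ⟨a, b, c, d, e, f⟩
      exact ⟨⟨⟨⟨⟨a, b⟩, fun τ hτ => ⟨a, c τ hτ⟩⟩, a, d⟩, a, e⟩, a, f⟩
    · rintro ⟨⟨⟨⟨⟨a, b⟩, c⟩, _, d⟩, _, e⟩, _, f⟩
      exact ⟨a, b, fun τ hτ => (c τ hτ).2, d, e, f⟩
  rw [e]
  have hw := h.cu.mono hK
  refine (((IsClosed.inter ?_ ?_).inter ?_).inter ?_).inter ?_
  · exact hw.preimage_isClosed_of_isClosed hc isClosed_Icc
  · refine isClosed_iInter fun τ => ?_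
    refine hc.isClosed_le hw (hw.comp (by fun_prop) ?_)
    rintro ⟨x, t⟩ ⟨hx, ht⟩
    refine ⟨hx, mul_nonneg τ.2.1 ht.1, ?_⟩
    exact (mul_le_of_le_one_left ht.1 τ.2.2).trans ht.2
  · exact (h.cH.mono hK).preimage_isClosed_of_isClosed hc isClosed_PSD
  · exact (h.cG.mono hK).norm.preimage_isClosed_of_isClosed hc isClosed_Iic
  · exact (h.cut.mono hK).preimage_isClosed_of_isClosed hc isClosed_Iic

set_option maxHeartbeats 1000000 in
lemma abp_contact {w wt : En n × ℝ → ℝ} {G H U t1} (h : Reg w wt G H U) (hU : IsOpen U)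
    (hK : abpK n t1 ⊆ U) (hb : ∀ X ∈ abpK n t1, (X.2 = 0 ∨ ‖X.1‖ = 3) → 0 ≤ w X)
    {x1 : En n} (hX1 : (x1, t1) ∈ abpK n t1) (hw1 : w (x1, t1) ≤ -3)
    {p : En n} {k : ℝ} (hp : ‖p‖ ≤ 1/6) (hk : k ∈ Icc (-2:ℝ) (-1)) :
    (p, k) ∈ abpF w G '' abpS w wt G H t1 := by
  have hw := h.cu.mono hK
  have hin : ∀ X ∈ abpK n t1, |⟪p, X.1⟫| ≤ 1/2 := by
    rintro ⟨x, t⟩ ⟨hx, -⟩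
    have hx3 : ‖x‖ ≤ 3 := by simpa using hx
    have := abs_real_inner_le_norm p x
    have h2 : ‖p‖ * ‖x‖ ≤ 1/6 * 3 := by gcongr
    show |⟪p, x⟫| ≤ 1/2
    linarith
  set f : En n × ℝ → ℝ := fun X => w X - ⟪p, X.1⟫ - k with hf
  have hfc : ContinuousOn f (abpK n t1) := by
    refine (hw.sub ?_).sub continuousOn_const
    exact (by fun_prop : Continuous fun X : En n × ℝ => ⟪p, X.1⟫).continuousOn
  set C := abpK n t1 ∩ f ⁻¹' Iic 0 with hC
  have hCc : IsCompact C := by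
    refine (abpK_compact t1).of_isClosed_subset
      (hfc.preimage_isClosed_of_isClosed (abpK_compact t1).isClosed isClosed_Iic) inter_subset_left
  have hCn : C.Nonempty := by
    refine ⟨(x1, t1), hX1, ?_⟩
    have := abs_le.1 (hin _ hX1)
    simp only [mem_preimage, mem_Iic, hf] at this ⊢
    linarith [hk.1]
  obtain ⟨⟨x, t⟩, ⟨hXK, hXf⟩, hmin⟩ := hCc.exists_isMinOn hCn (f := fun X => X.2) (by fun_prop)
  have hi := abs_le.1 (hin _ hXK)
  have hXK' := hXK
  obtain ⟨hx, ht⟩ := hXK'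
  simp only at hx ht hi
  have hx3 : ‖x‖ ≤ 3 := by simpa using hx
  simp only [mem_preimage, mem_Iic, hf] at hXf
  have hwneg : w (x, t) < 0 := by linarith [hk.2]
  have ht0 : 0 < t := by
    rcases ht.1.eq_or_lt with h0 | h0
    · exact absurd (hb _ hXK (Or.inl h0.symm)) (not_le.2 hwneg)
    · exact h0
  have hx3' : ‖x‖ < 3 := by
    rcases hx3.eq_or_lt with h0 | h0
    · exact absurd (hb _ hXK (Or.inr h0)) (not_le.2 hwneg)
    · exact h0
  have hearly : ∀ y, ‖y‖ ≤ 3 → ∀ τ, 0 ≤ τ → τ < t → 0 < f (y, τ) := by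
    intro y hy τ h0 hτ
    by_contra hc
    push Not at hc
    have : (y, τ) ∈ C := ⟨⟨by simpa using hy, h0, hτ.le.trans ht.2⟩, hc⟩
    have := hmin this
    simp only [mem_ofPred_eq] at this
    linarith
  -- at time t, f ≥ 0
  have hnow : ∀ y, ‖y‖ ≤ 3 → 0 ≤ f (y, t) := by
    intro y hy
    have hyK : (y, t) ∈ abpK n t1 := ⟨by simpa using hy, ht⟩
    have hcw : ContinuousWithinAt (fun τ => f (y, τ)) (Ico 0 t) t := by
      refine (hfc (y, t) hyK).comp (f := fun τ : ℝ => ((y, τ) : En n × ℝ))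
        (by fun_prop : Continuous fun τ : ℝ => ((y, τ) : En n × ℝ)).continuousWithinAt ?_
      intro τ hτ
      exact ⟨by simpa using hy, hτ.1, hτ.2.le.trans ht.2⟩
    have hne : (nhdsWithin t (Ico 0 t)).NeBot := by
      refine mem_closure_iff_nhdsWithin_neBot.1 ?_
      rw [closure_Ico ht0.ne]
      exact ⟨ht0.le, le_rfl⟩
    refine ge_of_tendsto hcw ?_
    filter_upwards [self_mem_nhdsWithin] with τ hτ
    exact (hearly y hy τ hτ.1 hτ.2).le
  have hf0 : f (x, t) = 0 := le_antisymm (by simpa [hf] using hXf) (hnow x hx3)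
  have hwe : w (x, t) = ⟪p, x⟫ + k := by simp only [hf] at hf0; linarith
  have hXU := hK hXK
  -- spatial min
  have hmin2 : IsLocalMin (fun y => f (y, t)) x := by
    have : ball (0:En n) 3 ∈ nhds x := isOpen_ball.mem_nhds (by simpa using hx3')
    filter_upwards [this] with y hy
    rw [hf0]
    exact hnow y (by simpa using (mem_ball.1 hy).le)
  have hUx : ∀ᶠ y in nhds x, ((y, t) : En n × ℝ) ∈ U :=
    (by fun_prop : Continuous fun y : En n => ((y, t) : En n × ℝ)).continuousAt.eventually_mem
      (hU.mem_nhds hXU)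
  have hp2 := hess_psd (f := fun y => f (y, t)) (g := fun y => G (y, t) - p) (L := H (x, t))
    (x₀ := x) (by
      filter_upwards [hUx] with y hy
      have := ((h.dx _ hy).sub ((innerSL ℝ p).hasFDerivAt (x := y))).sub_const k
      refine this.congr_fderiv ?_
      ext v; simp) ((h.dxx _ hXU).sub_const p) hmin2
  have hG : G (x, t) = p := sub_eq_zero.1 hp2.1
  have hwt : wt (x, t) ≤ 0 := by
    refine deriv_nonpos_of_left (h.dt _ hXU) ?_
    have : Ioo 0 t ∈ nhdsWithin t (Iio t) := Ioo_mem_nhdsLT ht0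
    filter_upwards [this] with τ hτ
    have := hearly x hx3 τ hτ.1.le hτ.2
    simp only [hf] at this
    show w (x, t) ≤ w (x, τ)
    linarith
  refine ⟨(x, t), ⟨hXK, ⟨by rw [hwe]; linarith [hk.1], by rw [hwe]; linarith [hk.2]⟩, ?_, hp2.2,
    by rw [hG]; exact hp, hwt⟩, ?_⟩
  · intro τ hτ
    show w (x, t) ≤ w (x, τ * t)
    rcases hτ.2.eq_or_lt with h1 | h1
    · rw [h1, one_mul]
    · have := hearly x hx3 (τ * t) (mul_nonneg hτ.1 ht0.le) (by nlinarith)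
      simp only [hf] at this
      linarith
  · simp only [abpF, hG, hwe, real_inner_comm]
    ext <;> simp

lemma abp_vol {w wt : En n × ℝ → ℝ} {G H U t1} {g : En n × ℝ → En n}
    (h : Reg w wt G H U) (hU : IsOpen U)
    (hg : ∀ X ∈ U, HasDerivAt (fun t => G (X.1,t)) (g X) X.2) (cg : ContinuousOn g U)
    (hK : abpK n t1 ⊆ U) (hb : ∀ X ∈ abpK n t1, (X.2 = 0 ∨ ‖X.1‖ = 3) → 0 ≤ w X)
    {x1 : En n} (hX1 : (x1, t1) ∈ abpK n t1) (hw1 : w (x1, t1) ≤ -3) :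
    volume (closedBall (0:En n) (1/6) ×ˢ Icc (-2:ℝ) (-1)) ≤
      ∫⁻ X in abpS w wt G H t1, ENNReal.ofReal (|wt X| * |(H X).det|) := by
  have : (volume : Measure (En n × ℝ)).IsAddHaarMeasure := by
    rw [Measure.volume_eq_prod]; infer_instance
  have hS : MeasurableSet (abpS w wt G H t1) := (abpS_closed h hK).measurableSet
  have h1 : closedBall (0:En n) (1/6) ×ˢ Icc (-2:ℝ) (-1) ⊆ abpF w G '' abpS w wt G H t1 := by
    rintro ⟨p, k⟩ ⟨hp, hk⟩
    exact abp_contact h hU hK hb hX1 hw1 (by simpa using hp) hk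
  refine (measure_mono h1).trans ?_
  refine (addHaar_image_le_lintegral_abs_det_fderiv volume hS
    (fun X hX => (abpF_deriv h hU hg cg (hK hX.1)).hasFDerivWithinAt)).trans (le_of_eq ?_)
  refine lintegral_congr fun X => ?_
  rw [abpD_det, abs_mul]

lemma abp_tonelli {w wt : En n × ℝ → ℝ} {G H U t1}
    (h : Reg w wt G H U) (hK : abpK n t1 ⊆ U) {β : En n → ℝ≥0∞} (hβ : Measurable β) :
    ∫⁻ X in abpS w wt G H t1, ENNReal.ofReal (-wt X) * β X.1 ^ n ≤
      2 * ∫⁻ x in ball (0:En n) 4, β x ^ n := by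
  set S := abpS w wt G H t1 with hSd
  have hS : MeasurableSet S := (abpS_closed h hK).measurableSet
  have hSU : S ⊆ U := fun X hX => hK hX.1
  have hm : AEMeasurable (fun X : En n × ℝ => ENNReal.ofReal (-wt X)) (volume.restrict S) :=
    ((h.cut.mono hSU).aemeasurable hS).neg.ennreal_ofReal
  have hm2 : AEMeasurable (fun X : En n × ℝ => ENNReal.ofReal (-wt X) * β X.1 ^ n)
      (volume.restrict S) := hm.mul ((hβ.comp measurable_fst).pow_const n).aemeasurable
  rw [← lintegral_indicator hS, Measure.volume_eq_prod, lintegral_prod _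
    (by rw [← Measure.volume_eq_prod]; exact (aemeasurable_indicator_iff hS).2 hm2),
    ← lintegral_const_mul' _ _ (by simp), ← lintegral_indicator measurableSet_ball]
  refine lintegral_mono fun x => ?_
  by_cases hx : x ∈ ball (0:En n) 4
  swap
  · have : ∀ t, S.indicator (fun X : En n × ℝ => ENNReal.ofReal (-wt X) * β X.1 ^ n) (x, t) = 0 := by
      intro t
      refine indicator_of_notMem ?_ _
      intro hX
      apply hx
      have := hX.1.1
      simp only [mem_closedBall, dist_zero_right, mem_ball] at this ⊢
      linarith
    simp [this]
  rw [indicator_of_mem hx]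
  set Sx : Set ℝ := {t | (x, t) ∈ S} with hSx
  have hSxm : MeasurableSet Sx := hS.preimage (by fun_prop : Measurable fun t : ℝ => (x, t))
  have e1 : ∀ t, S.indicator (fun X : En n × ℝ => ENNReal.ofReal (-wt X) * β X.1 ^ n) (x, t) =
      Sx.indicator (fun t => ENNReal.ofReal (-wt (x,t)) * β x ^ n) t := by
    intro t
    by_cases ht : (x, t) ∈ S
    · rw [indicator_of_mem ht, indicator_of_mem (show t ∈ Sx from ht)]
    · rw [indicator_of_notMem ht, indicator_of_notMem (show t ∉ Sx from ht)]
  simp only [e1]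
  have hcx : ContinuousOn (fun t => wt (x, t)) Sx :=
    (h.cut.mono hSU).comp (by fun_prop : Continuous fun t : ℝ => (x, t)).continuousOn
      (fun t ht => ht)
  have hcm : AEMeasurable (fun t => ENNReal.ofReal (-wt (x, t))) (volume.restrict Sx) :=
    (hcx.aemeasurable hSxm).neg.ennreal_ofReal
  rw [lintegral_indicator hSxm, lintegral_mul_const'' _ hcm]
  gcongr
  have ha : AntitoneOn (fun t => w (x, t)) Sx := by
    intro t ht t' ht' htt
    have h0 : 0 ≤ t := ht.1.2.1
    rcases (h0.trans htt).eq_or_lt with h1 | h1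
    · have : t = t' := by linarith
      rw [this]
    · have := ht'.2.2.1 (t / t') ⟨by positivity, (div_le_one h1).2 htt⟩
      simp only [div_mul_cancel₀ _ h1.ne'] at this
      exact this
  rw [lintegral_deriv_eq_volume_image_of_antitoneOn hSxm
    (fun t ht => (h.dt (x,t) (hSU ht)).hasDerivWithinAt) ha]
  have : (fun t => w (x, t)) '' Sx ⊆ Icc (-5/2) (-1/2) := by
    rintro _ ⟨t, ht, rfl⟩
    exact ht.2.1
  refine (measure_mono this).trans ?_
  rw [Real.volume_Icc]
  norm_num

/-! ### Steklov averages -/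

def Av {E : Type*} [NormedAddCommGroup E] [NormedSpace ℝ E] (ε : ℝ) (f : En n × ℝ → E)
    (X : En n × ℝ) : E := ∫ s in (0:ℝ)..1, f (X.1, X.2 + ε * s)


section
variable {E : Type*} [NormedAddCommGroup E] [NormedSpace ℝ E]

lemma Av_mem {R a b ε : ℝ} (hε : 0 < ε) {X : En n × ℝ} (hX : X ∈ ball (0:En n) R ×ˢ Ioo a (b - ε))
    {s : ℝ} (hs : s ∈ Icc (0:ℝ) 1) : (X.1, X.2 + ε * s) ∈ ball (0:En n) R ×ˢ Ioo a b := by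
  obtain ⟨hx, h1, h2⟩ := hX
  refine ⟨hx, ?_, ?_⟩
  · have := mul_nonneg hε.le hs.1
    show a < X.2 + ε * s
    linarith
  · have := mul_le_mul_of_nonneg_left hs.2 hε.le
    show X.2 + ε * s < b
    linarith

lemma Av_contOn {R a b ε : ℝ} (hε : 0 < ε) {f : En n × ℝ → E}
    (hf : ContinuousOn f (ball (0:En n) R ×ˢ Ioo a b)) {X : En n × ℝ}
    (hX : X ∈ ball (0:En n) R ×ˢ Ioo a (b - ε)) :
    ContinuousOn (fun s => f (X.1, X.2 + ε * s)) (uIcc (0:ℝ) 1) := by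
  rw [uIcc_of_le zero_le_one]
  exact hf.comp (by fun_prop) (fun s hs => Av_mem hε hX hs)

lemma Av_meas {R a b ε : ℝ} (hε : 0 < ε) {f : En n × ℝ → E}
    (hf : ContinuousOn f (ball (0:En n) R ×ˢ Ioo a b)) {X : En n × ℝ}
    (hX : X ∈ ball (0:En n) R ×ˢ Ioo a (b - ε)) :
    AEStronglyMeasurable (fun s => f (X.1, X.2 + ε * s)) (volume.restrict (uIoc (0:ℝ) 1)) :=
  ((Av_contOn hε hf hX).mono uIoc_subset_uIcc).aestronglyMeasurable measurableSet_uIoc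

lemma Av_loc {R a b ε : ℝ} (hε : 0 < ε) {f : En n × ℝ → E}
    (hf : ContinuousOn f (ball (0:En n) R ×ˢ Ioo a b)) {X : En n × ℝ}
    (hX : X ∈ ball (0:En n) R ×ˢ Ioo a (b - ε)) :
    ∃ δ > 0, ∃ C : ℝ, ∀ y t, dist y X.1 < δ → dist t X.2 < δ →
      (y, t) ∈ ball (0:En n) R ×ˢ Ioo a (b - ε) ∧ ∀ s ∈ Icc (0:ℝ) 1, ‖f (y, t + ε * s)‖ ≤ C := by
  obtain ⟨hx, h1, h2⟩ := hX
  have hx' : ‖X.1‖ < R := by simpa using hx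
  set δ := min ((R - ‖X.1‖)/2) (min ((X.2 - a)/2) ((b - ε - X.2)/2)) with hδ
  have d1 : δ ≤ (R - ‖X.1‖)/2 := min_le_left _ _
  have d2 : δ ≤ (X.2 - a)/2 := (min_le_right _ _).trans (min_le_left _ _)
  have d3 : δ ≤ (b - ε - X.2)/2 := (min_le_right _ _).trans (min_le_right _ _)
  have d0 : 0 < δ := by
    refine lt_min ?_ (lt_min ?_ ?_) <;> linarith
  have hc : IsCompact (closedBall X.1 δ ×ˢ Icc (X.2 - δ) (X.2 + ε + δ)) :=
    (isCompact_closedBall _ _).prod isCompact_Icc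
  have hsub : closedBall X.1 δ ×ˢ Icc (X.2 - δ) (X.2 + ε + δ) ⊆ ball (0:En n) R ×ˢ Ioo a b := by
    rintro ⟨y, t⟩ ⟨hy, ht⟩
    have hy' : dist y X.1 ≤ δ := hy
    have ht1 : X.2 - δ ≤ t := ht.1
    have ht2 : t ≤ X.2 + ε + δ := ht.2
    have hy2 : ‖y‖ ≤ ‖X.1‖ + δ := by
      have := norm_le_norm_add_norm_sub X.1 y
      rw [← dist_eq_norm, dist_comm] at this; linarith
    refine ⟨?_, ?_, ?_⟩
    · simp; linarith
    · show a < t; linarith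
    · show t < b; linarith
  obtain ⟨C, hC⟩ := hc.exists_bound_of_continuousOn (hf.mono hsub)
  refine ⟨δ, d0, C, fun y t hy ht => ?_⟩
  rw [Real.dist_eq, abs_lt] at ht
  have hy2 : ‖y‖ ≤ ‖X.1‖ + δ := by
    have := norm_le_norm_add_norm_sub X.1 y
    rw [← dist_eq_norm, dist_comm] at this; linarith
  refine ⟨⟨?_, ?_, ?_⟩, fun s hs => hC _ ⟨hy.le, ?_, ?_⟩⟩
  · simp; linarith
  · show a < t; linarith
  · show t < b - ε; linarith
  · have := mul_nonneg hε.le hs.1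
    show X.2 - δ ≤ t + ε * s; linarith
  · have := mul_le_mul_of_nonneg_left hs.2 hε.le
    show t + ε * s ≤ X.2 + ε + δ; linarith

lemma isOpen_bx (R a b : ℝ) : IsOpen (ball (0:En n) R ×ˢ Ioo a b) := isOpen_ball.prod isOpen_Ioo

lemma Av_continuousOn {R a b ε : ℝ} (hε : 0 < ε) {f : En n × ℝ → E}
    (hf : ContinuousOn f (ball (0:En n) R ×ˢ Ioo a b)) :
    ContinuousOn (Av ε f) (ball (0:En n) R ×ˢ Ioo a (b - ε)) := by
  intro X hX
  refine ContinuousAt.continuousWithinAt ?_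
  obtain ⟨δ, hδ, C, hC⟩ := Av_loc hε hf hX
  have hV : ∀ᶠ Y : En n × ℝ in nhds X, dist Y.1 X.1 < δ ∧ dist Y.2 X.2 < δ := by
    filter_upwards [ball_mem_nhds X hδ] with Y hY
    rw [mem_ball, Prod.dist_eq, max_lt_iff] at hY
    exact hY
  refine intervalIntegral.continuousAt_of_dominated_interval (bound := fun _ => C) ?_ ?_
    (by simp) ?_
  · filter_upwards [hV] with Y hY
    exact Av_meas hε hf (hC _ _ hY.1 hY.2).1
  · filter_upwards [hV] with Y hY
    refine Filter.Eventually.of_forall fun s hs => ?_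
    rw [uIoc_of_le zero_le_one] at hs
    exact (hC _ _ hY.1 hY.2).2 s ⟨hs.1.le, hs.2⟩
  · refine Filter.Eventually.of_forall fun s hs => ?_
    rw [uIoc_of_le zero_le_one] at hs
    have hm := Av_mem hε hX (s := s) ⟨hs.1.le, hs.2⟩
    refine ContinuousAt.comp (g := f) (f := fun Y : En n × ℝ => (Y.1, Y.2 + ε * s)) ?_
      (by fun_prop)
    exact hf.continuousAt ((isOpen_bx R a b).mem_nhds hm)

lemma Av_dx {R a b ε : ℝ} (hε : 0 < ε) {f : En n × ℝ → E} {f' : En n × ℝ → En n →L[ℝ] E}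
    (hf : ContinuousOn f (ball (0:En n) R ×ˢ Ioo a b))
    (hf' : ContinuousOn f' (ball (0:En n) R ×ˢ Ioo a b))
    (hd : ∀ X ∈ ball (0:En n) R ×ˢ Ioo a b, HasFDerivAt (fun x => f (x, X.2)) (f' X) X.1)
    {X : En n × ℝ} (hX : X ∈ ball (0:En n) R ×ˢ Ioo a (b - ε)) :
    HasFDerivAt (fun x => Av ε f (x, X.2)) (Av ε f' X) X.1 := by
  obtain ⟨δ, hδ, C, hC⟩ := Av_loc hε hf' hX
  have h0 : dist X.2 X.2 < δ := by simpa using hδ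
  refine intervalIntegral.hasFDerivAt_integral_of_dominated_of_fderiv_le (bound := fun _ => C)
    (F := fun x s => f (x, X.2 + ε * s)) (F' := fun x s => f' (x, X.2 + ε * s))
    (ball_mem_nhds X.1 hδ) ?_ ?_ ?_ ?_ (by simp) ?_
  · filter_upwards [ball_mem_nhds X.1 hδ] with y hy
    exact Av_meas hε hf (X := (y, X.2)) (hC y X.2 hy h0).1
  · exact (Av_contOn hε hf hX).intervalIntegrable
  · exact Av_meas hε hf' hX
  · refine Filter.Eventually.of_forall fun s hs y hy => ?_
    rw [uIoc_of_le zero_le_one] at hs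
    exact (hC y X.2 hy h0).2 s ⟨hs.1.le, hs.2⟩
  · refine Filter.Eventually.of_forall fun s hs y hy => ?_
    rw [uIoc_of_le zero_le_one] at hs
    exact hd _ (Av_mem hε (hC y X.2 hy h0).1 ⟨hs.1.le, hs.2⟩)

lemma Av_dt {R a b ε : ℝ} (hε : 0 < ε) {f f' : En n × ℝ → E}
    (hf : ContinuousOn f (ball (0:En n) R ×ˢ Ioo a b))
    (hf' : ContinuousOn f' (ball (0:En n) R ×ˢ Ioo a b))
    (hd : ∀ X ∈ ball (0:En n) R ×ˢ Ioo a b, HasDerivAt (fun t => f (X.1, t)) (f' X) X.2)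
    {X : En n × ℝ} (hX : X ∈ ball (0:En n) R ×ˢ Ioo a (b - ε)) :
    HasDerivAt (fun t => Av ε f (X.1, t)) (Av ε f' X) X.2 := by
  obtain ⟨δ, hδ, C, hC⟩ := Av_loc hε hf' hX
  have h0 : dist X.1 X.1 < δ := by simpa using hδ
  refine (intervalIntegral.hasDerivAt_integral_of_dominated_loc_of_deriv_le (bound := fun _ => C)
    (F := fun t s => f (X.1, t + ε * s)) (F' := fun t s => f' (X.1, t + ε * s))
    (ball_mem_nhds X.2 hδ) ?_ ?_ ?_ ?_ (by simp) ?_).2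
  · filter_upwards [ball_mem_nhds X.2 hδ] with t ht
    exact Av_meas hε hf (X := (X.1, t)) (hC X.1 t h0 ht).1
  · exact (Av_contOn hε hf hX).intervalIntegrable
  · exact Av_meas hε hf' hX
  · refine Filter.Eventually.of_forall fun s hs t ht => ?_
    rw [uIoc_of_le zero_le_one] at hs
    exact (hC X.1 t h0 ht).2 s ⟨hs.1.le, hs.2⟩
  · refine Filter.Eventually.of_forall fun s hs t ht => ?_
    rw [uIoc_of_le zero_le_one] at hs
    exact (hd _ (Av_mem hε (hC X.1 t h0 ht).1 ⟨hs.1.le, hs.2⟩)).comp_add_const t (ε * s)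

lemma Av_dt2 [CompleteSpace E] {R a b ε : ℝ} (hε : 0 < ε) {f : En n × ℝ → E}
    (hf : ContinuousOn f (ball (0:En n) R ×ˢ Ioo a b))
    {X : En n × ℝ} (hX : X ∈ ball (0:En n) R ×ˢ Ioo a (b - ε)) :
    HasDerivAt (fun t => Av ε f (X.1, t)) (ε⁻¹ • (f (X.1, X.2 + ε) - f (X.1, X.2))) X.2 := by
  obtain ⟨hx, h1, h2⟩ := hX
  have hc : ContinuousOn (fun τ => f (X.1, τ)) (Ioo a b) :=
    hf.comp (by fun_prop) (fun τ hτ => ⟨hx, hτ⟩)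
  have e : (fun t => Av ε f (X.1, t)) = fun t => ε⁻¹ • ∫ τ in t..(t + ε), f (X.1, τ) := by
    funext t
    have := intervalIntegral.integral_comp_add_mul (a := 0) (b := 1)
      (fun τ => f (X.1, τ)) hε.ne' t
    simp only [mul_zero, add_zero, mul_one] at this
    exact this
  rw [e]
  refine HasDerivAt.const_smul _ ?_
  have m1 : X.2 ∈ Ioo a b := ⟨h1, by linarith⟩
  have m2 : X.2 + ε ∈ Ioo a b := ⟨by linarith, by linarith⟩
  have hmeas : ∀ τ ∈ Ioo a b, StronglyMeasurableAtFilter (fun τ => f (X.1, τ)) (nhds τ) volume :=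
    fun τ hτ => hc.stronglyMeasurableAtFilter isOpen_Ioo τ hτ
  have hI : IntervalIntegrable (fun τ => f (X.1, τ)) volume X.2 (X.2 + ε) := by
    refine ContinuousOn.intervalIntegrable (hc.mono ?_)
    rw [uIcc_of_le (by linarith)]
    intro τ hτ
    exact ⟨by linarith [hτ.1], by linarith [hτ.2]⟩
  have hF := intervalIntegral.integral_hasFDerivAt hI (hmeas _ m1) (hmeas _ m2)
    (hc.continuousAt (isOpen_Ioo.mem_nhds m1)) (hc.continuousAt (isOpen_Ioo.mem_nhds m2))
  have hg : HasDerivAt (fun t : ℝ => ((t, t + ε) : ℝ × ℝ)) (1, 1) X.2 :=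
    (hasDerivAt_id X.2).prodMk ((hasDerivAt_id X.2).add_const ε)
  have := hF.comp_hasDerivAt X.2 hg
  simp only [sub_apply, ContinuousLinearMap.smulRight_apply,
    ContinuousLinearMap.coe_snd', ContinuousLinearMap.coe_fst', one_smul] at this
  exact this

lemma Av_close [CompleteSpace E] {ε η : ℝ} {f : En n × ℝ → E} {X : En n × ℝ}
    (hc : ContinuousOn (fun s => f (X.1, X.2 + ε * s)) (uIcc (0:ℝ) 1))
    (h : ∀ s ∈ Icc (0:ℝ) 1, ‖f (X.1, X.2 + ε * s) - f X‖ ≤ η) : ‖Av ε f X - f X‖ ≤ η := by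
  have e : Av ε f X - f X = ∫ s in (0:ℝ)..1, (f (X.1, X.2 + ε * s) - f X) := by
    rw [intervalIntegral.integral_sub hc.intervalIntegrable (by simp)]
    simp [Av]
  rw [e]
  have := intervalIntegral.norm_integral_le_of_norm_le_const (a := 0) (b := 1) (C := η)
    (f := fun s => f (X.1, X.2 + ε * s) - f X) (fun s hs => by
      rw [uIoc_of_le zero_le_one] at hs
      exact h s ⟨hs.1.le, hs.2⟩)
  simpa using this

lemma Av_unif [CompleteSpace E] {R a b T η : ℝ} (hη : 0 < η) {f : En n × ℝ → E}
    (hf : ContinuousOn f (ball (0:En n) R ×ˢ Ioo a b)) {R' : ℝ} (hR : R' < R) {a' : ℝ}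
    (ha : a < a') (hT : T < b) :
    ∃ ε0 > 0, ∀ ε, 0 < ε → ε < ε0 → ∀ X ∈ closedBall (0:En n) R' ×ˢ Icc a' T,
      ‖Av ε f X - f X‖ ≤ η := by
  have hcp : IsCompact (closedBall (0:En n) R' ×ˢ Icc a' ((T + b)/2)) :=
    (isCompact_closedBall _ _).prod isCompact_Icc
  have hsub : closedBall (0:En n) R' ×ˢ Icc a' ((T + b)/2) ⊆ ball (0:En n) R ×ˢ Ioo a b := by
    rintro ⟨x, t⟩ ⟨hx, ht⟩
    have hx' : ‖x‖ ≤ R' := by simpa using hx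
    have h1 : a' ≤ t := ht.1
    have h2 : t ≤ (T + b)/2 := ht.2
    refine ⟨by simp; linarith, ?_, ?_⟩
    · show a < t; linarith
    · show t < b; linarith
  have hu := hcp.uniformContinuousOn_of_continuous (hf.mono hsub)
  rw [Metric.uniformContinuousOn_iff_le] at hu
  obtain ⟨δ, hδ, hu⟩ := hu η hη
  refine ⟨min δ ((b - T)/2), lt_min hδ (by linarith), fun ε h0 h1 X hX => ?_⟩
  have e1 := h1.trans_le (min_le_left _ _)
  have e2 := h1.trans_le (min_le_right _ _)
  obtain ⟨x, t⟩ := X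
  obtain ⟨hx, ht⟩ := hX
  have hx' : ‖x‖ ≤ R' := by simpa using hx
  have t1 : a' ≤ t := ht.1
  have t2 : t ≤ T := ht.2
  refine Av_close (Av_contOn h0 hf ⟨by simp; linarith, ?_, ?_⟩) ?_
  · show a < t; linarith
  · show t < b - ε; linarith
  · intro s hs
    have s1 := mul_nonneg h0.le hs.1
    have s2 := mul_le_mul_of_nonneg_left hs.2 h0.le
    rw [← dist_eq_norm]
    refine hu (x, t + ε * s) ⟨hx, ?_, ?_⟩ (x, t) ⟨hx, t1, ?_⟩ ?_
    · show a' ≤ t + ε * s; linarith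
    · show t + ε * s ≤ (T + b)/2; linarith
    · show t ≤ (T + b)/2; linarith
    · simp only [Prod.dist_eq, dist_self, Real.dist_eq]
      simp [abs_of_pos h0, abs_of_nonneg hs.1]
      constructor <;> linarith
end

lemma Reg.steklov {u ut : En n × ℝ → ℝ} {G H} {R a b ε : ℝ} (hε : 0 < ε)
    (h : Reg u ut G H (ball (0:En n) R ×ˢ Ioo a b)) :
    Reg (Av ε u) (Av ε ut) (Av ε G) (Av ε H) (ball (0:En n) R ×ˢ Ioo a (b - ε)) where
  dt := fun X hX => Av_dt hε h.cu h.cut h.dt hX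
  dx := fun X hX => by
    have h1 := Av_dx (f' := fun X => innerSL ℝ (G X)) hε h.cu
      ((innerSL ℝ).continuous.comp_continuousOn h.cG) h.dx hX
    refine h1.congr_fderiv ?_
    exact (innerSL ℝ).intervalIntegral_comp_comm (Av_contOn hε h.cG hX).intervalIntegrable
  dxx := fun X hX => Av_dx hε h.cG h.cH h.dxx hX
  cu := Av_continuousOn hε h.cu
  cut := Av_continuousOn hε h.cut
  cG := Av_continuousOn hε h.cG
  cH := Av_continuousOn hε h.cH

lemma Reg.sub {u ut : En n × ℝ → ℝ} {G H Q} {v vt : En n × ℝ → ℝ} {G' H'}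
    (h : Reg u ut G H Q) (h' : Reg v vt G' H' Q) :
    Reg (fun X => u X - v X) (fun X => ut X - vt X) (fun X => G X - G' X) (fun X => H X - H' X) Q where
  dt := fun X hX => (h.dt X hX).sub (h'.dt X hX)
  dx := fun X hX => ((h.dx X hX).sub (h'.dx X hX)).congr_fderiv (by rw [map_sub])
  dxx := fun X hX => (h.dxx X hX).sub (h'.dxx X hX)
  cu := h.cu.sub h'.cu
  cut := h.cut.sub h'.cut
  cG := h.cG.sub h'.cG
  cH := h.cH.sub h'.cH

def bz (X : En n × ℝ) : ℝ := 4 * X.2 - ‖X.1‖^2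
def be (α : ℝ) (X : En n × ℝ) : ℝ := Real.exp (α * (2 - X.2))
def bphi (α : ℝ) (X : En n × ℝ) : ℝ := be α X * bz X ^ 3
def bphit (α : ℝ) (X : En n × ℝ) : ℝ := be α X * (-α * bz X ^ 3 + 12 * bz X ^ 2)
def bphiG (α : ℝ) (X : En n × ℝ) : En n := (-6 * be α X * bz X ^ 2) • X.1
def bphig (α : ℝ) (X : En n × ℝ) : En n :=
  (-6 * be α X * (-α * bz X ^ 2 + 8 * bz X)) • X.1
def bphiH (α : ℝ) (X : En n × ℝ) : En n →L[ℝ] En n :=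
  (24 * be α X * bz X) • rk1 X.1 - (6 * be α X * bz X ^ 2) • ContinuousLinearMap.id ℝ (En n)

lemma bz_dt (X : En n × ℝ) : HasDerivAt (fun t => bz (X.1, t)) 4 X.2 := by
  have := ((hasDerivAt_id X.2).const_mul 4).sub_const (‖X.1‖^2)
  simpa [bz] using this

lemma be_dt (α : ℝ) (X : En n × ℝ) : HasDerivAt (fun t => be α (X.1, t)) (-α * be α X) X.2 := by
  have := (((hasDerivAt_id X.2).const_sub 2).const_mul α).exp
  simp only [be]
  refine this.congr_deriv ?_
  simp; ring

lemma bz_dx (X : En n × ℝ) :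
    HasFDerivAt (fun x => bz (x, X.2)) (-((2:ℝ) • innerSL ℝ X.1)) X.1 := by
  have := (hasFDerivAt_nsq X.1).const_sub (4 * X.2)
  simpa [bz] using this

lemma be_cont (α : ℝ) : Continuous (be α : En n × ℝ → ℝ) := by unfold be; fun_prop
lemma bz_cont : Continuous (bz : En n × ℝ → ℝ) := by unfold bz; fun_prop

lemma rk1_cont : Continuous (fun x : En n => rk1 x) := by
  unfold rk1
  fun_prop

lemma bphi_reg (α : ℝ) (Q : Set (En n × ℝ)) :
    Reg (bphi α) (bphit α) (bphiG α) (bphiH α) Q where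
  dt := fun X _ => by
    have := (be_dt α X).mul ((bz_dt X).pow 3)
    refine this.congr_deriv ?_
    simp [bphit]; ring
  dx := fun X _ => by
    have := ((bz_dx X).pow 3).const_mul (be α X)
    refine this.congr_fderiv ?_
    ext v; simp [bphiG]; ring
  dxx := fun X _ => by
    have := (((bz_dx X).pow 2).const_mul (-6 * be α X)).smul (hasFDerivAt_id X.1)
    refine this.congr_fderiv ?_
    ext v i
    simp [bphiH, rk1]; ring
  cu := ((be_cont α).mul (bz_cont.pow 3)).continuousOn
  cut := ((be_cont α).mul (((bz_cont.pow 3).const_mul (-α)).add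
    ((bz_cont.pow 2).const_mul 12))).continuousOn
  cG := ((((be_cont α).const_mul (-6)).mul (bz_cont.pow 2)).smul continuous_fst).continuousOn
  cH := (((((be_cont α).const_mul 24).mul bz_cont).smul (rk1_cont.comp continuous_fst)).sub
    ((((be_cont α).const_mul 6).mul (bz_cont.pow 2)).smul continuous_const)).continuousOn

lemma bphig_dt (α : ℝ) (X : En n × ℝ) :
    HasDerivAt (fun t => bphiG α (X.1, t)) (bphig α X) X.2 := by
  have := ((((be_dt α X).const_mul (-6)).mul ((bz_dt X).pow 2))).smul_const X.1
  refine this.congr_deriv ?_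
  simp only [bphig]
  congr 1
  simp; ring

lemma bphig_cont (α : ℝ) : Continuous (bphig α : En n × ℝ → En n) :=
  (((be_cont α).const_mul (-6)).mul (((bz_cont.pow 2).const_mul (-α)).add
    (bz_cont.const_mul 8))).smul continuous_fst

lemma bphi_op {ν : ℝ} (hν : 0 ≤ ν) (α : ℝ) {A : Matrix (Fin n) (Fin n) ℝ} (hA : Ell ν A)
    {X : En n × ℝ} (hz : 0 < bz X) :
    bphit α X - trA A (bphiH α X) ≤
      be α X * bz X * (-α * bz X ^2 + (12 + 6 * n * ν) * bz X - 24 * (ν⁻¹ * ‖X.1‖^2)) := by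
  have h1 := hA.trA_rk1_ge X.1
  have h2 := hA.trA_id_le hν
  have he : 0 < be α X := Real.exp_pos _
  rw [bphiH, trA_sub, trA_smul, trA_smul]
  have e : bphit α X - (24 * be α X * bz X * trA A (rk1 X.1) -
      6 * be α X * bz X ^ 2 * trA A (ContinuousLinearMap.id ℝ (En n))) =
      be α X * bz X * (-α * bz X ^2 + 12 * bz X + 6 * bz X *
        trA A (ContinuousLinearMap.id ℝ (En n)) - 24 * trA A (rk1 X.1)) := by
    simp only [bphit]; ring
  rw [e]
  refine mul_le_mul_of_nonneg_left ?_ (by positivity)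
  have : 6 * bz X * trA A (ContinuousLinearMap.id ℝ (En n)) ≤ 6 * bz X * (n * ν) := by gcongr
  nlinarith

def bal (n : ℕ) (ν : ℝ) : ℝ := (36 + 6 * n * ν)^2 * ν / 96
def bE (n : ℕ) (ν : ℝ) : ℝ := Real.exp (bal n ν * 2)
lemma bE_ge {ν : ℝ} (hν : 1 ≤ ν) : 1 ≤ bE n ν := by
  rw [bE, Real.one_le_exp_iff, bal]
  positivity

lemma bphi_op1 {ν : ℝ} (hν : 1 ≤ ν) {A : Matrix (Fin n) (Fin n) ℝ} (hA : Ell ν A)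
    {X : En n × ℝ} (hz : 0 < bz X) (ht : 1/4 ≤ X.2) :
    bphit (bal n ν) X - trA A (bphiH (bal n ν) X) ≤ 0 := by
  refine (bphi_op (by linarith) _ hA hz).trans ?_
  have he : 0 < be (bal n ν) X := Real.exp_pos _
  refine mul_nonpos_of_nonneg_of_nonpos (by positivity) ?_
  have hν0 : 0 < ν := by linarith
  have hx : 1 - bz X ≤ ‖X.1‖^2 := by simp only [bz]; linarith
  have h1 : ν⁻¹ * (1 - bz X) ≤ ν⁻¹ * ‖X.1‖^2 := by gcongr
  have h2 : ν⁻¹ ≤ 1 := inv_le_one_of_one_le₀ hν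
  have h3 : ν⁻¹ * bz X ≤ bz X := mul_le_of_le_one_left hz.le h2
  set b := 36 + 6 * n * ν with hb
  have h4 : -bal n ν * bz X^2 + b * bz X - 24 * ν⁻¹ ≤ 0 := by
    have : -bal n ν * bz X^2 + b * bz X - 24 * ν⁻¹ =
        -(ν / 96) * (b * bz X - 48 * ν⁻¹)^2 := by
      rw [bal, ← hb]; field_simp; ring
    rw [this]
    have := mul_nonneg (by positivity : 0 ≤ ν / 96) (sq_nonneg (b * bz X - 48 * ν⁻¹))
    linarith
  nlinarith

lemma be_le {ν : ℝ} (hν : 1 ≤ ν) {X : En n × ℝ} (ht : 0 ≤ X.2) : be (bal n ν) X ≤ bE n ν := by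
  rw [be, bE]
  have : 0 ≤ bal n ν := by rw [bal]; positivity
  gcongr
  linarith

lemma bphi_op2 {ν : ℝ} (hν : 1 ≤ ν) {A : Matrix (Fin n) (Fin n) ℝ} (hA : Ell ν A)
    {X : En n × ℝ} (hz : 0 < bz X) (ht0 : 0 ≤ X.2) (ht : X.2 < 1/4) :
    bphit (bal n ν) X - trA A (bphiH (bal n ν) X) ≤ bE n ν * (12 + 6 * n * ν) := by
  refine (bphi_op (by linarith) _ hA hz).trans ?_
  have he : 0 < be (bal n ν) X := Real.exp_pos _
  have hz1 : bz X ≤ 1 := by simp only [bz]; nlinarith [sq_nonneg ‖X.1‖]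
  have hb : 0 ≤ bal n ν := by rw [bal]; positivity
  have h1 : (-bal n ν * bz X ^2 + (12 + 6 * n * ν) * bz X - 24 * (ν⁻¹ * ‖X.1‖^2)) ≤
      12 + 6 * n * ν := by
    have a1 : (12 + 6 * n * ν) * bz X ≤ (12 + 6 * n * ν) * 1 := by gcongr
    have a2 : 0 ≤ bal n ν * bz X^2 := by positivity
    have a3 : 0 ≤ 24 * (ν⁻¹ * ‖X.1‖^2) := by positivity
    linarith
  have h2 := be_le (n := n) hν ht0
  have hE := bE_ge (n := n) hν
  calc be (bal n ν) X * bz X * _ ≤ be (bal n ν) X * bz X * (12 + 6 * n * ν) := by gcongr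
    _ ≤ bE n ν * 1 * (12 + 6 * n * ν) := by gcongr
    _ = _ := by ring

lemma bphiG_le {ν : ℝ} (hν : 1 ≤ ν) {X : En n × ℝ} (hX : X ∈ abpK n 2) :
    ‖bphiG (bal n ν) X‖ ≤ 1458 * bE n ν := by
  obtain ⟨hx, ht⟩ := hX
  have hx3 : ‖X.1‖ ≤ 3 := by simpa using hx
  have he : 0 < be (bal n ν) X := Real.exp_pos _
  have h2 := be_le (n := n) hν ht.1
  have hz : bz X ^ 2 ≤ 81 := by
    have : ‖X.1‖^2 ≤ 9 := by nlinarith [norm_nonneg X.1]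
    have a := ht.1; have b := ht.2
    simp only [bz]
    nlinarith [sq_nonneg ‖X.1‖]
  rw [bphiG, norm_smul, Real.norm_eq_abs]
  have : |-6 * be (bal n ν) X * bz X ^ 2| = 6 * be (bal n ν) X * bz X^2 := by
    rw [show -6 * be (bal n ν) X * bz X ^ 2 = -(6 * be (bal n ν) X * bz X ^ 2) by ring, abs_neg,
      abs_of_nonneg (by positivity)]
  rw [this]
  calc 6 * be (bal n ν) X * bz X^2 * ‖X.1‖ ≤ 6 * bE n ν * 81 * 3 := by
        have := bE_ge (n := n) hν
        gcongr
    _ = _ := by ring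

lemma bphi_le {ν : ℝ} (hν : 1 ≤ ν) {X : En n × ℝ} (hX : X ∈ abpK n 2) (hz : 0 < bz X) :
    bphi (bal n ν) X ≤ 512 * bE n ν := by
  obtain ⟨hx, ht⟩ := hX
  have he : 0 < be (bal n ν) X := Real.exp_pos _
  have h2 := be_le (n := n) hν ht.1
  have hz8 : bz X ≤ 8 := by
    have b := ht.2
    simp only [bz]; nlinarith [sq_nonneg ‖X.1‖]
  calc be (bal n ν) X * bz X^3 ≤ bE n ν * 8^3 := by
        have := bE_ge (n := n) hν
        gcongr
    _ = _ := by ring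

lemma pm_alg {n : ℕ} {ν q T D C : ℝ} (hν : 1 ≤ ν) (hq : 0 ≤ q) (hT : 0 ≤ T) (hD : 0 ≤ D) (hC : 0 ≤ C)
    {β : ℝ≥0∞} (h : ENNReal.ofReal (q + ν⁻¹ * T) ≤ ENNReal.ofReal C * β + ENNReal.ofReal D) :
    ENNReal.ofReal (q * T^n) ≤ ENNReal.ofReal (ν^n * (2*C)^n) * (ENNReal.ofReal q * β^n) +
      ENNReal.ofReal (ν^n * (2*D)^(n+1)) := by
  have hν0 : 0 < ν := by linarith
  rcases le_total (ENNReal.ofReal D) (ENNReal.ofReal C * β) with h1 | h1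
  · have h2 : ENNReal.ofReal T ≤ ENNReal.ofReal (ν * (2 * C)) * β := by
      have a : ENNReal.ofReal (ν⁻¹ * T) ≤ 2 * (ENNReal.ofReal C * β) := by
        refine (ENNReal.ofReal_le_ofReal (by linarith)).trans (h.trans ?_)
        rw [two_mul]; gcongr
      have e : T = ν * (ν⁻¹ * T) := by field_simp
      calc ENNReal.ofReal T = ENNReal.ofReal ν * ENNReal.ofReal (ν⁻¹ * T) := by
            rw [← ENNReal.ofReal_mul hν0.le, ← e]
        _ ≤ ENNReal.ofReal ν * (2 * (ENNReal.ofReal C * β)) := mul_le_mul_right a _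
        _ = _ := by
          rw [ENNReal.ofReal_mul hν0.le, ENNReal.ofReal_mul (by norm_num)]
          simp only [ENNReal.ofReal_ofNat]; ring
    refine le_trans ?_ le_self_add
    rw [ENNReal.ofReal_mul hq, ENNReal.ofReal_pow hT]
    calc ENNReal.ofReal q * ENNReal.ofReal T ^ n
        ≤ ENNReal.ofReal q * (ENNReal.ofReal (ν * (2 * C)) * β)^n := by gcongr
      _ = _ := by
        rw [← mul_pow, mul_pow _ β, ENNReal.ofReal_pow (by positivity)]
        ring
  · have h2 : ENNReal.ofReal (q + ν⁻¹ * T) ≤ ENNReal.ofReal (2 * D) := by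
      refine h.trans ?_
      rw [two_mul, ENNReal.ofReal_add hD hD]; gcongr
    rw [ENNReal.ofReal_le_ofReal_iff (by positivity)] at h2
    have hT' : 0 ≤ ν⁻¹ * T := by positivity
    have h3 : T ≤ ν * (2 * D) := by
      have : ν⁻¹ * T ≤ 2 * D := by linarith
      calc T = ν * (ν⁻¹ * T) := by field_simp
        _ ≤ _ := by gcongr
    refine le_trans (ENNReal.ofReal_le_ofReal ?_) le_add_self
    calc q * T^n ≤ (2*D) * (ν * (2*D))^n := by gcongr; linarith
      _ = _ := by rw [mul_pow]; ring

def pmM (n : ℕ) (ν : ℝ) : ℝ := 512 * bE n ν + 1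
def pmC3 (n : ℕ) (ν : ℝ) : ℝ := 2 + 1458 * bE n ν
def pmC4 (n : ℕ) (ν : ℝ) : ℝ := 1 + n^2 * ν
def pmC1 (n : ℕ) (ν : ℝ) : ℝ := bE n ν * (12 + 6 * n * ν) + pmC4 n ν

/-- pointwise estimate on the contact set -/
lemma pm_point {ν η : ℝ} (hν : 1 ≤ ν) (hη : 0 < η) (hη1 : η ≤ 1)
    {ut vt : ℝ} {Gu Gv : En n} {Hu Hv : En n →L[ℝ] En n} {X : En n × ℝ} {β : ℝ≥0∞}
    {A : Matrix (Fin n) (Fin n) ℝ} (hA : Ell ν A)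
    (hs : ENNReal.ofReal (trA A Hu - ut) ≤ β * ‖Gu‖ₑ) (c1 : ‖vt - ut‖ ≤ η) (c2 : ‖Gv - Gu‖ ≤ η)
    (c3 : ‖Hv - Hu‖ ≤ η) (hX : X ∈ abpK n 2) (hz : 0 < bz X)
    (hP : PSD (Hv - bphiH (bal n ν) X)) (hG : ‖Gv - bphiG (bal n ν) X‖ ≤ 1/6)
    (hq : vt - bphit (bal n ν) X ≤ 0) :
    ENNReal.ofReal (|vt - bphit (bal n ν) X| * |(Hv - bphiH (bal n ν) X).det|) ≤
      ENNReal.ofReal (n.factorial * (ν^n * (2 * pmC3 n ν)^n)) *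
        (ENNReal.ofReal (-(vt - bphit (bal n ν) X)) * β^n) +
      ENNReal.ofReal (n.factorial * (ν^n *
        (2 * (if X.2 < 1/4 then pmC1 n ν else pmC4 n ν * η))^(n+1))) := by
  have hν0 : 0 ≤ ν := by linarith
  have hE := bE_ge (n := n) hν
  set q := -(vt - bphit (bal n ν) X) with hqd
  set L := Hv - bphiH (bal n ν) X with hL
  set D := (if X.2 < 1/4 then pmC1 n ν else pmC4 n ν * η) with hD
  have hC4 : 0 ≤ pmC4 n ν := by rw [pmC4]; positivity
  have hD0 : 0 ≤ D := by
    rw [hD]; split_ifs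
    · rw [pmC1]; positivity
    · positivity
  have hC30 : 0 ≤ pmC3 n ν := by rw [pmC3]; positivity
  have hT := hP.trc_nonneg
  have h1 : ENNReal.ofReal (q + ν⁻¹ * trc L) ≤ ENNReal.ofReal (pmC3 n ν) * β + ENNReal.ofReal D := by
    have a1 := hP.trA_ge hA
    have a2 : trA A L = trA A (Hv - Hu) + trA A Hu - trA A (bphiH (bal n ν) X) := by
      rw [hL, trA_sub, trA_sub]; ring
    have a3 := (abs_le.1 (hA.trA_abs_le hν0 (Hv - Hu))).2
    have a4 : (n:ℝ)^2 * ν * ‖Hv - Hu‖ ≤ n^2 * ν * η := by gcongr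
    have a5 := (abs_le.1 c1).1
    have a6 : bphit (bal n ν) X - trA A (bphiH (bal n ν) X) + pmC4 n ν * η ≤ D := by
      rw [hD]; split_ifs with ht
      · have := bphi_op2 hν hA hz hX.2.1 ht
        have : pmC4 n ν * η ≤ pmC4 n ν * 1 := by gcongr
        rw [pmC1]; linarith
      · have := bphi_op1 hν hA hz (not_lt.1 ht)
        linarith
    have a7 : q + ν⁻¹ * trc L ≤ (trA A Hu - ut) + D := by
      rw [pmC4] at a6
      rw [hqd]; linarith
    have a8 : ‖Gu‖ ≤ pmC3 n ν := by
      have b1 := bphiG_le hν hX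
      have b2 : Gu = (Gv - bphiG (bal n ν) X) + bphiG (bal n ν) X - (Gv - Gu) := by abel
      have b3 := norm_sub_le ((Gv - bphiG (bal n ν) X) + bphiG (bal n ν) X) (Gv - Gu)
      have b4 := norm_add_le (Gv - bphiG (bal n ν) X) (bphiG (bal n ν) X)
      rw [← b2] at b3
      rw [pmC3]; linarith
    refine (ENNReal.ofReal_le_ofReal a7).trans (ENNReal.ofReal_add_le.trans ?_)
    gcongr
    refine hs.trans ?_
    rw [mul_comm, ← ofReal_norm]
    gcongr
  have h2 := pm_alg (n := n) hν (by linarith : 0 ≤ q) hT hD0 hC30 h1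
  have h3 := hP.det_le
  have h4 : |vt - bphit (bal n ν) X| = q := by rw [abs_of_nonpos hq]
  rw [h4]
  have hf : (0:ℝ) ≤ n.factorial := by positivity
  calc ENNReal.ofReal (q * |L.det|) ≤ ENNReal.ofReal (n.factorial * (q * trc L^n)) := by
        refine ENNReal.ofReal_le_ofReal ?_
        have : q * |L.det| ≤ q * (n.factorial * trc L ^ n) := by gcongr; linarith
        linarith
    _ = ENNReal.ofReal n.factorial * ENNReal.ofReal (q * trc L^n) := ENNReal.ofReal_mul hf
    _ ≤ _ := by
      refine (mul_le_mul_right h2 _).trans (le_of_eq ?_)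
      rw [mul_add, ENNReal.ofReal_mul hf, ENNReal.ofReal_mul hf, mul_assoc]

lemma abpK_mono {t1 t2 : ℝ} (h : t1 ≤ t2) : abpK n t1 ⊆ abpK n t2 :=
  prod_mono_right (Icc_subset_Icc_right h)

set_option maxHeartbeats 2000000 in
/-- the estimate with parameters -/
lemma pm_core {ν η : ℝ} (hν : 1 ≤ ν) (hη : 0 < η) (hη1 : η ≤ 1)
    {β : En n → ℝ≥0∞} {u : En n × ℝ → ℝ} {b t1 : ℝ} {x1 : En n} (hβ : Measurable β)
    (hS : Super ν β u (ball (0:En n) 4 ×ˢ Ioo (-1) b)) (htb : t1 < b) (ht1 : 1 ≤ t1) (ht2 : t1 ≤ 2)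
    (hx1 : ‖x1‖ ≤ 3/2) (hu0 : ∀ X ∈ ball (0:En n) 4 ×ˢ Ioo (-1) b, 0 ≤ u X) (hu1 : u (x1, t1) ≤ 1) :
    volume (closedBall (0:En n) (1/6) ×ˢ Icc (-2:ℝ) (-1)) ≤
      ENNReal.ofReal (n.factorial * (ν^n * (2 * pmC3 n ν)^n)) *
        (2 * ∫⁻ x in ball (0:En n) 4, β x ^ n) +
      (ENNReal.ofReal (n.factorial * (ν^n * (2 * pmC1 n ν)^(n+1))) *
        volume {X ∈ ball (0:En n) 1 ×ˢ Ioo (0:ℝ) (1/4) | u X ≤ pmM n ν} +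
      ENNReal.ofReal (n.factorial * (ν^n * (2 * (pmC4 n ν * η))^(n+1))) * volume (abpK n 2)) := by
  obtain ⟨ut, G, H, hR, hE⟩ := hS
  obtain ⟨e1, he1, c1⟩ := Av_unif (R' := 3) (a' := 0) hη hR.cu (by norm_num) (by norm_num) htb
  obtain ⟨e2, he2, c2⟩ := Av_unif (R' := 3) (a' := 0) hη hR.cut (by norm_num) (by norm_num) htb
  obtain ⟨e3, he3, c3⟩ := Av_unif (R' := 3) (a' := 0) hη hR.cG (by norm_num) (by norm_num) htb
  obtain ⟨e4, he4, c4⟩ := Av_unif (R' := 3) (a' := 0) hη hR.cH (by norm_num) (by norm_num) htb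
  set ε := min (min (e1/2) (e2/2)) (min (min (e3/2) (e4/2)) ((b - t1)/2)) with hε
  have l1 : ε ≤ e1/2 := (min_le_left _ _).trans (min_le_left _ _)
  have l2 : ε ≤ e2/2 := (min_le_left _ _).trans (min_le_right _ _)
  have l3 : ε ≤ e3/2 := (min_le_right _ _).trans ((min_le_left _ _).trans (min_le_left _ _))
  have l4 : ε ≤ e4/2 := (min_le_right _ _).trans ((min_le_left _ _).trans (min_le_right _ _))
  have l5 : ε ≤ (b - t1)/2 := (min_le_right _ _).trans (min_le_right _ _)
  have l0 : 0 < ε := by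
    refine lt_min (lt_min ?_ ?_) (lt_min (lt_min ?_ ?_) ?_) <;> linarith
  replace c1 := c1 ε l0 (by linarith)
  replace c2 := c2 ε l0 (by linarith)
  replace c3 := c3 ε l0 (by linarith)
  replace c4 := c4 ε l0 (by linarith)
  set U := ball (0:En n) 4 ×ˢ Ioo (-1) (b - ε) with hU
  have hUo : IsOpen U := isOpen_bx _ _ _
  have hV := hR.steklov l0
  have hV0 : ∀ X ∈ U, 0 ≤ Av ε u X := fun X hX => by
    refine intervalIntegral.integral_nonneg zero_le_one fun s hs => hu0 _ (Av_mem l0 hX hs)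
  set α := bal n ν
  have hW := hV.sub (bphi_reg α U)
  have hK : abpK n t1 ⊆ U := by
    rintro ⟨x, t⟩ ⟨hx, ht⟩
    have hx' : ‖x‖ ≤ 3 := by simpa using hx
    have a1 : 0 ≤ t := ht.1
    have a2 : t ≤ t1 := ht.2
    refine ⟨by simp; linarith, ?_, ?_⟩
    · show -1 < t; linarith
    · show t < b - ε; linarith
  have hKQ : abpK n t1 ⊆ ball (0:En n) 4 ×ˢ Ioo (-1) b := fun X hX =>
    ⟨(hK hX).1, (hK hX).2.1, by have := (hK hX).2.2; linarith⟩
  have hgd : ∀ X ∈ U, HasDerivAt (fun t => Av ε G (X.1, t) - bphiG α (X.1, t))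
      (ε⁻¹ • (G (X.1, X.2 + ε) - G (X.1, X.2)) - bphig α X) X.2 := fun X hX =>
    (Av_dt2 l0 hR.cG hX).sub (bphig_dt α X)
  have hgc : ContinuousOn (fun X => ε⁻¹ • (G (X.1, X.2 + ε) - G (X.1, X.2)) - bphig α X) U := by
    have g1 : ContinuousOn (fun X : En n × ℝ => G (X.1, X.2 + ε)) U := by
      refine hR.cG.comp (by fun_prop) fun X hX => ?_
      have := Av_mem l0 hX (s := 1) ⟨zero_le_one, le_rfl⟩
      rwa [mul_one] at this
    have g2 : ContinuousOn (fun X : En n × ℝ => G (X.1, X.2)) U := by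
      refine hR.cG.comp (by fun_prop) fun X hX => ?_
      have := Av_mem l0 hX (s := 0) ⟨le_rfl, zero_le_one⟩
      rwa [mul_zero, add_zero] at this
    exact ((g1.sub g2).const_smul (ε⁻¹ : ℝ)).sub (bphig_cont α).continuousOn
  have hX1 : (x1, t1) ∈ abpK n t1 := ⟨by simp; linarith, by constructor <;> linarith⟩
  have hepos : ∀ X : En n × ℝ, 0 < be α X := fun X => Real.exp_pos _
  have habp := abp_vol hW hUo hgd hgc hK (fun X hX hb => by
      have hz : bz X ≤ 0 := by
        have a2 : X.2 ≤ t1 := hX.2.2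
        simp only [bz]
        rcases hb with h | h
        · rw [h]; nlinarith [sq_nonneg ‖X.1‖]
        · rw [h]; linarith
      have : bphi α X ≤ 0 := by
        rw [bphi]
        exact mul_nonpos_of_nonneg_of_nonpos (hepos X).le (Odd.pow_nonpos (by decide) hz)
      have := hV0 X (hK hX)
      linarith) hX1 (by
      have a1 := (abs_le.1 (c1 _ hX1)).2
      have a2 : 7/4 ≤ bz (x1, t1) := by
        have : ‖x1‖^2 ≤ (3/2)^2 := by gcongr
        simp only [bz]; linarith
      have a3 : 1 ≤ be α (x1, t1) := by
        rw [be, Real.one_le_exp_iff]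
        have : 0 ≤ α := by simp only [α, bal]; positivity
        exact mul_nonneg this (by simp; linarith)
      have a4 : 5 ≤ bphi α (x1, t1) := by
        rw [bphi]
        have : (7/4:ℝ)^3 ≤ bz (x1, t1)^3 := by gcongr
        nlinarith
      linarith)
  refine habp.trans ?_
  set S := abpS (fun X => Av ε u X - bphi α X) (fun X => Av ε ut X - bphit α X)
    (fun X => Av ε G X - bphiG α X) (fun X => Av ε H X - bphiH α X) t1 with hSd
  have hSm : MeasurableSet S := (abpS_closed hW hK).measurableSet
  have hSz : ∀ X ∈ S, 0 < bz X := by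
    intro X hX
    by_contra hz
    push Not at hz
    have : bphi α X ≤ 0 := by
      rw [bphi]
      exact mul_nonpos_of_nonneg_of_nonpos (hepos X).le (Odd.pow_nonpos (by decide) hz)
    have h1 := hV0 X (hK hX.1)
    have h2 := hX.2.1.2
    simp only at h2
    linarith
  set Qm : Set (En n × ℝ) := {X | X.2 < 1/4} with hQm
  have hQmm : MeasurableSet Qm := measurableSet_lt measurable_snd measurable_const
  set A1 := ENNReal.ofReal (n.factorial * (ν^n * (2 * pmC3 n ν)^n))
  set A2 := ENNReal.ofReal (n.factorial * (ν^n * (2 * pmC1 n ν)^(n+1)))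
  set A3 := ENNReal.ofReal (n.factorial * (ν^n * (2 * (pmC4 n ν * η))^(n+1)))
  have hpt : ∀ X ∈ S, ENNReal.ofReal (|Av ε ut X - bphit α X| * |(Av ε H X - bphiH α X).det|) ≤
      A1 * (ENNReal.ofReal (-(Av ε ut X - bphit α X)) * β X.1^n) +
        (Qm.indicator (fun _ => A2) X + A3) := by
    intro X hX
    obtain ⟨A, hA, hs⟩ := hE X (hKQ hX.1)
    have hb := pm_point hν hη hη1 hA hs (c2 X hX.1) (c3 X hX.1) (c4 X hX.1)
      (abpK_mono ht2 hX.1) (hSz X hX) hX.2.2.2.1 hX.2.2.2.2.1 hX.2.2.2.2.2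
    refine hb.trans ?_
    gcongr
    by_cases h : X.2 < 1/4
    · rw [if_pos h, indicator_of_mem (show X ∈ Qm from h)]
      exact le_self_add
    · rw [if_neg h]
      exact le_add_self
  refine (setLIntegral_mono_ae' hSm (Filter.Eventually.of_forall hpt)).trans ?_
  have hBm : Measurable (fun X => Qm.indicator (fun _ => A2) X + A3) :=
    (measurable_const.indicator hQmm).add measurable_const
  rw [lintegral_add_right _ hBm,
    lintegral_add_right _ measurable_const, lintegral_const_mul' _ _ ENNReal.ofReal_ne_top,
    lintegral_indicator hQmm, setLIntegral_const, setLIntegral_const]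
  refine add_le_add (mul_le_mul_right (abp_tonelli hW hK hβ) _)
    (add_le_add (mul_le_mul_right ?_ _) (mul_le_mul_right ?_ _))
  · rw [Measure.restrict_apply hQmm]
    refine measure_mono ?_
    rintro ⟨x, t⟩ ⟨htQ, hX⟩
    have hz := hSz _ hX
    have htq : t < 1/4 := htQ
    have ht0 : 0 ≤ t := hX.1.2.1
    simp only [bz] at hz
    have hx2 : ‖x‖^2 < 1 := by linarith
    have hx1 : ‖x‖ < 1 := by nlinarith [norm_nonneg x]
    have ht0' : 0 < t := by nlinarith [sq_nonneg ‖x‖]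
    refine ⟨⟨by simpa using hx1, ht0', htq⟩, ?_⟩
    have h1 := (abs_le.1 (c1 _ hX.1)).1
    have h2 := hX.2.1.2
    have h3 := bphi_le hν (abpK_mono ht2 hX.1) (hSz _ hX)
    simp only at h2
    rw [pmM]
    linarith
  · exact measure_mono fun X hX => abpK_mono ht2 hX.1

set_option maxHeartbeats 1000000 in
lemma pm_unit (n : ℕ) {ν : ℝ} (hν : 1 ≤ ν) : ∃ ε0 μ : ℝ, 0 < ε0 ∧ 0 < μ ∧
    ∀ (β : En n → ℝ≥0∞) (u : En n × ℝ → ℝ) (b t1 : ℝ) (x1 : En n), Measurable β →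
    Super ν β u (ball (0:En n) 4 ×ˢ Ioo (-1) b) → t1 < b → 1 ≤ t1 → t1 ≤ 2 →
    ‖x1‖ ≤ 3/2 → (∀ X ∈ ball (0:En n) 4 ×ˢ Ioo (-1) b, 0 ≤ u X) →
    ∫⁻ x in ball (0:En n) 4, β x ^ n ≤ ENNReal.ofReal ε0 → u (x1, t1) ≤ 1 →
    ENNReal.ofReal μ ≤ volume {X ∈ ball (0:En n) 1 ×ˢ Ioo (0:ℝ) (1/4) | u X ≤ pmM n ν} := by
  have hE := bE_ge (n := n) hν
  have hν0 : 0 < ν := by linarith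
  set c0 := (volume (closedBall (0:En n) (1/6) ×ˢ Icc (-2:ℝ) (-1))).toReal with hc0
  have hfin : volume (closedBall (0:En n) (1/6) ×ˢ Icc (-2:ℝ) (-1)) ≠ ∞ :=
    ((isCompact_closedBall _ _).prod isCompact_Icc).measure_lt_top.ne
  have hc0p : 0 < c0 := by
    refine ENNReal.toReal_pos ?_ hfin
    rw [Measure.volume_eq_prod, Measure.prod_prod]
    refine mul_ne_zero (measure_closedBall_pos _ _ (by norm_num)).ne' ?_
    rw [Real.volume_Icc]; norm_num
  set V := (volume (abpK n 2)).toReal with hV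
  have hVfin : volume (abpK n 2) ≠ ∞ := (abpK_compact 2).measure_lt_top.ne
  have hV0 : 0 ≤ V := ENNReal.toReal_nonneg
  have hC3 : 0 < pmC3 n ν := by rw [pmC3]; positivity
  have hC4 : 0 < pmC4 n ν := by rw [pmC4]; positivity
  have hC1 : 0 < pmC1 n ν := by rw [pmC1]; positivity
  set a1 : ℝ := n.factorial * (ν^n * (2 * pmC3 n ν)^n) with ha1
  set a2 : ℝ := n.factorial * (ν^n * (2 * pmC1 n ν)^(n+1)) with ha2
  set a3 : ℝ := n.factorial * (ν^n * (2 * pmC4 n ν)^(n+1)) with ha3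
  have p1 : 0 < a1 := by positivity
  have p2 : 0 < a2 := by positivity
  have p3 : 0 < a3 := by positivity
  refine ⟨c0 / (8 * a1), c0 / (4 * a2), by positivity, by positivity, ?_⟩
  intro β u b t1 x1 hβ hS htb ht1 ht2 hx1 hu0 hβS hu1
  set η := min 1 (c0 / (4 * a3 * (V + 1))) with hη
  have hη0 : 0 < η := lt_min one_pos (by positivity)
  have hη1 : η ≤ 1 := min_le_left _ _
  have hη2 : η ≤ c0 / (4 * a3 * (V + 1)) := min_le_right _ _
  have key := pm_core hν hη0 hη1 hβ hS htb ht1 ht2 hx1 hu0 hu1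
  by_contra hcon
  push Not at hcon
  have e3 : (n.factorial : ℝ) * (ν^n * (2 * (pmC4 n ν * η))^(n+1)) ≤ a3 * η := by
    have : η^(n+1) ≤ η := by
      rw [pow_succ]; exact mul_le_of_le_one_left hη0.le (pow_le_one₀ hη0.le hη1)
    calc (n.factorial : ℝ) * (ν^n * (2 * (pmC4 n ν * η))^(n+1)) = a3 * η^(n+1) := by
          rw [ha3, ← mul_assoc 2, mul_pow _ η]; ring
      _ ≤ _ := by gcongr
  have h3 : a3 * η * V ≤ c0 / 4 := by
    calc a3 * η * V ≤ a3 * (c0 / (4 * a3 * (V + 1))) * (V + 1) := by gcongr; linarith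
      _ = c0 / 4 := by field_simp
  have : ENNReal.ofReal c0 ≤ ENNReal.ofReal (a1 * (2 * (c0 / (8 * a1))) +
      (a2 * (c0 / (4 * a2)) + a3 * η * V)) := by
    rw [hc0, ENNReal.ofReal_toReal hfin, ENNReal.ofReal_add (by positivity) (by positivity),
      ENNReal.ofReal_add (by positivity) (by positivity), ENNReal.ofReal_mul p1.le,
      ENNReal.ofReal_mul p2.le, ENNReal.ofReal_mul (by positivity : 0 ≤ a3 * η),
      ENNReal.ofReal_mul (by norm_num : (0:ℝ) ≤ 2), ENNReal.ofReal_ofNat,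
      hV, ENNReal.ofReal_toReal hVfin]
    refine key.trans ?_
    gcongr
  rw [ENNReal.ofReal_le_ofReal_iff (by positivity)] at this
  have q1 : a1 * (2 * (c0 / (8 * a1))) = c0 / 4 := by field_simp; norm_num
  have q2 : a2 * (c0 / (4 * a2)) = c0 / 4 := by field_simp
  linarith

lemma pm_scaled (n : ℕ) {ν : ℝ} (hν : 1 ≤ ν) : ∃ ε0 μ M : ℝ, 0 < ε0 ∧ 0 < μ ∧ 1 < M ∧
    ∀ (β : En n → ℝ≥0∞) (u : En n × ℝ → ℝ) (Q : Set (En n × ℝ)) (b t t1 r c : ℝ) (x x1 : En n),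
    Measurable β → Super ν β u Q → 0 < r → 0 < c →
    ball x (4 * r) ×ˢ Ioo (t - r^2) b ⊆ Q → t1 < b → t + r^2 ≤ t1 → t1 ≤ t + 2 * r^2 →
    dist x1 x ≤ 3/2 * r → (∀ X ∈ Q, 0 ≤ u X) →
    ∫⁻ y in ball x (4 * r), β y ^ n ≤ ENNReal.ofReal ε0 → u (x1, t1) ≤ c →
    ENNReal.ofReal (μ * r^(n+2)) ≤ volume {X ∈ ball x r ×ˢ Ioo t (t + r^2/4) | u X ≤ M * c} := by
  obtain ⟨ε0, μ, h0, hμ, H⟩ := pm_unit n hν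
  have hE := bE_ge (n := n) hν
  refine ⟨ε0, μ, pmM n ν, h0, hμ, by rw [pmM]; linarith, ?_⟩
  intro β u Q b t t1 r c x x1 hβ hS hr hc hQ htb ht1 ht2 hx1 hu0 hI hu1
  have hr2 : 0 < r^2 := by positivity
  have hmap : ∀ X ∈ ball (0:En n) 4 ×ˢ Ioo (-1) ((b - t)/r^2), psc x t r X ∈ Q := by
    rintro ⟨y, s⟩ ⟨hy, hs1, hs2⟩
    have hy' : ‖y‖ < 4 := by simpa using hy
    simp only at hs1 hs2
    rw [lt_div_iff₀ hr2] at hs2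
    refine hQ ⟨?_, ?_, ?_⟩
    · simp only [psc, mem_ball, dist_self_add_left, norm_smul, Real.norm_eq_abs, abs_of_pos hr]
      nlinarith
    · simp only [psc]; nlinarith
    · simp only [psc]; linarith
  have key := H (fun y => ENNReal.ofReal r * β (x + r • y)) (fun X => c⁻¹ * u (psc x t r X) + 0)
    ((b - t)/r^2) ((t1 - t)/r^2) (r⁻¹ • (x1 - x)) (by fun_prop)
    (hS.scale x t 0 hr (by positivity) hmap)
    (by gcongr) (by rw [le_div_iff₀ hr2]; linarith) (by rw [div_le_iff₀ hr2]; linarith)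
    (by
      rw [norm_smul, Real.norm_eq_abs, abs_of_pos (by positivity : 0 < r⁻¹), ← dist_eq_norm,
        inv_mul_le_iff₀ hr]
      linarith)
    (fun X hX => by
      have := hu0 _ (hmap X hX)
      positivity)
    (by rw [lint_scale hβ x hr 4, mul_comm]; exact hI)
    (by
      have e : psc x t r (r⁻¹ • (x1 - x), (t1 - t)/r^2) = (x1, t1) := by
        simp only [psc]
        rw [smul_inv_smul₀ hr.ne', mul_div_cancel₀ _ hr2.ne']
        simp
      rw [e, add_zero, inv_mul_le_iff₀ hc]; linarith)
  set E := {X ∈ ball x r ×ˢ Ioo t (t + r^2/4) | u X ≤ pmM n ν * c} with hEd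
  have hsub : {X ∈ ball (0:En n) 1 ×ˢ Ioo (0:ℝ) (1/4) | c⁻¹ * u (psc x t r X) + 0 ≤ pmM n ν} ⊆
      psc x t r ⁻¹' (toMeasurable volume E) := by
    rintro ⟨y, s⟩ ⟨⟨hy, hs1, hs2⟩, hu⟩
    refine subset_toMeasurable _ _ ?_
    have hy' : ‖y‖ < 1 := by simpa using hy
    simp only at hs1 hs2
    refine ⟨⟨?_, ?_, ?_⟩, ?_⟩
    · simp only [psc, mem_ball, dist_self_add_left, norm_smul, Real.norm_eq_abs, abs_of_pos hr]
      nlinarith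
    · simp only [psc]; nlinarith
    · simp only [psc]; nlinarith
    · rw [add_zero, inv_mul_le_iff₀ hc] at hu; linarith
  have h2 := key.trans (measure_mono hsub)
  rw [vol_psc x t hr (measurableSet_toMeasurable _ _), measure_toMeasurable] at h2
  have hrp : 0 < r^(n+2) := by positivity
  calc ENNReal.ofReal (μ * r^(n+2)) = ENNReal.ofReal (r^(n+2)) * ENNReal.ofReal μ := by
        rw [mul_comm, ENNReal.ofReal_mul hrp.le]
    _ ≤ ENNReal.ofReal (r^(n+2)) * (ENNReal.ofReal ((r^(n+2))⁻¹) * volume E) :=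
        mul_le_mul_right h2 _
    _ = volume E := by
        rw [← mul_assoc, ← ENNReal.ofReal_mul hrp.le, mul_inv_cancel₀ hrp.ne']; simp

/-- The point-to-measure property. -/
def PMp (u : En n × ℝ → ℝ) (μ M T1 : ℝ) : Prop :=
  ∀ (x : En n) (t r : ℝ) (x1 : En n) (t1 c : ℝ), ‖x‖ ≤ 5 → 0 < r → r ≤ 1/2 → 0 ≤ t → 0 < c →
    t + r^2 ≤ t1 → t1 ≤ t + 2*r^2 → t1 < T1 → dist x1 x ≤ 3/2*r → u (x1,t1) ≤ c →
    ENNReal.ofReal (μ*r^(n+2)) ≤ volume {X ∈ ball x r ×ˢ Ioo t (t+r^2/4) | u X ≤ M*c}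

lemma PMp.exists {u : En n × ℝ → ℝ} {μ M T1 : ℝ} (h : PMp u μ M T1) (hμ : 0 < μ)
    (x : En n) (t r : ℝ) (x1 : En n) (t1 c : ℝ) (hx : ‖x‖ ≤ 5) (hr : 0 < r) (hr2 : r ≤ 1/2)
    (ht : 0 ≤ t) (hc : 0 < c) (h1 : t + r^2 ≤ t1) (h2 : t1 ≤ t + 2*r^2) (h3 : t1 < T1)
    (h4 : dist x1 x ≤ 3/2*r) (h5 : u (x1,t1) ≤ c) :
    ∃ x2 t2, dist x2 x < r ∧ t < t2 ∧ t2 < t + r^2/4 ∧ u (x2,t2) ≤ M*c := by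
  have h6 := h x t r x1 t1 c hx hr hr2 ht hc h1 h2 h3 h4 h5
  have h7 : 0 < volume {X ∈ ball x r ×ˢ Ioo t (t+r^2/4) | u X ≤ M*c} :=
    lt_of_lt_of_le (ENNReal.ofReal_pos.2 (by positivity)) h6
  obtain ⟨X, hX, hu⟩ := nonempty_of_measure_ne_zero h7.ne'
  exact ⟨X.1, X.2, hX.1, hX.2.1, hX.2.2, hu⟩

lemma PMp.chain {u : En n × ℝ → ℝ} {μ M T1 : ℝ} (h : PMp u μ M T1) (hμ : 0 < μ) (hM : 1 < M)
    {x : En n} (hx : ‖x‖ ≤ 2) {τ r : ℝ} (hτ : 0 ≤ τ) (hr : 0 < r) (hr2 : r ≤ 1/2) (N : ℕ) :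
    ∀ (x1 : En n) (t1 c : ℝ), 0 < c → τ + r^2 ≤ t1 → t1 ≤ τ + 2*r^2 + N*(3/4*r^2) → t1 < T1 →
      dist x1 x * r ≤ 3/2*r^2 + 1/2*max 0 (t1 - τ - 2*r^2) → dist x1 x ≤ 3 → u (x1,t1) ≤ c →
      ∃ x2 t2, dist x2 x < r ∧ τ < t2 ∧ t2 < τ + r^2/4 ∧ u (x2,t2) ≤ M^(N+1)*c := by
  have base : ∀ (x1 : En n) (t1 c : ℝ), 0 < c → τ + r^2 ≤ t1 → t1 ≤ τ + 2*r^2 → t1 < T1 →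
      dist x1 x * r ≤ 3/2*r^2 + 1/2*max 0 (t1 - τ - 2*r^2) → u (x1,t1) ≤ c →
      ∃ x2 t2, dist x2 x < r ∧ τ < t2 ∧ t2 < τ + r^2/4 ∧ u (x2,t2) ≤ M*c := by
    intro x1 t1 c hc h1 h2 h3 h4 h5
    rw [max_eq_left (by linarith)] at h4
    have h4' : dist x1 x ≤ 3/2*r := by
      by_contra hh
      push Not at hh
      nlinarith
    exact h.exists hμ x τ r x1 t1 c (by linarith) hr hr2 hτ hc h1 h2 h3 h4' h5
  induction N with
  | zero =>
    intro x1 t1 c hc h1 h2 h3 h4 _ h5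
    simpa using base x1 t1 c hc h1 (by simpa using h2) h3 h4 h5
  | succ N ih =>
    intro x1 t1 c hc h1 h2 h3 h4 h4b h5
    by_cases hcase : t1 ≤ τ + 2*r^2
    · obtain ⟨x2, t2, a1, a2, a3, a4⟩ := base x1 t1 c hc h1 hcase h3 h4 h5
      refine ⟨x2, t2, a1, a2, a3, a4.trans ?_⟩
      have : M ≤ M^(N+1+1) := le_self_pow₀ hM.le (by omega)
      nlinarith
    · push Not at hcase
      rw [max_eq_right (by linarith)] at h4
      -- choice of the intermediate centre
      obtain ⟨y, hy1, hy2⟩ : ∃ y : En n, dist x1 y ≤ 3/2*r ∧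
          dist y x ≤ max 0 (dist x1 x - 3/2*r) := by
        by_cases hd : dist x1 x ≤ 3/2*r
        · exact ⟨x, hd, by simp⟩
        · push Not at hd
          have hd0 : 0 < dist x1 x := by linarith [mul_pos (show (0:ℝ) < 3/2 by norm_num) hr]
          refine ⟨x1 + (3/2*r/dist x1 x) • (x - x1), ?_, ?_⟩
          · rw [dist_eq_norm, show x1 - (x1 + (3/2*r/dist x1 x) • (x - x1))
              = -((3/2*r/dist x1 x) • (x - x1)) by abel, norm_neg, norm_smul, ← dist_eq_norm,
              dist_comm x x1, Real.norm_of_nonneg (by positivity)]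
            apply le_of_eq; field_simp
          · rw [dist_eq_norm, show x1 + (3/2*r/dist x1 x) • (x - x1) - x
              = (1 - 3/2*r/dist x1 x) • (x1 - x) by module, norm_smul, ← dist_eq_norm x1 x,
              Real.norm_of_nonneg (by rw [sub_nonneg, div_le_one hd0]; exact hd.le)]
            apply le_max_of_le_right
            apply le_of_eq; field_simp
      have hyx : dist y x ≤ 3 := hy2.trans (max_le (by norm_num) (by linarith))
      have hy5 : ‖y‖ ≤ 5 := by
        have : ‖y‖ ≤ ‖y - x‖ + ‖x‖ := by simpa using norm_add_le (y - x) x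
        rw [← dist_eq_norm] at this; linarith
      obtain ⟨x2, t2, a1, a2, a3, a4⟩ := h.exists hμ y (t1 - r^2) r x1 t1 c hy5 hr hr2
        (by nlinarith) hc (by linarith) (by nlinarith) h3 hy1 h5
      have hM0 : 0 < M := by linarith
      have htri := dist_triangle x2 y x
      obtain ⟨x3, t3, b1, b2, b3, b4⟩ := ih x2 t2 (M*c) (by positivity) (by linarith)
        (by push_cast at h2; linarith) (by nlinarith)
        (by
          have hm1 := le_max_left 0 (t2 - τ - 2*r^2)
          have hm2 := le_max_right 0 (t2 - τ - 2*r^2)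
          rcases max_choice 0 (dist x1 x - 3/2*r) with hc1 | hc1
          · rw [hc1] at hy2; nlinarith
          · rw [hc1] at hy2; nlinarith)
        (by
          rcases max_choice 0 (dist x1 x - 3/2*r) with hc1 | hc1
          · rw [hc1] at hy2; linarith
          · rw [hc1] at hy2; linarith) a4
      exact ⟨x3, t3, b1, b2, b3, b4.trans (le_of_eq (by ring))⟩

/-- The forward box. -/
def fbox (X : En n × ℝ) (r : ℝ) : Set (En n × ℝ) :=
  ball X.1 r ×ˢ Ioo (X.2 + r^2) (X.2 + r^2 + r^2/4)

lemma fbox_open (X : En n × ℝ) (r : ℝ) : IsOpen (fbox X r) := isOpen_ball.prod isOpen_Ioo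

lemma fbox_nonempty (X : En n × ℝ) {r : ℝ} (hr : 0 < r) : (fbox X r).Nonempty :=
  ⟨(X.1, X.2 + r^2 + r^2/8), mem_ball_self hr, by
    have := pow_pos hr 2
    constructor <;> (show (_:ℝ) < _; linarith)⟩

lemma PMp.select {u : En n × ℝ → ℝ} {μ M T1 : ℝ} (h : PMp u μ M T1) (hT : 3 ≤ T1)
    {X : En n × ℝ} (hX1 : ‖X.1‖ ≤ 2) (hX2 : 0 ≤ X.2) (hX3 : X.2 < 2)
    {r0 c : ℝ} (hr0 : 0 < r0) (hr1 : r0 ≤ 1/2) (hc : 0 < c) (hbad : c < u X)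
    (hu : ContinuousAt u X) (hgood : ∃ Z ∈ fbox X r0, u Z ≤ c) :
    ∃ r, 0 < r ∧ r ≤ r0 ∧ (∀ Z ∈ fbox X r, c < u Z) ∧
      ENNReal.ofReal (μ*r^(n+2)) ≤ volume {Z ∈ fbox X r | u Z ≤ M*c} := by
  classical
  have hrp : ∀ j : ℕ, 0 < r0*(2/3:ℝ)^j := fun j => by positivity
  have hrl : ∀ j : ℕ, r0*(2/3:ℝ)^j ≤ r0 := fun j => by
    have : (2/3:ℝ)^j ≤ 1 := pow_le_one₀ (by norm_num) (by norm_num)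
    nlinarith
  have hex : ∃ j : ℕ, ∀ Z ∈ fbox X (r0*(2/3:ℝ)^j), c < u Z := by
    obtain ⟨ε, hε, hball⟩ := Metric.mem_nhds_iff.1 (hu.eventually (lt_mem_nhds hbad))
    have hlim : Filter.Tendsto (fun j : ℕ => r0*(2/3:ℝ)^j) Filter.atTop (nhds 0) := by
      simpa using (tendsto_pow_atTop_nhds_zero_of_lt_one (by norm_num : (0:ℝ) ≤ 2/3)
        (by norm_num)).const_mul r0
    obtain ⟨j, hj⟩ := (hlim.eventually (gt_mem_nhds hε)).exists
    refine ⟨j, fun Z hZ => hball ?_⟩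
    have hp := hrp j
    have hl := hrl j
    set r := r0*(2/3:ℝ)^j
    rw [mem_ball, Prod.dist_eq]
    refine max_lt ((mem_ball.1 hZ.1).trans hj) ?_
    have h1 : X.2 + r^2 < Z.2 := hZ.2.1
    have h2 : Z.2 < X.2 + r^2 + r^2/4 := hZ.2.2
    rw [Real.dist_eq, abs_lt]
    constructor <;> nlinarith
  have hspec := Nat.find_spec hex
  have hmin : ∀ m < Nat.find hex, ¬ _ := fun m hm => Nat.find_min hex hm
  set j := Nat.find hex
  have hj0 : j ≠ 0 := by
    intro h0
    obtain ⟨Z, hZ, hZ2⟩ := hgood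
    rw [h0] at hspec
    have := hspec Z (by simpa using hZ)
    linarith
  obtain ⟨i, hi⟩ := Nat.exists_eq_succ_of_ne_zero hj0
  have h1 := hmin i (by omega)
  push Not at h1
  obtain ⟨Z, hZ, hZ2⟩ := h1
  have hri : r0*(2/3:ℝ)^i = 3/2*(r0*(2/3:ℝ)^j) := by
    rw [hi, Nat.succ_eq_add_one, pow_succ]; ring
  rw [hri] at hZ
  have hp := hrp j
  have hl := hrl j
  refine ⟨_, hp, hl, hspec, ?_⟩
  set r := r0*(2/3:ℝ)^j
  have h1 : X.2 + (3/2*r)^2 < Z.2 := hZ.2.1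
  have h2 : Z.2 < X.2 + (3/2*r)^2 + (3/2*r)^2/4 := hZ.2.2
  have hrsq : r^2 ≤ 1/4 := by nlinarith
  have hrsq0 : 0 < r^2 := by positivity
  exact h X.1 (X.2+r^2) r Z.1 Z.2 c (by linarith) hp (by linarith) (by positivity) hc
    (by nlinarith) (by nlinarith) (by nlinarith) (mem_ball.1 hZ.1).le hZ2

/-- Volume of the unit ball. -/
def vball (n : ℕ) : ℝ≥0∞ := volume (ball (0 : En n) 1)

lemma vball_pos (n : ℕ) : 0 < vball n := measure_ball_pos _ _ one_pos
lemma vball_ne_top (n : ℕ) : vball n ≠ ⊤ := measure_ball_lt_top.ne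

lemma vol_ball_r (x : En n) {r : ℝ} (hr : 0 < r) :
    volume (ball x r) = ENNReal.ofReal (r^n) * vball n := by
  rw [Measure.addHaar_ball_of_pos _ _ hr, finrank_euclideanSpace_fin, vball]

lemma vol_bx (x : En n) {r : ℝ} (hr : 0 < r) (a b : ℝ) :
    volume (ball x r ×ˢ Ioo a b) = ENNReal.ofReal (r^n) * vball n * ENNReal.ofReal (b - a) := by
  rw [Measure.volume_eq_prod, Measure.prod_prod, vol_ball_r x hr, Real.volume_Ioo]

set_option maxHeartbeats 1000000 in
lemma PMp.step {u : En n × ℝ → ℝ} {μ M T1 : ℝ} (h : PMp u μ M T1) (hμ : 0 < μ) (hT : 3 ≤ T1)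
    {ρ η r0 c : ℝ} (hρ : 0 < ρ) (hη : 0 < η) (hρη : ρ + η ≤ 2) (hr0 : 0 < r0) (hr1 : r0 ≤ 1/2)
    (hr2 : r0 ≤ η/2) (hc : 0 < c)
    (hu : ContinuousOn u (ball (0:En n) 2 ×ˢ Ioo 0 2))
    (hgood : ∀ X ∈ ball (0:En n) ρ ×ˢ Ioo 0 ρ, ∃ Z ∈ fbox X r0, u Z ≤ c) :
    volume {X ∈ ball (0:En n) ρ ×ˢ Ioo 0 ρ | c < u X} ≤
      (ENNReal.ofReal (16*4^n/μ) * vball n) *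
        volume {X ∈ ball (0:En n) (ρ+η) ×ˢ Ioo 0 (ρ+η) | c < u X ∧ u X ≤ M*c} := by
  classical
  have hO : IsOpen (ball (0:En n) 2 ×ˢ Ioo (0:ℝ) 2) := isOpen_ball.prod isOpen_Ioo
  set A := {X ∈ ball (0:En n) ρ ×ˢ Ioo 0 ρ | c < u X} with hA
  have hA2 : ∀ X ∈ A, X ∈ ball (0:En n) 2 ×ˢ Ioo (0:ℝ) 2 := by
    intro X hX
    have h1 := mem_ball_zero_iff.1 hX.1.1
    have h2 := hX.1.2
    exact ⟨mem_ball_zero_iff.2 (by linarith), h2.1, by linarith [h2.2]⟩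
  have hsel : ∀ X : A, ∃ r, 0 < r ∧ r ≤ r0 ∧ (∀ Z ∈ fbox X.1 r, c < u Z) ∧
      ENNReal.ofReal (μ*r^(n+2)) ≤ volume {Z ∈ fbox X.1 r | u Z ≤ M*c} := by
    rintro ⟨X, hX⟩
    have h2 := hA2 X hX
    exact h.select hT (mem_ball_zero_iff.1 h2.1).le h2.2.1.le h2.2.2 hr0 hr1 hc hX.2
      (hu.continuousAt (hO.mem_nhds h2)) (hgood X hX.1)
  choose R hR0 hRr hRbad hRvol using hsel
  obtain ⟨v, -, hdisj, hcov⟩ := Vitali.exists_disjoint_subfamily_covering_enlargement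
    (fun X : A => fbox X.1 (R X)) univ R 2 (by norm_num) (fun X _ => (hR0 X).le) r0
    (fun X _ => hRr X) (fun X _ => fbox_nonempty _ (hR0 X))
  have hvc : v.Countable := hdisj.countable_of_isOpen (fun X _ => fbox_open _ _)
    (fun X _ => fbox_nonempty _ (hR0 X))
  have hsub : ∀ X : A, fbox X.1 (R X) ⊆ ball (0:En n) (ρ+η) ×ˢ Ioo 0 (ρ+η) := by
    rintro X Z ⟨hZ1, hZ2⟩
    have h1 := mem_ball_zero_iff.1 X.2.1.1
    have h2 := X.2.1.2
    have h3 : ‖Z.1 - X.1.1‖ < R X := by rw [← dist_eq_norm]; exact hZ1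
    have h4 : ‖Z.1‖ ≤ ‖Z.1 - X.1.1‖ + ‖X.1.1‖ := by simpa using norm_add_le (Z.1 - X.1.1) X.1.1
    have h5 := hRr X
    have h6 := hR0 X
    have h7 : X.1.2 + (R X)^2 < Z.2 := hZ2.1
    have h8 : Z.2 < X.1.2 + (R X)^2 + (R X)^2/4 := hZ2.2
    have h9 : 0 < X.1.2 := h2.1
    have h10 : X.1.2 < ρ := h2.2
    refine ⟨mem_ball_zero_iff.2 (by linarith), ?_, ?_⟩
    · show 0 < Z.2
      nlinarith [sq_nonneg (R X)]
    · show Z.2 < ρ + η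
      nlinarith
  have hcover : A ⊆ ⋃ X ∈ v, ball (X : A).1.1 (4*R X) ×ˢ
      Ioo (X.1.2 - 8*(R X)^2) (X.1.2 + 8*(R X)^2) := by
    intro X hX
    obtain ⟨b, hb, ⟨Z, hZa, hZb⟩, hab⟩ := hcov ⟨X, hX⟩ (mem_univ _)
    refine mem_iUnion₂.2 ⟨b, hb, ?_⟩
    have pa := hR0 ⟨X, hX⟩
    have pb := hR0 b
    set ra := R ⟨X, hX⟩
    set rb := R b
    have h1 : dist Z.1 X.1 < ra := hZa.1
    have h2 : dist Z.1 b.1.1 < rb := hZb.1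
    have h3 := dist_triangle_left X.1 b.1.1 Z.1
    have a1 : X.2 + ra^2 < Z.2 := hZa.2.1
    have a2 : Z.2 < X.2 + ra^2 + ra^2/4 := hZa.2.2
    have b1 : b.1.2 + rb^2 < Z.2 := hZb.2.1
    have b2 : Z.2 < b.1.2 + rb^2 + rb^2/4 := hZb.2.2
    have hsq : ra^2 ≤ 4*rb^2 := by nlinarith
    have hra : 0 < ra^2 := by positivity
    have hrb : 0 < rb^2 := by positivity
    refine ⟨mem_ball.2 (by linarith), ?_, ?_⟩
    · show b.1.2 - 8*rb^2 < X.2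
      linarith
    · show X.2 < b.1.2 + 8*rb^2
      linarith
  have hmeas : ∀ X : A, MeasurableSet {Z ∈ fbox X.1 (R X) | u Z ≤ M*c} := by
    intro X
    have hcu : ContinuousOn u (fbox X.1 (R X)) := by
      refine hu.mono ((hsub X).trans ?_)
      rintro Z ⟨h1, h2⟩
      exact ⟨ball_subset_ball hρη h1, h2.1, lt_of_lt_of_le h2.2 hρη⟩
    have h1 := hcu.isOpen_inter_preimage (fbox_open _ _) (isOpen_Ioi (a := M*c))
    have h2 : {Z ∈ fbox X.1 (R X) | u Z ≤ M*c}
        = fbox X.1 (R X) \ (fbox X.1 (R X) ∩ u ⁻¹' Ioi (M*c)) := by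
      ext Z
      simp only [mem_ofPred_eq, mem_diff, mem_inter_iff, mem_preimage, mem_Ioi]
      constructor
      · rintro ⟨h1, h2⟩; exact ⟨h1, fun h3 => absurd h3.2 (not_lt.2 h2)⟩
      · rintro ⟨h1, h2⟩; exact ⟨h1, not_lt.1 fun h3 => h2 ⟨h1, h3⟩⟩
    rw [h2]
    exact (fbox_open _ _).measurableSet.diff h1.measurableSet
  have hone : ∀ X : A, volume (ball X.1.1 (4*R X) ×ˢ
      Ioo (X.1.2 - 8*(R X)^2) (X.1.2 + 8*(R X)^2)) ≤
      (ENNReal.ofReal (16*4^n/μ) * vball n) * volume {Z ∈ fbox X.1 (R X) | u Z ≤ M*c} := by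
    intro X
    have hp := hR0 X
    rw [vol_bx _ (by positivity)]
    refine le_trans (le_of_eq ?_) (mul_le_mul_right (hRvol X) _)
    rw [mul_assoc, mul_comm (vball n), ← mul_assoc, mul_assoc (ENNReal.ofReal (16*4^n/μ)),
      mul_comm (vball n), ← mul_assoc, ← ENNReal.ofReal_mul (by positivity),
      ← ENNReal.ofReal_mul (by positivity)]
    congr 2
    field_simp
    ring
  calc volume A ≤ volume (⋃ X ∈ v, ball (X : A).1.1 (4*R X) ×ˢ
      Ioo (X.1.2 - 8*(R X)^2) (X.1.2 + 8*(R X)^2)) := measure_mono hcover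
    _ ≤ ∑' X : v, volume (ball (X : A).1.1 (4*R X) ×ˢ
      Ioo (X.1.1.2 - 8*(R X)^2) (X.1.1.2 + 8*(R X)^2)) := measure_biUnion_le _ hvc _
    _ ≤ ∑' X : v, (ENNReal.ofReal (16*4^n/μ) * vball n) *
        volume {Z ∈ fbox X.1.1 (R X) | u Z ≤ M*c} := ENNReal.tsum_le_tsum fun X => hone X
    _ = (ENNReal.ofReal (16*4^n/μ) * vball n) *
        volume (⋃ X ∈ v, {Z ∈ fbox (X:A).1 (R X) | u Z ≤ M*c}) := by
      rw [ENNReal.tsum_mul_left, measure_biUnion hvc _ (fun X _ => hmeas X)]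
      exact hdisj.mono_on (fun X _ => sep_subset _ _)
    _ ≤ _ := by
      refine mul_le_mul_right (measure_mono ?_) _
      refine iUnion₂_subset fun X hX Z hZ => ⟨hsub X hZ.1, hRbad X Z hZ.1, hZ.2⟩

set_option maxHeartbeats 1000000 in
lemma PMp.step2 {u : En n × ℝ → ℝ} {μ M T1 : ℝ} (h : PMp u μ M T1) (hμ : 0 < μ) (hM : 1 < M)
    (hT : 3 ≤ T1)
    {ρ η r0 c : ℝ} (hρ : 0 < ρ) (hη : 0 < η) (hρη : ρ + η ≤ 2) (hr0 : 0 < r0) (hr1 : r0 ≤ 1/2)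
    (hr2 : r0 ≤ η/2) (hc : 0 < c)
    (hu : ContinuousOn u (ball (0:En n) 2 ×ˢ Ioo 0 2))
    (hgood : ∀ X ∈ ball (0:En n) ρ ×ˢ Ioo 0 ρ, ∃ Z ∈ fbox X r0, u Z ≤ c) :
    (1 + 16*4^n/μ * (vball n).toReal) *
      (volume {X ∈ ball (0:En n) ρ ×ˢ Ioo 0 ρ | M*c < u X}).toReal ≤
    (16*4^n/μ * (vball n).toReal) *
      (volume {X ∈ ball (0:En n) (ρ+η) ×ˢ Ioo 0 (ρ+η) | c < u X}).toReal := by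
  have hfin : ∀ (ρ : ℝ) (P : En n × ℝ → Prop),
      volume {X ∈ ball (0:En n) ρ ×ˢ Ioo 0 ρ | P X} ≠ ⊤ := by
    intro ρ P
    refine ne_top_of_le_ne_top ?_ (measure_mono (sep_subset _ _))
    rw [Measure.volume_eq_prod, Measure.prod_prod]
    exact ENNReal.mul_ne_top measure_ball_lt_top.ne (by simp)
  have h1 := h.step hμ hT hρ hη hρη hr0 hr1 hr2 hc hu hgood
  set C := 16*4^n/μ * (vball n).toReal with hC
  have hC0 : 0 ≤ C := by positivity
  have hCE : ENNReal.ofReal (16*4^n/μ) * vball n = ENNReal.ofReal C := by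
    rw [hC, ENNReal.ofReal_mul (by positivity), ENNReal.ofReal_toReal (vball_ne_top n)]
  rw [hCE] at h1
  have hle1 : volume {X ∈ ball (0:En n) ρ ×ˢ Ioo 0 ρ | M*c < u X} ≤
      volume {X ∈ ball (0:En n) ρ ×ˢ Ioo 0 ρ | c < u X} := by
    refine measure_mono fun X hX => ⟨hX.1, ?_⟩
    have := hX.2
    show c < u X
    nlinarith
  have hle2 : volume {X ∈ ball (0:En n) ρ ×ˢ Ioo 0 ρ | M*c < u X} ≤
      volume {X ∈ ball (0:En n) (ρ+η) ×ˢ Ioo 0 (ρ+η) | M*c < u X} := by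
    refine measure_mono fun X hX => ⟨⟨ball_subset_ball (by linarith) hX.1.1, hX.1.2.1, ?_⟩, hX.2⟩
    show X.2 < ρ + η
    have := hX.1.2.2
    linarith
  have hsub : ball (0:En n) (ρ+η) ×ˢ Ioo (0:ℝ) (ρ+η) ⊆ ball (0:En n) 2 ×ˢ Ioo 0 2 := by
    rintro Z ⟨h1, h2⟩
    exact ⟨ball_subset_ball hρη h1, h2.1, lt_of_lt_of_le h2.2 hρη⟩
  have hopen : IsOpen (ball (0:En n) (ρ+η) ×ˢ Ioo (0:ℝ) (ρ+η) ∩ u ⁻¹' Ioi (M*c)) :=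
    (hu.mono hsub).isOpen_inter_preimage (isOpen_ball.prod isOpen_Ioo) isOpen_Ioi
  have hadd : volume {X ∈ ball (0:En n) (ρ+η) ×ˢ Ioo 0 (ρ+η) | c < u X ∧ u X ≤ M*c} +
      volume {X ∈ ball (0:En n) (ρ+η) ×ˢ Ioo 0 (ρ+η) | M*c < u X} ≤
      volume {X ∈ ball (0:En n) (ρ+η) ×ˢ Ioo 0 (ρ+η) | c < u X} := by
    rw [← measure_union]
    · refine measure_mono ?_
      rintro X (⟨a, b⟩ | ⟨a, b⟩)
      · exact ⟨a, b.1⟩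
      · refine ⟨a, ?_⟩
        show c < u X
        nlinarith
    · rw [Set.disjoint_left]
      rintro X ⟨a, b⟩ ⟨c', d⟩
      exact absurd d (not_lt.2 b.2)
    · exact hopen.measurableSet
  have e1 := ENNReal.toReal_mono (ENNReal.mul_ne_top ENNReal.ofReal_ne_top (hfin _ _)) (hle1.trans h1)
  rw [ENNReal.toReal_mul, ENNReal.toReal_ofReal hC0] at e1
  have e2 := ENNReal.toReal_mono (hfin _ _) hle2
  have e3 := ENNReal.toReal_mono (hfin _ _) hadd
  rw [ENNReal.toReal_add (hfin _ _) (hfin _ _)] at e3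
  nlinarith

set_option maxHeartbeats 1000000 in
theorem lemD (n : ℕ) {ν : ℝ} (hν : 1 ≤ ν) : ∃ ε0 : ℝ, 0 < ε0 ∧ ∀ T1 : ℝ, ∃ δ : ℝ, 0 < δ ∧
    ∀ (β : En n → ℝ≥0∞) (u : En n × ℝ → ℝ), Measurable β →
      Super ν β u (ball (0:En n) 8 ×ˢ Ioo (-1) T1) →
      (∀ X ∈ ball (0:En n) 8 ×ˢ Ioo (-1) T1, 0 ≤ u X) →
      ∫⁻ x in ball (0:En n) 8, β x ^ n ≤ ENNReal.ofReal ε0 →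
      vball n ≤ 2 * volume {X ∈ ball (0:En n) 1 ×ˢ Ioo 0 1 | 1/2 ≤ u X} →
      ∀ x ∈ ball (0:En n) 1, ∀ t ∈ Ico 3 T1, δ ≤ u (x,t) := by
  obtain ⟨ε0, μ, M, hε0, hμ, hM, hpm⟩ := pm_scaled n hν
  have hM0 : 0 < M := by linarith
  have hV : 0 < (vball n).toReal := ENNReal.toReal_pos (vball_pos n).ne' (vball_ne_top n)
  set C := 16*4^n/μ * (vball n).toReal with hC
  have hC0 : 0 < C := by positivity
  set q := C/(1+C) with hq
  have hq0 : 0 < q := by positivity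
  have hq1 : q < 1 := by rw [hq, div_lt_one (by positivity)]; linarith
  obtain ⟨K', hK'⟩ := exists_pow_lt_of_lt_one (show (0:ℝ) < (2^(n+2))⁻¹ by positivity) hq1
  set K := K' + 1 with hK
  have hKq : q^K < (2^(n+2))⁻¹ := lt_of_le_of_lt (pow_le_pow_of_le_one hq0.le hq1.le (by omega)) hK'
  have hKpos : (0:ℝ) < K := by rw [hK]; positivity
  set η : ℝ := 1/K with hη
  have hη0 : 0 < η := by positivity
  set r0 : ℝ := min (1/20) (η/2) with hr0
  have hr0p : 0 < r0 := by positivity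
  have hr20 : r0 ≤ 1/20 := min_le_left _ _
  have hrη : r0 ≤ η/2 := min_le_right _ _
  set c0 : ℝ := (4*M^K)⁻¹ with hc0
  have hc0p : 0 < c0 := by positivity
  refine ⟨ε0, hε0, fun T1 => ?_⟩
  obtain ⟨N, hN⟩ := exists_nat_ge (T1/(3/4*r0^2))
  rw [div_le_iff₀ (by positivity)] at hN
  refine ⟨c0/M^(N+1), by positivity, ?_⟩
  intro β u hβ hsup hu0 hint hvol x0 hx0 t0 ht0
  by_contra hlt
  push Not at hlt
  have hT3 : 3 < T1 := lt_of_le_of_lt ht0.1 ht0.2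
  have hcu : ContinuousOn u (ball (0:En n) 2 ×ˢ Ioo 0 2) := by
    obtain ⟨ut, G, H, hreg, -⟩ := hsup
    refine hreg.cu.mono ?_
    rintro Z ⟨h1, h2⟩
    refine ⟨ball_subset_ball (by norm_num) h1, ?_, ?_⟩
    · show -1 < Z.2
      linarith [h2.1]
    · show Z.2 < T1
      linarith [h2.2]
  have hP : PMp u μ M T1 := by
    intro x t r x1 t1 c hx hr hr2 ht hc h1 h2 h3 h4 h5
    have hsb : ball x (4*r) ⊆ ball (0:En n) 8 := by
      refine ball_subset_ball' ?_
      rw [dist_zero_right]; linarith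
    refine hpm β u _ T1 t t1 r c x x1 hβ hsup hr hc ?_ h3 h1 h2 h4 hu0 ?_ h5
    · exact prod_mono hsb (Ioo_subset_Ioo_left (by nlinarith))
    · exact (lintegral_mono_set hsb).trans hint
  have hgood : ∀ X ∈ ball (0:En n) 2 ×ˢ Ioo (0:ℝ) 2, ∃ Z ∈ fbox X r0, u Z ≤ c0 := by
    rintro ⟨x, t⟩ ⟨hx, ht⟩
    have hx' : ‖x‖ < 2 := mem_ball_zero_iff.1 hx
    have hx0' : ‖x0‖ < 1 := mem_ball_zero_iff.1 hx0
    have ht1 : 0 < t := ht.1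
    have ht2 : t < 2 := ht.2
    have ht3 := ht0.1
    have ht4 := ht0.2
    have hd : dist x0 x ≤ 3 := by
      rw [dist_eq_norm]; linarith [norm_sub_le x0 x]
    have hrsq : r0^2 ≤ 1/400 := by nlinarith
    have hrsq0 : 0 < r0^2 := by positivity
    obtain ⟨x2, t2, a1, a2, a3, a4⟩ := hP.chain hμ hM (x := x) hx'.le (τ := t + r0^2) (r := r0)
      (by positivity) hr0p (by linarith) N x0 t0 (c0/M^(N+1)) (by positivity) (by linarith)
      (by linarith) ht4 (by
        have := le_max_right 0 (t0 - (t+r0^2) - 2*r0^2)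
        nlinarith) hd hlt.le
    refine ⟨(x2,t2), ⟨a1, a2, a3⟩, a4.trans (le_of_eq ?_)⟩
    field_simp
  let f : ℕ → ℝ := fun k => (volume {X ∈ ball (0:En n) (1+((K:ℝ)-k)*η) ×ˢ
    Ioo 0 (1+((K:ℝ)-k)*η) | M^k*c0 < u X}).toReal
  have hKη : (K:ℝ)*η = 1 := by rw [hη]; field_simp
  have hstep : ∀ k, k < K → f (k+1) ≤ q * f k := by
    intro k hk
    have hkK : (k:ℝ) + 1 ≤ K := by exact_mod_cast hk
    have hk0 : (0:ℝ) ≤ k := by positivity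
    have hle : 1 + ((K:ℝ) - k)*η ≤ 2 := by nlinarith
    have hρ : 0 < 1 + ((K:ℝ) - (k+1:ℕ))*η := by push_cast; nlinarith
    have heq : 1 + ((K:ℝ) - (k+1:ℕ))*η + η = 1 + ((K:ℝ) - k)*η := by push_cast; ring
    have hMk : 1 ≤ M^k := one_le_pow₀ hM.le
    have h1 := hP.step2 hμ hM hT3.le hρ hη0 (by rw [heq]; exact hle) hr0p (by linarith) hrη
      (c := M^k*c0) (by positivity) hcu (by
        rintro X ⟨hX1, hX2⟩
        obtain ⟨Z, hZ, hZ2⟩ := hgood X ⟨ball_subset_ball (by linarith) hX1, hX2.1,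
          lt_of_lt_of_le hX2.2 (by linarith)⟩
        exact ⟨Z, hZ, hZ2.trans (by nlinarith)⟩)
    rw [heq, show M*(M^k*c0) = M^(k+1)*c0 by ring] at h1
    change (1+C) * f (k+1) ≤ C * f k at h1
    rw [hq, div_mul_eq_mul_div, le_div_iff₀ (by positivity)]
    linarith
  have hiter : ∀ k, k ≤ K → f k ≤ q^k * f 0 := by
    intro k
    induction k with
    | zero => intro _; simp
    | succ k ih =>
      intro hk
      calc f (k+1) ≤ q * f k := hstep k (by omega)
        _ ≤ q * (q^k * f 0) := by
          have := ih (by omega)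
          gcongr
        _ = _ := by ring
  have hf0 : f 0 ≤ 2^(n+1) * (vball n).toReal := by
    have h1 : volume {X ∈ ball (0:En n) (1+((K:ℝ)-(0:ℕ))*η) ×ˢ
        Ioo 0 (1+((K:ℝ)-(0:ℕ))*η) | M^0*c0 < u X} ≤ ENNReal.ofReal (2^(n+1)) * vball n := by
      refine (measure_mono (sep_subset _ _)).trans ?_
      rw [show 1+((K:ℝ)-(0:ℕ))*η = 2 by push_cast; linarith, vol_bx _ (by norm_num)]
      apply le_of_eq
      rw [mul_assoc, mul_comm (vball n), ← mul_assoc, ← ENNReal.ofReal_mul (by positivity)]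
      congr 2; ring
    have h2 := ENNReal.toReal_mono (ENNReal.mul_ne_top ENNReal.ofReal_ne_top (vball_ne_top n)) h1
    rwa [ENNReal.toReal_mul, ENNReal.toReal_ofReal (by positivity)] at h2
  have hfK : (vball n).toReal ≤ 2 * f K := by
    have hle : volume {X ∈ ball (0:En n) 1 ×ˢ Ioo 0 1 | 1/2 ≤ u X} ≤
        volume {X ∈ ball (0:En n) (1+((K:ℝ)-K)*η) ×ˢ
          Ioo 0 (1+((K:ℝ)-K)*η) | M^K*c0 < u X} := by
      refine measure_mono ?_
      rintro X ⟨hX1, hX2⟩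
      refine ⟨by simpa using hX1, ?_⟩
      show M^K*c0 < u X
      rw [show M^K*c0 = 1/4 by rw [hc0]; field_simp]
      have : (1/2:ℝ) ≤ u X := hX2
      linarith
    have hfin : volume {X ∈ ball (0:En n) (1+((K:ℝ)-K)*η) ×ˢ
          Ioo 0 (1+((K:ℝ)-K)*η) | M^K*c0 < u X} ≠ ⊤ := by
      refine ne_top_of_le_ne_top ?_ (measure_mono (sep_subset _ _))
      rw [Measure.volume_eq_prod, Measure.prod_prod]
      exact ENNReal.mul_ne_top measure_ball_lt_top.ne (by simp)
    have h2 := ENNReal.toReal_mono (ENNReal.mul_ne_top ENNReal.ofNat_ne_top hfin)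
      (hvol.trans (mul_le_mul_right hle _))
    rw [ENNReal.toReal_mul, ENNReal.toReal_ofNat] at h2
    exact h2
  have h1 := hiter K le_rfl
  have h2 : q^K * f 0 ≤ q^K * (2^(n+1) * (vball n).toReal) := by gcongr
  have h3 : q^K * (2^(n+1) * (vball n).toReal) < (2^(n+2))⁻¹ * (2^(n+1) * (vball n).toReal) := by
    gcongr
  have h4 : ((2:ℝ)^(n+2))⁻¹ * (2^(n+1) * (vball n).toReal) = (vball n).toReal/2 := by
    rw [pow_succ 2 (n+1)]; field_simp
  linarith

lemma good_ball (hn : 0 < n) {S ε0 : ℝ} (hε : 0 < ε0) {N : ℕ} (hN0 : 0 < N) (hN : S < N*ε0)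
    {a : ℝ} (ha : a = 1/(128*N)) (β : En n → ℝ≥0∞)
    (hint : ∫⁻ x in ball (0:En n) 2, β x ^ n ≤ ENNReal.ofReal S) :
    ∃ y : En n, ‖y‖ ≤ 1/8 ∧ ∫⁻ x in ball y (8*a), β x ^ n ≤ ENNReal.ofReal ε0 := by
  by_contra hcon
  push Not at hcon
  have hNr : (0:ℝ) < N := by exact_mod_cast hN0
  have ha0 : 0 < a := by rw [ha]; positivity
  have haN : a * N = 1/128 := by rw [ha]; field_simp
  let e : En n := EuclideanSpace.single ⟨0, hn⟩ 1
  have he : ‖e‖ = 1 := by simp [e]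
  let y : ℕ → En n := fun i => (16*a*i) • e
  have hy : ∀ i < N, ‖y i‖ ≤ 1/8 := by
    intro i hi
    have : (i:ℝ) ≤ N := by exact_mod_cast hi.le
    simp only [y]
    rw [norm_smul, he, Real.norm_of_nonneg (by positivity)]
    nlinarith
  have hdisj : (↑(Finset.range N) : Set ℕ).PairwiseDisjoint (fun i => ball (y i) (8*a)) := by
    intro i _ j _ hij
    apply ball_disjoint_ball
    simp only [y]
    rw [dist_eq_norm, ← sub_smul, norm_smul, he, ← mul_sub, norm_mul,
      Real.norm_of_nonneg (by positivity)]
    have : (1:ℝ) ≤ ‖(i:ℝ) - j‖ := by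
      have h1 : (1:ℤ) ≤ |(i:ℤ) - j| := Int.one_le_abs (by omega)
      rw [Real.norm_eq_abs]
      exact_mod_cast h1
    nlinarith
  have h1 : ∑ i ∈ Finset.range N, ∫⁻ x in ball (y i) (8*a), β x ^ n ≤
      ∫⁻ x in ball (0:En n) 2, β x ^ n := by
    rw [← lintegral_biUnion_finset hdisj (fun i _ => measurableSet_ball)]
    refine lintegral_mono_set (iUnion₂_subset fun i hi => ball_subset_ball' ?_)
    rw [dist_zero_right]
    have := hy i (Finset.mem_range.1 hi)
    have : (1:ℝ) ≤ N := by exact_mod_cast hN0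
    nlinarith
  have h2 : ∑ i ∈ Finset.range N, ENNReal.ofReal ε0 ≤
      ∑ i ∈ Finset.range N, ∫⁻ x in ball (y i) (8*a), β x ^ n :=
    Finset.sum_le_sum fun i hi => (hcon (y i) (hy i (Finset.mem_range.1 hi))).le
  have h3 := (h2.trans h1).trans hint
  rw [Finset.sum_const, Finset.card_range, nsmul_eq_mul, ← ENNReal.ofReal_natCast,
    ← ENNReal.ofReal_mul (by positivity)] at h3
  have hpos : 0 < (N:ℝ)*ε0 := by positivity
  rcases le_or_gt S 0 with hS | hS
  · rw [ENNReal.ofReal_of_nonpos hS] at h3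
    have := ENNReal.ofReal_pos.2 hpos
    exact absurd h3 (not_le.2 this)
  · rw [ENNReal.ofReal_le_ofReal_iff hS.le] at h3
    linarith

set_option maxHeartbeats 1000000 in
theorem lemF (hn : 0 < n) {ν : ℝ} (hν : 1 ≤ ν) (S : ℝ) : ∃ T2 δ' : ℝ, 1 < T2 ∧ 0 < δ' ∧ δ' < 1 ∧
    ∀ (β : En n → ℝ≥0∞) (u : En n × ℝ → ℝ), Measurable β →
      Super ν β u (ball (0:En n) 2 ×ˢ Ioo (-T2) 0) →
      Super ν β (fun X => 1 - u X) (ball (0:En n) 2 ×ˢ Ioo (-T2) 0) →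
      (∀ X ∈ ball (0:En n) 2 ×ˢ Ioo (-T2) 0, 0 ≤ u X ∧ u X ≤ 1) →
      ∫⁻ x in ball (0:En n) 2, β x ^ n ≤ ENNReal.ofReal S →
      (∀ X ∈ ball (0:En n) (1/8) ×ˢ Ioo (-1) 0, δ' ≤ u X) ∨
      (∀ X ∈ ball (0:En n) (1/8) ×ˢ Ioo (-1) 0, u X ≤ 1 - δ') := by
  obtain ⟨ε0, hε0, hD⟩ := lemD n hν
  obtain ⟨N', hN'⟩ := exists_nat_gt (S/ε0)
  set N := N' + 1 with hN
  have hN0 : 0 < N := by omega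
  have hNS : S < N*ε0 := by
    rw [div_lt_iff₀ hε0] at hN'
    rw [hN]; push_cast; nlinarith
  have hNr : (1:ℝ) ≤ N := by exact_mod_cast hN0
  set a : ℝ := 1/(128*N) with ha
  have ha0 : 0 < a := by positivity
  have ha1 : a ≤ 1/128 := by
    rw [ha]; gcongr; linarith
  obtain ⟨T, c, hT, hc, hE⟩ := lemE hn hν (show 0 < a/2 by positivity)
    (show a/2 < 1/4 by linarith) S
  obtain ⟨δ, hδ, hD⟩ := hD ((T+2)/a^2)
  have hasq : a^2 ≤ 1/128 := by nlinarith
  have hasq0 : 0 < a^2 := by positivity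
  refine ⟨T+3, min (c*δ) (1/2), by linarith, by positivity,
    lt_of_le_of_lt (min_le_right _ _) (by norm_num), ?_⟩
  intro β u hβ hs1 hs2 hu hint
  obtain ⟨y, hy, hyint⟩ := good_ball hn hε0 hN0 hNS ha β hint
  -- one sided lemma
  have key : ∀ w : En n × ℝ → ℝ, Super ν β w (ball (0:En n) 2 ×ˢ Ioo (-(T+3)) 0) →
      (∀ X ∈ ball (0:En n) 2 ×ˢ Ioo (-(T+3)) 0, 0 ≤ w X) →
      vball n ≤ 2 * volume {X ∈ ball (0:En n) 1 ×ˢ Ioo 0 1 | 1/2 ≤ w (psc y (-T-2) a X)} →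
      ∀ X ∈ ball (0:En n) (1/8) ×ˢ Ioo (-1) 0, min (c*δ) (1/2) ≤ w X := by
    intro w hw hw0 hvol
    have hQ : ∀ X ∈ ball (0:En n) 8 ×ˢ Ioo (-1) ((T+2)/a^2),
        psc y (-T-2) a X ∈ ball (0:En n) 2 ×ˢ Ioo (-(T+3)) 0 := by
      rintro X ⟨h1, h2⟩
      have h1' := mem_ball_zero_iff.1 h1
      have h3 : -1 < X.2 := h2.1
      have h4 : X.2 < (T+2)/a^2 := h2.2
      rw [lt_div_iff₀ hasq0] at h4
      refine ⟨mem_ball_zero_iff.2 ?_, ?_, ?_⟩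
      · show ‖y + a • X.1‖ < 2
        have := norm_add_le y (a • X.1)
        rw [norm_smul, Real.norm_of_nonneg ha0.le] at this
        nlinarith
      · show -(T+3) < -T-2 + a^2*X.2
        nlinarith
      · show -T-2 + a^2*X.2 < 0
        linarith
    have hsc := hw.scale y (-T-2) (r := a) (c := 1) 0 ha0 zero_le_one hQ
    have hlow := hD (fun x => ENNReal.ofReal a * β (y + a•x))
      (fun X => 1 * w (psc y (-T-2) a X) + 0)
      ((hβ.comp (by fun_prop)).const_mul _) hsc
      (fun X hX => by have := hw0 _ (hQ X hX); simpa using this)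
      (by rw [lint_scale hβ y ha0, mul_comm a 8]; exact hyint)
      (by simpa using hvol)
    have hlow2 : ∀ z : En n, ‖z‖ < a → ∀ t, -T-1 < t → t < 0 → δ ≤ w (y+z,t) := by
      intro z hz t ht1 ht2
      have h1 := hlow (a⁻¹ • z) (mem_ball_zero_iff.2 (by
        rw [norm_smul, Real.norm_of_nonneg (by positivity), inv_mul_lt_iff₀ ha0]; linarith))
        ((t+T+2)/a^2) ⟨by rw [le_div_iff₀ hasq0]; linarith, by
          rw [div_lt_div_iff_of_pos_right hasq0]; linarith⟩
      have h2 : psc y (-T-2) a (a⁻¹ • z, (t+T+2)/a^2) = (y+z, t) := by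
        simp only [psc, smul_smul, mul_inv_cancel₀ ha0.ne', one_smul]
        congr 1
        field_simp; ring
      rw [h2] at h1
      linarith
    have hQ1 : ∀ X ∈ ball (0:En n) 1 ×ˢ Ioo (-(T+3)) 0,
        psc y 0 1 X ∈ ball (0:En n) 2 ×ˢ Ioo (-(T+3)) 0 := by
      rintro X ⟨h1, h2⟩
      have h1' := mem_ball_zero_iff.1 h1
      refine ⟨mem_ball_zero_iff.2 ?_, by simpa [psc] using h2⟩
      show ‖y + (1:ℝ) • X.1‖ < 2
      rw [one_smul]
      linarith [norm_add_le y X.1]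
    have hsc1 := hw.scale y 0 (r := 1) (c := 1) 0 one_pos zero_le_one hQ1
    rintro ⟨x, ts⟩ ⟨hx, hts⟩
    have hx' : ‖x‖ < 1/8 := mem_ball_zero_iff.1 hx
    have hts1 : -1 < ts := hts.1
    have hts2 : ts < 0 := hts.2
    have hfin := hE (fun x => ENNReal.ofReal 1 * β (y + (1:ℝ)•x))
      (fun X => 1 * w (psc y 0 1 X) + 0) (-(T+3)) 0 ts δ
      ((hβ.comp (by fun_prop)).const_mul _) hsc1 (by linarith) hts2 hδ
      (fun X hX => by have := hw0 _ (hQ1 X hX); simpa using this)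
      (by
        rw [lint_scale hβ y one_pos]
        refine (lintegral_mono_set (ball_subset_ball' ?_)).trans hint
        rw [dist_zero_right]; linarith)
      (by
        intro z hz t ht
        have h1 := hlow2 z (by linarith) t (by linarith [ht.1]) (by linarith [ht.2])
        simpa [psc] using h1)
      (x - y) (by linarith [norm_sub_le x y])
    refine (min_le_left _ _).trans ?_
    simpa [psc] using hfin
  -- the dichotomy
  have hKvol : vball n ≤ volume {X ∈ ball (0:En n) 1 ×ˢ Ioo 0 1 | 1/2 ≤ u (psc y (-T-2) a X)} +
      volume {X ∈ ball (0:En n) 1 ×ˢ Ioo 0 1 | 1/2 ≤ 1 - u (psc y (-T-2) a X)} := by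
    have h1 : vball n = volume (ball (0:En n) 1 ×ˢ Ioo (0:ℝ) 1) := by
      rw [vol_bx _ one_pos]; simp
    rw [h1]
    refine le_trans (measure_mono ?_) (measure_union_le _ _)
    intro X hX
    rcases le_total (1/2) (u (psc y (-T-2) a X)) with h | h
    · exact Or.inl ⟨hX, h⟩
    · refine Or.inr ⟨hX, ?_⟩
      show 1/2 ≤ 1 - u (psc y (-T-2) a X)
      linarith
  rcases le_total (volume {X ∈ ball (0:En n) 1 ×ˢ Ioo 0 1 | 1/2 ≤ u (psc y (-T-2) a X)})
    (volume {X ∈ ball (0:En n) 1 ×ˢ Ioo 0 1 | 1/2 ≤ 1 - u (psc y (-T-2) a X)}) with h | h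
  · right
    intro X hX
    have := key (fun X => 1 - u X) hs2 (fun X hX => by linarith [(hu X hX).2]) (by
      rw [two_mul]; exact hKvol.trans (by gcongr)) X hX
    linarith
  · left
    exact key u hs1 (fun X hX => (hu X hX).1) (by
      rw [two_mul]; exact hKvol.trans (by gcongr))

/-- Spatial gradient. -/
def gradU (u : En n × ℝ → ℝ) (X : En n × ℝ) : En n := WithLp.toLp 2 fun i => Dx u i X

/-- Spatial Hessian. -/
def hessU (u : En n × ℝ → ℝ) (X : En n × ℝ) : En n →L[ℝ] En n :=
  ∑ i, (EuclideanSpace.proj i : En n →L[ℝ] ℝ).smulRight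
    (WithLp.toLp 2 fun j => Dxx u i j X : En n)

lemma hessU_apply (u : En n × ℝ → ℝ) (X : En n × ℝ) (v : En n) (j : Fin n) :
    (hessU u X v) j = ∑ i, v i * Dxx u i j X := by
  simp [hessU]

lemma clm_expand (L : En n →L[ℝ] ℝ) (v : En n) :
    L v = ∑ i, v i * L (EuclideanSpace.single i 1) := by
  conv_lhs => rw [en_sum v]
  simp

lemma IsC21.reg {u : En n × ℝ → ℝ} {Q : Set (En n × ℝ)} (h : IsC21 u Q) :
    Reg u (Dt u) (gradU u) (hessU u) Q where
  dt := fun X hX => (h.diff_t X hX).hasDerivAt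
  dx := fun X hX => (h.diff_x X hX).hasFDerivAt.congr_fderiv (by
    ext v
    rw [clm_expand, innerSL_apply_apply, PiLp.inner_apply]
    refine Finset.sum_congr rfl fun i _ => ?_
    simp [gradU, Dx])
  dxx := fun X hX => by
    rw [← hasFDerivWithinAt_univ, hasFDerivWithinAt_euclidean]
    intro j
    rw [hasFDerivWithinAt_univ]
    refine (h.diff_xx j X hX).hasFDerivAt.congr_fderiv ?_
    ext v
    rw [clm_expand]
    exact (hessU_apply u X v j).symm
  cu := h.cont
  cut := h.cont_t
  cG := by
    refine (PiLp.continuous_toLp 2 _).comp_continuousOn ?_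
    exact continuousOn_pi.2 fun i => h.cont_x i
  cH := by
    refine continuousOn_finsetSum _ fun i _ => ?_
    refine ((ContinuousLinearMap.smulRightL ℝ (En n) (En n)
      (EuclideanSpace.proj i : En n →L[ℝ] ℝ)).continuous).comp_continuousOn ?_
    refine (PiLp.continuous_toLp 2 _).comp_continuousOn ?_
    exact continuousOn_pi.2 fun j => h.cont_xx i j

lemma trA_hessU (A : Matrix (Fin n) (Fin n) ℝ) (u : En n × ℝ → ℝ) (X : En n × ℝ) :
    trA A (hessU u X) = ∑ i, ∑ j, A i j * Dxx u i j X := by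
  unfold trA
  refine Finset.sum_congr rfl fun i _ => Finset.sum_congr rfl fun j _ => ?_
  rw [hessU_apply]
  simp [Pi.single_apply]

lemma Reg.neg {u ut : En n × ℝ → ℝ} {G H Q} (h : Reg u ut G H Q) :
    Reg (fun X => - u X) (fun X => - ut X) (fun X => - G X) (fun X => - H X) Q where
  dt := fun X hX => (h.dt X hX).neg
  dx := fun X hX => ((h.dx X hX).neg).congr_fderiv (by rw [map_neg])
  dxx := fun X hX => (h.dxx X hX).neg
  cu := h.cu.neg
  cut := h.cut.neg
  cG := h.cG.neg
  cH := h.cH.neg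

/-- Set of elliptic matrices. -/
def EllSet (n : ℕ) (ν : ℝ) : Set (Matrix (Fin n) (Fin n) ℝ) := {A | Ell ν A}

lemma isCompact_EllSet {ν : ℝ} (hν : 0 ≤ ν) : IsCompact (EllSet n ν) := by
  have hK : IsCompact (Set.pi univ fun _ : Fin n => Set.pi univ fun _ : Fin n => Icc (-ν) ν) :=
    isCompact_univ_pi fun _ => isCompact_univ_pi fun _ => isCompact_Icc
  have hcl : IsClosed (EllSet n ν) := by
    have : EllSet n ν = (⋂ ξ : Fin n → ℝ, {A : Matrix (Fin n) (Fin n) ℝ |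
        ν⁻¹ * (∑ i, ξ i ^ 2) ≤ ∑ i, ∑ j, A i j * ξ i * ξ j}) ∩
        {A | (∑ i, ∑ j, (A i j) ^ 2) ≤ ν ^ 2} := by
      ext A
      simp only [EllSet, Ell, mem_ofPred_eq, mem_inter_iff, mem_iInter]
    rw [this]
    refine (isClosed_iInter fun ξ => isClosed_le continuous_const ?_).inter
      (isClosed_le ?_ continuous_const)
    · refine continuous_finsetSum _ fun i _ => continuous_finsetSum _ fun j _ => ?_
      exact ((continuous_id.matrix_elem i j).mul continuous_const).mul continuous_const
    · refine continuous_finsetSum _ fun i _ => continuous_finsetSum _ fun j _ => ?_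
      exact (continuous_id.matrix_elem i j).pow 2
  refine hK.of_isClosed_subset hcl ?_
  intro A hA i _ j _
  exact abs_le.1 (Ell.entry hν hA i j)

/-- Distance of `τ` to the range of `trA · L`. -/
def gap (ν : ℝ) (p : (En n →L[ℝ] En n) × ℝ) : ℝ :=
  sInf ((fun A => |trA A p.1 - p.2|) '' EllSet n ν)

lemma gap_cont {ν : ℝ} (hν : 0 ≤ ν) : Continuous (gap (n := n) ν) := by
  refine (isCompact_EllSet hν).continuous_sInf (f := fun (p : (En n →L[ℝ] En n) × ℝ) A =>
    |trA A p.1 - p.2|) ?_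
  have : Continuous fun q : ((En n →L[ℝ] En n) × ℝ) × Matrix (Fin n) (Fin n) ℝ =>
      |trA q.2 q.1.1 - q.1.2| := by
    refine continuous_abs.comp (Continuous.sub ?_ (by fun_prop))
    unfold trA
    refine continuous_finsetSum _ fun i _ => continuous_finsetSum _ fun j _ => ?_
    refine (continuous_snd.matrix_elem i j).mul ?_
    have h1 : Continuous fun q : ((En n →L[ℝ] En n) × ℝ) × Matrix (Fin n) (Fin n) ℝ =>
      q.1.1 (EuclideanSpace.single i 1) := by fun_prop
    exact (EuclideanSpace.proj j : En n →L[ℝ] ℝ).continuous.comp h1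
  exact this

lemma gap_le {ν : ℝ} (p : (En n →L[ℝ] En n) × ℝ) {A} (hA : Ell ν A) :
    gap ν p ≤ |trA A p.1 - p.2| :=
  csInf_le ⟨0, by rintro _ ⟨B, _, rfl⟩; positivity⟩ ⟨A, hA, rfl⟩

lemma gap_nonneg {ν : ℝ} (p : (En n →L[ℝ] En n) × ℝ) : 0 ≤ gap ν p :=
  Real.sInf_nonneg (by rintro _ ⟨B, _, rfl⟩; positivity)

lemma gap_attained {ν : ℝ} (hν : 0 ≤ ν) (p : (En n →L[ℝ] En n) × ℝ)
    (hne : ∃ A : Matrix (Fin n) (Fin n) ℝ, Ell ν A) :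
    ∃ A, Ell ν A ∧ |trA A p.1 - p.2| = gap ν p := by
  have hc : Continuous fun A : Matrix (Fin n) (Fin n) ℝ => |trA A p.1 - p.2| := by
    refine continuous_abs.comp (Continuous.sub ?_ (by fun_prop))
    unfold trA
    refine continuous_finsetSum _ fun i _ => continuous_finsetSum _ fun j _ => ?_
    exact (continuous_id.matrix_elem i j).mul continuous_const
  obtain ⟨A, hA, h⟩ := (isCompact_EllSet (n := n) hν).exists_sInf_image_eq hne hc.continuousOn
  exact ⟨A, hA, h.symm⟩

/-- The reduced drift ratio. -/
def gratio (ν : ℝ) (ut : En n × ℝ → ℝ) (G : En n × ℝ → En n) (H : En n × ℝ → En n →L[ℝ] En n)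
    (Q : Set (En n × ℝ)) (X : En n × ℝ) : ℝ :=
  Q.indicator (fun X => gap ν (H X, ut X)) X / Q.indicator (fun X => ‖G X‖) X

lemma indicator_meas {f : En n × ℝ → ℝ} {Q : Set (En n × ℝ)} (hQ : IsOpen Q)
    (hf : ContinuousOn f Q) : Measurable (Q.indicator f) := by
  classical
  rw [← Set.piecewise_eq_indicator]
  exact hf.measurable_piecewise continuousOn_const hQ.measurableSet

theorem stepA {ν : ℝ} (hν : 0 ≤ ν) {u : En n × ℝ → ℝ} {Q : Set (En n × ℝ)} (hQ : IsOpen Q)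
    (h : IsC21 u Q) {a : En n × ℝ → Matrix (Fin n) (Fin n) ℝ} {b : En n × ℝ → En n}
    (ha : UnifParabolic ν a Q) (heq : ∀ X ∈ Q, -Dt u X + Lop a b u X = 0) :
    ∃ β : En n → ℝ≥0∞, Measurable β ∧ Super ν β u Q ∧ Super ν β (fun X => - u X) Q ∧
      ∫⁻ x, β x ^ n ≤ LxnLtinfPow b Q := by
  have hreg := h.reg
  set ut := Dt u
  set G := gradU u
  set H := hessU u
  have hgc : ContinuousOn (fun X => gap ν (H X, ut X)) Q :=
    (gap_cont hν).comp_continuousOn (hreg.cH.prodMk hreg.cut)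
  have hGc : ContinuousOn (fun X => ‖G X‖) Q := hreg.cG.norm
  have hgm : Measurable (gratio ν ut G H Q) :=
    (indicator_meas hQ hgc).div (indicator_meas hQ hGc)
  have hgQ : ∀ X ∈ Q, gratio ν ut G H Q X = gap ν (H X, ut X) / ‖G X‖ := by
    intro X hX
    simp only [gratio, indicator_of_mem hX]
  have hgap : ∀ X ∈ Q, gap ν (H X, ut X) ≤ ‖b X‖ * ‖G X‖ := by
    intro X hX
    refine (gap_le _ (ha X hX)).trans ?_
    have h1 := heq X hX
    have h2 : ∑ i, b X i * Dx u i X = ⟪G X, b X⟫ := by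
      rw [PiLp.inner_apply]
      refine Finset.sum_congr rfl fun i _ => ?_
      simp [G, gradU]
    unfold Lop at h1
    rw [← trA_hessU, h2] at h1
    have h3 : trA (a X) (H X) - ut X = -⟪G X, b X⟫ := by
      show trA (a X) (hessU u X) - Dt u X = -⟪G X, b X⟫
      linarith
    simp only
    rw [h3, abs_neg, mul_comm]
    exact abs_real_inner_le_norm _ _
  have hgb : ∀ X ∈ Q, gratio ν ut G H Q X ≤ ‖b X‖ := by
    intro X hX
    rw [hgQ X hX]
    exact div_le_of_le_mul₀ (norm_nonneg _) (norm_nonneg _) (hgap X hX)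
  have hcAt : ∀ X, 0 < gratio ν ut G H Q X → X ∈ Q ∧ ContinuousAt (gratio ν ut G H Q) X := by
    intro X hpos
    have hX : X ∈ Q := by
      by_contra hX
      simp [gratio, indicator_of_notMem hX] at hpos
    refine ⟨hX, ?_⟩
    rw [hgQ X hX] at hpos
    have hG : ‖G X‖ ≠ 0 := by
      intro h0; rw [h0] at hpos; simp at hpos
    have h1 : ContinuousAt (fun X => gap ν (H X, ut X) / ‖G X‖) X :=
      (hgc.continuousAt (hQ.mem_nhds hX)).div (hGc.continuousAt (hQ.mem_nhds hX)) hG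
    refine h1.congr ?_
    filter_upwards [hQ.mem_nhds hX] with Z hZ
    exact (hgQ Z hZ).symm
  -- neighbourhoods in time
  have hnear : ∀ (x : En n) (t : ℝ) (m : ℝ≥0∞), m < ENNReal.ofReal (gratio ν ut G H Q (x,t)) →
      ∃ V : Set ℝ, IsOpen V ∧ t ∈ V ∧ ∀ t' ∈ V, (x,t') ∈ Q ∧
        m < ENNReal.ofReal (gratio ν ut G H Q (x,t')) := by
    intro x t m hm
    have hpos : 0 < gratio ν ut G H Q (x,t) := ENNReal.ofReal_pos.1 (lt_of_le_of_lt zero_le hm)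
    obtain ⟨hX, hcX⟩ := hcAt _ hpos
    have hpath : ContinuousAt (fun t' : ℝ => ((x,t') : En n × ℝ)) t := by fun_prop
    have h1 : ContinuousAt (fun t' => gratio ν ut G H Q (x,t')) t :=
      ContinuousAt.comp (f := fun t' : ℝ => ((x,t') : En n × ℝ)) hcX hpath
    have h2 : ContinuousAt (fun t' => ENNReal.ofReal (gratio ν ut G H Q (x,t'))) t :=
      ENNReal.continuous_ofReal.continuousAt.comp h1
    have h3 := (h2.eventually (lt_mem_nhds hm)).and (hpath.eventually (hQ.mem_nhds hX))
    obtain ⟨V, hV1, hV2, hV3⟩ := _root_.eventually_nhds_iff.1 h3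
    exact ⟨V, hV2, hV3, fun t' ht' => ⟨(hV1 t' ht').2, (hV1 t' ht').1⟩⟩
  let β : En n → ℝ≥0∞ := fun x => ⨆ q : ℚ, ENNReal.ofReal (gratio ν ut G H Q (x, (q:ℝ)))
  have hβm : Measurable β := Measurable.iSup fun q => by
    exact ENNReal.measurable_ofReal.comp (hgm.comp (by fun_prop))
  have hβge : ∀ X, ENNReal.ofReal (gratio ν ut G H Q X) ≤ β X.1 := by
    rintro ⟨x, t⟩
    by_contra hcon
    push Not at hcon
    obtain ⟨V, hVo, htV, hV⟩ := hnear x t _ hcon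
    obtain ⟨q, hq⟩ := (Rat.denseRange_cast (𝕜 := ℝ)).exists_mem_open hVo ⟨t, htV⟩
    exact absurd (le_iSup (fun q : ℚ => ENNReal.ofReal (gratio ν ut G H Q (x, (q:ℝ)))) q)
      (not_le.2 (hV _ hq).2)
  have hβle : ∀ x, β x ≤ essSup (fun t => (‖b (x, t)‖₊ : ℝ≥0∞))
      (volume.restrict {t | (x, t) ∈ Q}) := by
    intro x
    refine iSup_le fun q => ?_
    by_contra hcon
    push Not at hcon
    obtain ⟨V, hVo, htV, hV⟩ := hnear x q _ hcon
    have h1 := ENNReal.ae_le_essSup (μ := volume.restrict {t | (x, t) ∈ Q})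
      (fun t => (‖b (x, t)‖₊ : ℝ≥0∞))
    have hVpos : 0 < (volume.restrict {t | (x, t) ∈ Q}) V := by
      rw [Measure.restrict_eq_self _ (show V ⊆ {t | (x, t) ∈ Q} from fun t ht => (hV t ht).1)]
      exact hVo.measure_pos _ ⟨_, htV⟩
    have h2 : V ⊆ {t | ¬ (‖b (x, t)‖₊ : ℝ≥0∞) ≤ essSup (fun t => (‖b (x, t)‖₊ : ℝ≥0∞))
      (volume.restrict {t | (x, t) ∈ Q})} := by
      intro t ht
      show ¬ _
      rw [not_le]
      refine lt_of_lt_of_le (hV t ht).2 ?_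
      rw [← enorm_eq_nnnorm, ← ofReal_norm]
      exact ENNReal.ofReal_le_ofReal (hgb _ (hV t ht).1)
    have h3 := measure_mono_null h2 (ae_iff.1 h1)
    exact hVpos.ne' h3
  have hsup : ∀ X ∈ Q, ENNReal.ofReal (gap ν (H X, ut X)) ≤ β X.1 * ‖G X‖ₑ := by
    intro X hX
    refine le_trans (le_of_eq ?_) (mul_le_mul_left (hβge X) _)
    rw [hgQ X hX, ← ofReal_norm, ← ENNReal.ofReal_mul
      (div_nonneg (gap_nonneg _) (norm_nonneg _))]
    congr 1
    by_cases hG : ‖G X‖ = 0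
    · have h1 := hgap X hX
      rw [hG] at h1 ⊢
      have h2 := gap_nonneg (ν := ν) (H X, ut X)
      linarith
    · field_simp
  refine ⟨β, hβm, ⟨ut, G, H, hreg, fun X hX => ?_⟩,
    ⟨fun X => - ut X, fun X => - G X, fun X => - H X, hreg.neg, fun X hX => ?_⟩, ?_⟩
  · obtain ⟨A, hA, hA2⟩ := gap_attained hν (H X, ut X) ⟨a X, ha X hX⟩
    refine ⟨A, hA, le_trans (ENNReal.ofReal_le_ofReal ?_) (hsup X hX)⟩
    rw [← hA2]; exact le_abs_self _
  · obtain ⟨A, hA, hA2⟩ := gap_attained hν (H X, ut X) ⟨a X, ha X hX⟩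
    refine ⟨A, hA, ?_⟩
    rw [enorm_neg]
    refine le_trans (ENNReal.ofReal_le_ofReal ?_) (hsup X hX)
    rw [← hA2, trA_neg]
    have := neg_le_abs (trA A (H X) - ut X)
    simp only
    linarith
  · exact lintegral_mono fun x => pow_le_pow_left₀ zero_le (hβle x) n

lemma pcyl_open (Y : En n × ℝ) (r : ℝ) : IsOpen (pcyl Y r) := isOpen_ball.prod isOpen_Ioo

theorem osc_step (hn : 0 < n) {ν : ℝ} (hν : 1 ≤ ν) (S : ℝ) : ∃ θ q : ℝ, 0 < θ ∧ θ < 1 ∧ 0 < q ∧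
    q < 1 ∧ ∀ (β : En n → ℝ≥0∞) (u : En n × ℝ → ℝ) (Q : Set (En n × ℝ)), Measurable β →
      Super ν β u Q → Super ν β (fun X => - u X) Q → ∫⁻ x, β x ^ n ≤ ENNReal.ofReal S →
      ∀ (Z : En n × ℝ) (ρ A ω : ℝ), 0 < ρ → 0 < ω → pcyl Z ρ ⊆ Q →
        (∀ X ∈ pcyl Z ρ, A ≤ u X ∧ u X ≤ A + ω) →
        ∃ A', ∀ X ∈ pcyl Z (θ*ρ), A' ≤ u X ∧ u X ≤ A' + q*ω := by
  obtain ⟨T2, δ, hT2, hδ0, hδ1, hF⟩ := lemF hn hν S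
  set R0 := 1 + T2 with hR0
  have hR2 : 2 ≤ R0 := by linarith
  refine ⟨1/(8*R0), 1-δ, by positivity, by rw [div_lt_one (by positivity)]; linarith,
    by linarith, by linarith, ?_⟩
  intro β u Q hβ hs1 hs2 hint Z ρ A ω hρ hω hQ hu
  set σ := ρ/R0 with hσ
  have hσ0 : 0 < σ := by positivity
  have hσR : σ*R0 = ρ := by rw [hσ]; field_simp
  have hin : ∀ X ∈ ball (0:En n) 2 ×ˢ Ioo (-T2) 0, psc Z.1 Z.2 σ X ∈ pcyl Z ρ := by
    rintro X ⟨h1, h2⟩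
    have h1' := mem_ball_zero_iff.1 h1
    have h3 : -T2 < X.2 := h2.1
    have h4 : X.2 < 0 := h2.2
    refine ⟨?_, ?_, ?_⟩
    · show Z.1 + σ • X.1 ∈ ball Z.1 ρ
      rw [mem_ball, dist_eq_norm, add_sub_cancel_left, norm_smul, Real.norm_of_nonneg hσ0.le]
      nlinarith
    · show Z.2 - ρ^2 < Z.2 + σ^2*X.2
      have h5 : T2 ≤ R0^2 := by nlinarith
      have h6 : 0 < σ^2 := by positivity
      have h7 : ρ^2 = σ^2*R0^2 := by rw [← hσR]; ring
      nlinarith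
    · show Z.2 + σ^2*X.2 < Z.2
      have h6 : 0 < σ^2 := by positivity
      nlinarith
  have hin' : ∀ X ∈ ball (0:En n) 2 ×ˢ Ioo (-T2) 0, psc Z.1 Z.2 σ X ∈ Q := fun X hX => hQ (hin X hX)
  have hv1 := hs1.scale Z.1 Z.2 (r := σ) (c := ω⁻¹) (-(A*ω⁻¹)) hσ0 (by positivity) hin'
  have hv2 := hs2.scale Z.1 Z.2 (r := σ) (c := ω⁻¹) (1 + A*ω⁻¹) hσ0 (by positivity) hin'
  have hb : ∀ X ∈ ball (0:En n) 2 ×ˢ Ioo (-T2) 0,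
      0 ≤ ω⁻¹ * u (psc Z.1 Z.2 σ X) + -(A*ω⁻¹) ∧ ω⁻¹ * u (psc Z.1 Z.2 σ X) + -(A*ω⁻¹) ≤ 1 := by
    intro X hX
    obtain ⟨h1, h2⟩ := hu _ (hin X hX)
    have h3 : ω⁻¹ * u (psc Z.1 Z.2 σ X) + -(A*ω⁻¹) = (u (psc Z.1 Z.2 σ X) - A)/ω := by
      field_simp; ring
    rw [h3, div_le_one hω]
    exact ⟨div_nonneg (by linarith) hω.le, by linarith⟩
  have hres := hF (fun x => ENNReal.ofReal σ * β (Z.1 + σ•x))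
    (fun X => ω⁻¹ * u (psc Z.1 Z.2 σ X) + -(A*ω⁻¹)) ((hβ.comp (by fun_prop)).const_mul _) hv1
    (by
      have h1 : (fun X => 1 - (ω⁻¹ * u (psc Z.1 Z.2 σ X) + -(A*ω⁻¹))) =
        (fun X => ω⁻¹ * (- u (psc Z.1 Z.2 σ X)) + (1 + A*ω⁻¹)) := by
        funext X; ring
      rw [h1]; exact hv2) hb
    (by
      rw [lint_scale hβ Z.1 hσ0]
      exact (setLIntegral_le_lintegral _ _).trans hint)
  have hpull : ∀ X ∈ pcyl Z (1/(8*R0)*ρ), ∃ W ∈ ball (0:En n) (1/8) ×ˢ Ioo (-1:ℝ) 0,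
      psc Z.1 Z.2 σ W = X := by
    rintro X ⟨h1, h2⟩
    have hθρ : 1/(8*R0)*ρ = σ/8 := by rw [hσ]; field_simp
    rw [hθρ] at h1 h2
    have h3 : Z.2 - (σ/8)^2 < X.2 := h2.1
    have h4 : X.2 < Z.2 := h2.2
    have h6 : 0 < σ^2 := by positivity
    refine ⟨(σ⁻¹ • (X.1 - Z.1), (X.2 - Z.2)/σ^2), ⟨?_, ?_, ?_⟩, ?_⟩
    · rw [mem_ball_zero_iff]
      simp only
      rw [norm_smul, Real.norm_of_nonneg (by positivity), inv_mul_lt_iff₀ hσ0, ← dist_eq_norm]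
      have := mem_ball.1 h1
      linarith
    · show -1 < (X.2 - Z.2)/σ^2
      rw [lt_div_iff₀ h6]
      nlinarith
    · show (X.2 - Z.2)/σ^2 < 0
      exact div_neg_of_neg_of_pos (by linarith) h6
    · simp only [psc, smul_smul, mul_inv_cancel₀ hσ0.ne', one_smul]
      ext1
      · simp
      · simp only; field_simp; ring
  have hsubs : ∀ X ∈ pcyl Z (1/(8*R0)*ρ), X ∈ pcyl Z ρ := by
    intro X hX
    obtain ⟨W, hW, rfl⟩ := hpull X hX
    refine hin W ⟨ball_subset_ball (by norm_num) hW.1, ?_, hW.2.2⟩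
    show -T2 < W.2
    linarith [hW.2.1]
  rcases hres with h | h
  · refine ⟨A + δ*ω, fun X hX => ?_⟩
    have hX2 := hu X (hsubs X hX)
    obtain ⟨W, hW, rfl⟩ := hpull X hX
    have h1 := h W hW
    have h3 : ω⁻¹ * u (psc Z.1 Z.2 σ W) + -(A*ω⁻¹) = (u (psc Z.1 Z.2 σ W) - A)/ω := by
      field_simp; ring
    rw [h3, le_div_iff₀ hω] at h1
    constructor <;> linarith
  · refine ⟨A, fun X hX => ?_⟩
    have hX2 := hu X (hsubs X hX)
    obtain ⟨W, hW, rfl⟩ := hpull X hX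
    have h1 := h W hW
    have h3 : ω⁻¹ * u (psc Z.1 Z.2 σ W) + -(A*ω⁻¹) = (u (psc Z.1 Z.2 σ W) - A)/ω := by
      field_simp; ring
    rw [h3, div_le_iff₀ hω] at h1
    exact ⟨hX2.1, by linarith⟩

theorem holder_num {θ q : ℝ} (hθ : 0 < θ) (hθ1 : θ < 1) (hq : 0 < q) (hq1 : q < 1) :
    ∃ α : ℝ, 0 < α ∧ α < 1 ∧ ∀ (D d r m : ℝ), 0 < r → 0 ≤ m → 0 < d → D ≤ 2*m →
      (∀ k : ℕ, d < r/2*θ^k → D ≤ q^k*(2*m)) → D ≤ 4/q*m*(d/r)^α := by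
  have hlθ : Real.log θ < 0 := Real.log_neg hθ hθ1
  have hlq : Real.log q < 0 := Real.log_neg hq hq1
  set α := min (Real.log q/Real.log θ) (1/2) with hα
  have hα0 : 0 < α := lt_min (div_pos_of_neg_of_neg hlq hlθ) (by norm_num)
  have hα1 : α < 1 := lt_of_le_of_lt (min_le_right _ _) (by norm_num)
  have hqθ : q ≤ θ^α := by
    have h1 : α * Real.log θ ≥ Real.log q := by
      have : α ≤ Real.log q/Real.log θ := min_le_left _ _
      rw [le_div_iff_of_neg hlθ] at this
      linarith
    rw [Real.rpow_def_of_pos hθ, ← Real.exp_log hq]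
    apply Real.exp_le_exp.2
    linarith
  refine ⟨α, hα0, hα1, ?_⟩
  intro D d r m hr hm hd hD0 hD
  classical
  have hdr : 0 < d/r := by positivity
  have hex : ∃ k : ℕ, ¬ (d < r/2*θ^k) := by
    obtain ⟨k, hk⟩ := exists_pow_lt_of_lt_one (show 0 < d/(r/2) by positivity) hθ1
    refine ⟨k, ?_⟩
    rw [lt_div_iff₀ (by positivity)] at hk
    linarith
  have hs := Nat.find_spec hex
  have hmin : ∀ j < Nat.find hex, ¬ ¬ (d < r/2*θ^j) := fun j hj => Nat.find_min hex hj
  set k := Nat.find hex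
  push Not at hs
  have hqk : q^k ≤ (2*(d/r))^α := by
    calc q^k ≤ (θ^α)^k := by gcongr
      _ = (θ^k)^α := by rw [← Real.rpow_mul_natCast hθ.le, mul_comm, Real.rpow_natCast_mul hθ.le]
      _ ≤ (2*(d/r))^α := by
        refine Real.rpow_le_rpow (by positivity) ?_ hα0.le
        rw [← mul_div_assoc, le_div_iff₀ hr]
        linarith
  have h2α : (2*(d/r))^α ≤ 2*(d/r)^α := by
    rw [Real.mul_rpow (by norm_num) hdr.le]
    have : (2:ℝ)^α ≤ 2 := by
      calc (2:ℝ)^α ≤ 2^(1:ℝ) := Real.rpow_le_rpow_of_exponent_le (by norm_num) hα1.le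
        _ = 2 := by norm_num
    have h3 : 0 ≤ (d/r)^α := by positivity
    nlinarith
  have hDk : D ≤ q⁻¹*q^k*(2*m) := by
    rcases Nat.eq_zero_or_pos k with h0 | h0
    · rw [h0, pow_zero, mul_one]
      have : 1 ≤ q⁻¹ := (one_le_inv₀ hq).2 hq1.le
      nlinarith
    · obtain ⟨j, hj⟩ := Nat.exists_eq_succ_of_ne_zero h0.ne'
      have h1 := hD j (not_not.1 (hmin j (by omega)))
      rw [hj, Nat.succ_eq_add_one, pow_succ]
      refine h1.trans (le_of_eq ?_)
      field_simp
  calc D ≤ q⁻¹*q^k*(2*m) := hDk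
    _ ≤ q⁻¹*(2*(d/r)^α)*(2*m) := by gcongr; exact hqk.trans h2α
    _ = _ := by field_simp; ring

/-- **Interior Hölder continuity of solutions** (Theorem 6.2). -/
theorem interior_holder_continuity
    (n : ℕ) (hn : 0 < n) (ν S : ℝ) (hν : 1 ≤ ν) :
    ∃ α N : ℝ, α ∈ Set.Ioo (0 : ℝ) 1 ∧ 0 < N ∧
      ∀ (Y : En n × ℝ) (r : ℝ) (u : En n × ℝ → ℝ)
        (a : En n × ℝ → Matrix (Fin n) (Fin n) ℝ) (b : En n × ℝ → En n),
        0 < r →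
        IsC21 u (pcyl Y r) →
        ContinuousOn u (closure (pcyl Y r)) →
        UnifParabolic ν a (pcyl Y r) →
        LxnLtinfPow b (pcyl Y r) ≤ ENNReal.ofReal S →
        (∀ X ∈ pcyl Y r, -Dt u X + Lop a b u X = 0) →
        ∀ X ∈ pcyl Y (r / 2), ∀ X' ∈ pcyl Y (r / 2),
          |u X - u X'| ≤
            N * sSup ((fun Z => |u Z|) '' pcyl Y r) *
              ((dist X.1 X'.1 + Real.sqrt |X.2 - X'.2|) / r) ^ α := by
  obtain ⟨θ, q, hθ, hθ1, hq, hq1, hstep⟩ := osc_step hn hν S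
  obtain ⟨α, hα, hα1, hnum⟩ := holder_num hθ hθ1 hq hq1
  refine ⟨α, 4/q, ⟨hα, hα1⟩, by positivity, ?_⟩
  intro Y r u a b hr hC hcl ha hb heq
  obtain ⟨β, hβ, hs1, hs2, hβi⟩ := stepA (by linarith) (pcyl_open Y r) hC ha heq
  have hβS := hβi.trans hb
  have hbdd : BddAbove ((fun Z => |u Z|) '' pcyl Y r) := by
    have hcomp : IsCompact (closure (pcyl Y r)) := by
      have hbd : Bornology.IsBounded (pcyl Y r) := isBounded_ball.prod (isBounded_Ioo _ _)
      exact hbd.isCompact_closure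
    exact (hcomp.bddAbove_image (continuous_abs.comp_continuousOn hcl)).mono
      (image_mono subset_closure)
  set m := sSup ((fun Z => |u Z|) '' pcyl Y r) with hm
  have hum : ∀ X ∈ pcyl Y r, |u X| ≤ m := fun X hX => le_csSup hbdd ⟨X, hX, rfl⟩
  have hsubY : pcyl Y (r/2) ⊆ pcyl Y r := by
    rintro X ⟨h1, h2⟩
    refine ⟨ball_subset_ball (by linarith) h1, ?_, h2.2⟩
    have h3 : Y.2 - (r/2)^2 < X.2 := h2.1
    show Y.2 - r^2 < X.2
    nlinarith
  have main : ∀ X ∈ pcyl Y (r/2), ∀ X' ∈ pcyl Y (r/2), X'.2 ≤ X.2 →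
      |u X - u X'| ≤ 4/q * m * ((dist X.1 X'.1 + Real.sqrt |X.2 - X'.2|) / r) ^ α := by
    intro X hX X' hX' htt
    have hm0 : 0 ≤ m := (abs_nonneg _).trans (hum X (hsubY hX))
    have hDm : |u X - u X'| ≤ 2*m := by
      have h1 := abs_le.1 (hum X (hsubY hX))
      have h2 := abs_le.1 (hum X' (hsubY hX'))
      rw [abs_le]; constructor <;> linarith
    set d := dist X.1 X'.1 + Real.sqrt |X.2 - X'.2| with hd
    have hd0 : 0 ≤ d := by positivity
    rcases hm0.eq_or_lt with hm00 | hmpos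
    · rw [← hm00] at hDm ⊢
      simpa using hDm
    rcases hd0.eq_or_lt with hd00 | hdpos
    · have h1 : dist X.1 X'.1 = 0 := by
        have := Real.sqrt_nonneg |X.2 - X'.2|
        have := dist_nonneg (x := X.1) (y := X'.1)
        linarith
      have h2 : Real.sqrt |X.2 - X'.2| = 0 := by linarith
      rw [Real.sqrt_eq_zero (abs_nonneg _), abs_eq_zero, sub_eq_zero] at h2
      have h3 : X = X' := Prod.ext (dist_eq_zero.1 h1) h2
      rw [h3, sub_self, abs_zero]
      positivity
    refine hnum _ d r m hr hm0 hdpos hDm ?_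
    intro k hk
    have hx1 : dist X.1 X'.1 ≤ d := by
      have := Real.sqrt_nonneg |X.2 - X'.2|
      linarith
    have hx2 : Real.sqrt |X.2 - X'.2| ≤ d := by
      have := dist_nonneg (x := X.1) (y := X'.1)
      linarith
    have hx3 : X.2 - X'.2 < (r/2*θ^k)^2 := by
      have h1 : |X.2 - X'.2| = Real.sqrt |X.2 - X'.2| ^ 2 := (Real.sq_sqrt (abs_nonneg _)).symm
      have h2 : Real.sqrt |X.2 - X'.2| ^ 2 < (r/2*θ^k)^2 :=
        pow_lt_pow_left₀ (by linarith) (Real.sqrt_nonneg _) (by norm_num)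
      linarith [le_abs_self (X.2 - X'.2)]
    have hXs : X.2 < Y.2 := hX.2.2
    have hXb : Y.2 - (r/2)^2 < X.2 := hX.2.1
    have hX'b : Y.2 - (r/2)^2 < X'.2 := hX'.2.1
    set ι := min (Y.2 - X.2) (((r/2*θ^k)^2 - (X.2 - X'.2))/2) with hι
    have hι0 : 0 < ι := lt_min (by linarith) (by linarith)
    have hι1 : ι ≤ Y.2 - X.2 := min_le_left _ _
    have hι2 : ι ≤ ((r/2*θ^k)^2 - (X.2 - X'.2))/2 := min_le_right _ _
    have hZ : pcyl (X.1, X.2 + ι) (r/2) ⊆ pcyl Y r := by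
      rintro W ⟨h1, h2⟩
      have h1' : dist W.1 X.1 < r/2 := h1
      have h2' : X.2 + ι - (r/2)^2 < W.2 := h2.1
      have h3' : W.2 < X.2 + ι := h2.2
      have h4' : dist X.1 Y.1 < r/2 := hX.1
      refine ⟨?_, ?_, ?_⟩
      · show dist W.1 Y.1 < r
        linarith [dist_triangle W.1 X.1 Y.1]
      · show Y.2 - r^2 < W.2
        nlinarith
      · show W.2 < Y.2
        linarith
    have hosc : ∀ j : ℕ, ∃ A, ∀ W ∈ pcyl (X.1, X.2 + ι) (r/2*θ^j),
        A ≤ u W ∧ u W ≤ A + q^j*(2*m) := by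
      intro j
      induction j with
      | zero =>
        refine ⟨-m, fun W hW => ?_⟩
        have := abs_le.1 (hum W (hZ (by simpa using hW)))
        constructor <;> linarith
      | succ j ih =>
        obtain ⟨A, hA⟩ := ih
        have hsubj : pcyl (X.1, X.2 + ι) (r/2*θ^j) ⊆ pcyl Y r := by
          refine Subset.trans ?_ hZ
          have hθj : θ^j ≤ 1 := pow_le_one₀ hθ.le hθ1.le
          have hθj0 : 0 < θ^j := by positivity
          have hle : r/2*θ^j ≤ r/2 := by nlinarith
          rintro W ⟨h1, h2⟩
          refine ⟨ball_subset_ball hle h1, ?_, h2.2⟩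
          have h3 : X.2 + ι - (r/2*θ^j)^2 < W.2 := h2.1
          show X.2 + ι - (r/2)^2 < W.2
          have h4 : (r/2*θ^j)^2 ≤ (r/2)^2 := by gcongr
          linarith
        obtain ⟨A', hA'⟩ := hstep β u (pcyl Y r) hβ hs1 hs2 hβS (X.1, X.2+ι) (r/2*θ^j) A
          (q^j*(2*m)) (by positivity) (by positivity) hsubj hA
        refine ⟨A', fun W hW => ?_⟩
        have := hA' W (by rw [show θ*(r/2*θ^j) = r/2*θ^(j+1) by ring]; exact hW)
        rw [show q*(q^j*(2*m)) = q^(j+1)*(2*m) by ring] at this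
        exact this
    obtain ⟨A, hA⟩ := hosc k
    have hθk : 0 < r/2*θ^k := by positivity
    have hXm := hA X ⟨mem_ball_self hθk, by
      show X.2 + ι - (r/2*θ^k)^2 < X.2
      linarith, by
      show X.2 < X.2 + ι
      linarith⟩
    have hXm' := hA X' ⟨by
      show dist X'.1 X.1 < r/2*θ^k
      rw [dist_comm]; linarith, by
      show X.2 + ι - (r/2*θ^k)^2 < X'.2
      linarith, by
      show X'.2 < X.2 + ι
      linarith⟩
    rw [abs_le]
    constructor <;> linarith [hXm.1, hXm.2, hXm'.1, hXm'.2]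
  intro X hX X' hX'
  rcases le_total X'.2 X.2 with h | h
  · exact main X hX X' hX' h
  · have := main X' hX' X hX h
    rwa [abs_sub_comm, dist_comm, abs_sub_comm X'.2] at this
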